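/- Let n = n_T be a nilradical in a complex simple Lie algebra g that admits a commutative polarisation. Then S(n) is a free module over S(n)^U, where U = exp(u). -/

import Mathlib

open Module LieAlgebra
open scoped Classical

set_option synthInstance.maxHeartbeats 1000000
set_option maxHeartbeats 1000000

noncomputable section

/-! ### Generalities: coadjoint stabilisers, index, Frobenius semiradical -/

/-- The stabiliser `q^ξ = {x : q | ξ([x, q]) = 0}` of `ξ ∈ q*` for the coadjoint
representation of a Lie algebra `q`. -/
def coadStab (𝕜 : Type*) (Q : Type*) [CommRing 𝕜] [LieRing Q] [LieAlgebra 𝕜 Q]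
    (ξ : Module.Dual 𝕜 Q) : Submodule 𝕜 Q where
  carrier := {x | ∀ y, ξ ⁅x, y⁆ = 0}
  add_mem' := by
    intro a b ha hb y
    rw [Set.mem_setOf_eq] at ha hb
    rw [add_lie, map_add, ha y, hb y, add_zero]
  zero_mem' := by intro y; rw [zero_lie, map_zero]
  smul_mem' := by
    intro c x hx y
    rw [Set.mem_setOf_eq] at hx
    rw [smul_lie, map_smul, hx y, smul_zero]

/-- The index of a Lie algebra: the minimal dimension of a coadjoint stabiliser. -/
def lieIndex (𝕜 : Type*) (Q : Type*) [CommRing 𝕜] [LieRing Q] [LieAlgebra 𝕜 Q] : ℕ :=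
  ⨅ ξ : Module.Dual 𝕜 Q, Module.finrank 𝕜 (coadStab 𝕜 Q ξ)

/-- `ξ ∈ q*` is regular if its stabiliser has minimal dimension. -/
def IsRegularDual (𝕜 : Type*) (Q : Type*) [CommRing 𝕜] [LieRing Q] [LieAlgebra 𝕜 Q]
    (ξ : Module.Dual 𝕜 Q) : Prop :=
  Module.finrank 𝕜 (coadStab 𝕜 Q ξ) = lieIndex 𝕜 Q

/-- The Frobenius semiradical `F(q) = Σ_{ξ regular} q^ξ`. -/
def frobeniusSemiradical (𝕜 : Type*) (Q : Type*) [CommRing 𝕜] [LieRing Q] [LieAlgebra 𝕜 Q] :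
    Submodule 𝕜 Q :=
  ⨆ ξ : {ξ : Module.Dual 𝕜 Q // IsRegularDual 𝕜 Q ξ}, coadStab 𝕜 Q ξ.1

/-! ### Zariski topology on a complex vector space -/

/-- The Zariski topology on a complex vector space: generated by the complements of zero
sets of polynomial functions (elements of the subalgebra of functions generated by the
linear functionals). -/
def zariskiTop (V : Type*) [AddCommGroup V] [Module ℂ V] : TopologicalSpace V :=
  TopologicalSpace.generateFrom
    {U : Set V | ∃ p ∈ Algebra.adjoin ℂ (Set.range fun l : Module.Dual ℂ V => (l : V → ℂ)),
      U = {v | p v ≠ 0}}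

/-- Zariski-open subset of a complex vector space. -/
def zOpen {V : Type*} [AddCommGroup V] [Module ℂ V] (s : Set V) : Prop :=
  (zariskiTop V).IsOpen s

/-- Zariski-dense subset of a complex vector space. -/
def zDense {V : Type*} [AddCommGroup V] [Module ℂ V] (s : Set V) : Prop :=
  @Dense V (zariskiTop V) s

/-- The dimension of a subset of a complex vector space: the (topological) Krull dimension
with respect to the Zariski topology. -/
def zDim {V : Type*} [AddCommGroup V] [Module ℂ V] (s : Set V) : WithBot ℕ∞ :=
  letI := zariskiTop V
  topologicalKrullDim s

/-! ### Exponentials and stabilisers in the concrete model `n* ≅ n⁻` -/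

/-- The (truncated) exponential of a nilpotent endomorphism. For `x` in a nilradical `n`,
`nilExp (ad x)` is the adjoint action of the element `exp x` of the unipotent group
`N = exp(n)`; since `exp : n → N` is bijective, every element of `N` is of this form. -/
def nilExp {L : Type*} [AddCommGroup L] [Module ℂ L] (f : Module.End ℂ L) : Module.End ℂ L :=
  ∑ i ∈ Finset.range (Module.finrank ℂ L + 1), ((i.factorial : ℂ)⁻¹) • f ^ i

/-- For `v ∈ n⁻ ≅ n*`, the stabiliser of the linear functional `κ(v, ·)|_n` inside a (possibly
larger) subalgebra `q`, namely `{x ∈ q | κ(v, [x, n]) = 0}`, where `κ` is the Killing form.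
For `q = n` this is the coadjoint stabiliser `n^v`. -/
def killStab {L : Type*} [LieRing L] [LieAlgebra ℂ L] (v : L) (n q : LieSubalgebra ℂ L) :
    Submodule ℂ L where
  carrier := {x | x ∈ q ∧ ∀ y ∈ n, killingForm ℂ L v ⁅x, y⁆ = 0}
  add_mem' := by
    rintro a b ⟨ha, ha'⟩ ⟨hb, hb'⟩
    refine ⟨q.add_mem ha hb, fun y hy => ?_⟩
    rw [add_lie, map_add, ha' y hy, hb' y hy, add_zero]
  zero_mem' := ⟨q.zero_mem, fun y hy => by rw [zero_lie, map_zero]⟩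
  smul_mem' := by
    rintro c x ⟨hx, hx'⟩
    refine ⟨q.smul_mem c hx, fun y hy => ?_⟩
    rw [smul_lie, map_smul, hx' y hy, smul_zero]

/-! ### Triangular decompositions, root data and the Kostant cascade -/

/-- The support of a root (in simple-root coordinates). -/
def fsupp {SR : Type*} [Fintype SR] (γ : SR → ℤ) : Finset SR :=
  Finset.univ.filter fun a => γ a ≠ 0

/-- The data of a triangular decomposition of a complex simple Lie algebra `L`:
a Cartan subalgebra, a root-space decomposition indexed by the coordinates of the
roots with respect to the simple roots `SR`, the highest root, and a compatible
family of projections onto sums of root spaces. -/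
structure TriangularData (L : Type*) [LieRing L] [LieAlgebra ℂ L]
    (SR : Type*) [Fintype SR] [DecidableEq SR] where
  /-- the set of all roots, written in simple-root coordinates -/
  R : Finset (SR → ℤ)
  /-- the root space attached to `γ`; `rs 0` is the Cartan subalgebra, `rs γ = ⊥` off roots -/
  rs : (SR → ℤ) → Submodule ℂ L
  /-- the Cartan subalgebra `t` -/
  cartan : LieSubalgebra ℂ L
  rs_zero : rs 0 = cartan.toSubmodule
  rs_dim : ∀ γ ∈ R, Module.finrank ℂ (rs γ) = 1
  rs_bot : ∀ γ : SR → ℤ, γ ≠ 0 → γ ∉ R → rs γ = ⊥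
  root_ne_zero : ∀ γ ∈ R, γ ≠ 0
  root_neg : ∀ γ ∈ R, -γ ∈ R
  root_pos_or_neg : ∀ γ ∈ R, (∀ a, 0 ≤ γ a) ∨ (∀ a, γ a ≤ 0)
  root_single : ∀ a : SR, Pi.single a 1 ∈ R
  /-- the highest root `θ` -/
  theta : SR → ℤ
  theta_mem : theta ∈ R
  theta_highest : ∀ γ ∈ R, γ ≤ theta
  bracket_mem : ∀ γ δ : SR → ℤ, ∀ x ∈ rs γ, ∀ y ∈ rs δ, ⁅x, y⁆ ∈ rs (γ + δ)
  isInternal : DirectSum.IsInternal (fun γ : {γ : SR → ℤ // γ = 0 ∨ γ ∈ R} => rs γ.1)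
  /-- `proj S` is the projection onto `⊕_{γ ∈ S} rs γ` along `⊕_{γ ∉ S} rs γ` -/
  proj : Set (SR → ℤ) → (L →ₗ[ℂ] L)
  proj_mem : ∀ (S : Set (SR → ℤ)) (x : L), proj S x ∈ ⨆ γ ∈ S, rs γ
  proj_compl : ∀ (S : Set (SR → ℤ)) (x : L), x - proj S x ∈ ⨆ γ ∈ Sᶜ, rs γ

namespace TriangularData

variable {L : Type*} [LieRing L] [LieAlgebra ℂ L]
  {SR : Type*} [Fintype SR] [DecidableEq SR]
  (td : TriangularData L SR)

/-- The set `Δ⁺` of positive roots. -/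
def posR : Finset (SR → ℤ) := td.R.filter fun γ => ∀ a, 0 ≤ γ a

/-- The set of roots `Δ(n_T)` of the nilradical `n_T` attached to a set `T` of simple
roots: the positive roots having a strictly positive coefficient on some element of `T`. -/
def nilRoots (T : Finset SR) : Finset (SR → ℤ) :=
  td.posR.filter fun γ => ∃ a ∈ T, 0 < γ a

/-- The nilradical `n_T` of the standard parabolic subalgebra `p_T`. -/
def nilrad (T : Finset SR) : LieSubalgebra ℂ L :=
  LieSubalgebra.lieSpan ℂ L (⋃ γ ∈ (td.nilRoots T : Set (SR → ℤ)), (td.rs γ : Set L))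

/-- The Borel subalgebra `b = t ⊕ u` (as a subspace). -/
def borelSub : Submodule ℂ L :=
  td.rs 0 ⊔ ⨆ γ ∈ (td.posR : Set (SR → ℤ)), td.rs γ

/-- The parabolic subalgebra `p_T` (as a subspace): everything except `n_T⁻`. -/
def parabSub (T : Finset SR) : Submodule ℂ L :=
  td.rs 0 ⊔ ⨆ γ ∈ {γ : SR → ℤ | γ ∈ td.R ∧ -γ ∉ td.nilRoots T}, td.rs γ

/-- The set of roots of the opposite nilradical `n_T⁻`. -/
def negSet (T : Finset SR) : Set (SR → ℤ) := (fun γ => -γ) '' (td.nilRoots T : Set (SR → ℤ))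

/-- The opposite nilradical `n_T⁻ ⊆ u⁻`, which is identified with `n_T*` via the
Killing form and the decomposition `g = p_T ⊕ n_T⁻`. -/
def negNilSub (T : Finset SR) : Submodule ℂ L := ⨆ γ ∈ td.negSet T, td.rs γ

/-- The Heisenberg subset `H_β` attached to a positive root `β`: the positive roots in
the root subsystem generated by `supp β` that are not orthogonal to `β`. -/
def heisRoots (β : SR → ℤ) : Finset (SR → ℤ) :=
  td.posR.filter fun γ => fsupp γ ⊆ fsupp β ∧ (γ = β ∨ β - γ ∈ td.R)

/-- `Φ(β) = Π ∩ H_β`. -/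
def Phi (β : SR → ℤ) : Finset SR :=
  Finset.univ.filter fun a => Pi.single a 1 ∈ td.heisRoots β

/-- `K` is the Kostant cascade: a maximal set of pairwise strongly orthogonal positive
roots, containing the highest root, such that each `β ∈ K` is the highest root of the root
subsystem generated by its support and such that the attached Heisenberg subsets
partition `Δ⁺`. -/
structure IsCascade (K : Finset (SR → ℤ)) : Prop where
  subset_pos : K ⊆ td.posR
  theta_mem : td.theta ∈ K
  strong_orth : ∀ β ∈ K, ∀ β' ∈ K, β ≠ β' → β + β' ∉ td.R ∧ β - β' ∉ td.R
  highest : ∀ β ∈ K, ∀ γ ∈ td.posR, fsupp γ ⊆ fsupp β → γ ≤ β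
  partition : ∀ γ ∈ td.posR, ∃! β, β ∈ K ∧ γ ∈ td.heisRoots β

/-- `K(n_T) = K ∩ Δ(n_T)`. -/
def cascadeK (K : Finset (SR → ℤ)) (T : Finset SR) : Finset (SR → ℤ) := K ∩ td.nilRoots T

/-- The set of simple roots of the optimisation of `n_T`, namely
`T̃ = ⋃_{β ∈ K(n_T)} Φ(β)`; the optimisation of `n_T` is `n_{T̃}`. -/
def optT (K : Finset (SR → ℤ)) (T : Finset SR) : Finset SR :=
  (td.cascadeK K T).biUnion td.Phi

/-- The cascade subspace `E = ⊕_{β ∈ K(n_T)} g_{−β} ⊆ n_T⁻ ≅ n_T*`. -/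
def cascadeSub (K : Finset (SR → ℤ)) (T : Finset SR) : Submodule ℂ L :=
  ⨆ β ∈ (td.cascadeK K T : Set (SR → ℤ)), td.rs (-β)

/-- `v = Σ_{β ∈ K(n_T)} e_{−β}` with all `e_{−β} ∈ g_{−β}` nonzero is a cascade point
of `n_T⁻ ≅ n_T*`. -/
def IsCascadePoint (K : Finset (SR → ℤ)) (T : Finset SR) (v : L) : Prop :=
  ∃ e : (SR → ℤ) → L,
    (∀ β ∈ td.cascadeK K T, e β ∈ td.rs (-β) ∧ e β ≠ 0) ∧ v = ∑ β ∈ td.cascadeK K T, e β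

/-- `ind n_T`, computed in the model `n_T* ≅ n_T⁻`. -/
def nilIndex (T : Finset SR) : ℕ :=
  ⨅ v : ↥(td.negNilSub T), Module.finrank ℂ (killStab (v : L) (td.nilrad T) (td.nilrad T))

/-- `v ∈ n_T⁻ ≅ n_T*` is a regular point. -/
def IsRegPoint (T : Finset SR) (v : L) : Prop :=
  v ∈ td.negNilSub T ∧
    Module.finrank ℂ (killStab v (td.nilrad T) (td.nilrad T)) = td.nilIndex T

/-- The Frobenius semiradical `F(n_T) = Σ_{v regular} n_T^v`. -/
def frobNil (T : Finset SR) : Submodule ℂ L :=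
  ⨆ v : {v : L // td.IsRegPoint T v}, killStab (v : L) (td.nilrad T) (td.nilrad T)

/-- `v ∈ n_T⁻ ≅ n_T*` is a generic point for the coadjoint-type action on `n_T*` of the
unipotent group `exp(q)` (where `n_T ⊆ q ⊆ b`): there is a Zariski-dense open subset `Ω`
containing `v` on which all stabilisers (inside `q`) are conjugate under the group
`exp(q) = {exp(ad x) : x ∈ q}` to the stabiliser of `v`.  The stabiliser of such a point is
called a generic stabiliser. -/
def IsGenericStabPoint (T : Finset SR) (q : LieSubalgebra ℂ L) (v : L) : Prop :=
  ∃ Ω : Set ↥(td.negNilSub T), zOpen Ω ∧ zDense Ω ∧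
    (∃ hv : v ∈ td.negNilSub T, (⟨v, hv⟩ : ↥(td.negNilSub T)) ∈ Ω) ∧
    ∀ w ∈ Ω, ∃ x ∈ q,
      (killStab v (td.nilrad T) q).map (nilExp (LieAlgebra.ad ℂ L x)) =
        killStab (w : L) (td.nilrad T) q

/-- The saturation `exp(q)·E ⊆ n_T⁻ ≅ n_T*` of the cascade subspace `E` under the group
`exp(q)`: the coadjoint action is `exp(ad x)` followed by the projection to `n_T⁻`
along `p_T`. -/
def satSet (K : Finset (SR → ℤ)) (T : Finset SR) (q : LieSubalgebra ℂ L) :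
    Set ↥(td.negNilSub T) :=
  {w | ∃ x ∈ q, ∃ u ∈ td.cascadeSub K T,
    nilExp (LieAlgebra.ad ℂ L x) u - (w : L) ∈ td.parabSub T}

/-- The coadjoint action of `exp x` on `n_T* ≅ n_T⁻`: apply `exp(ad x)` and project
back to `n_T⁻` along `p_T`. -/
def coactOn (T : Finset SR) (x : L) (w : ↥(td.negNilSub T)) : ↥(td.negNilSub T) :=
  ⟨td.proj (td.negSet T) (nilExp (LieAlgebra.ad ℂ L x) (w : L)), td.proj_mem _ _⟩

/-- The algebra `S(n_T) = ℂ[n_T*]` of polynomial functions on `n_T* ≅ n_T⁻`. -/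
def polyAlg (T : Finset SR) : Subalgebra ℂ (↥(td.negNilSub T) → ℂ) :=
  Algebra.adjoin ℂ
    (Set.range fun l : Module.Dual ℂ ↥(td.negNilSub T) => (l : ↥(td.negNilSub T) → ℂ))

def invAlg (T : Finset SR) (q : LieSubalgebra ℂ L) : Subalgebra ℂ ↥(td.polyAlg T) where
  carrier := {F | ∀ x ∈ q, ∀ w, (F : ↥(td.negNilSub T) → ℂ) (td.coactOn T x w)
    = (F : ↥(td.negNilSub T) → ℂ) w}
  mul_mem' := by
    intro F G hF hG x hx w
    simp only [Set.mem_setOf_eq] at hF hG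
    simp only [MulMemClass.coe_mul, Pi.mul_apply, hF x hx w, hG x hx w]
  add_mem' := by
    intro F G hF hG x hx w
    simp only [Set.mem_setOf_eq] at hF hG
    simp only [AddMemClass.coe_add, Pi.add_apply, hF x hx w, hG x hx w]
  algebraMap_mem' := by
    intro c x hx w
    rfl

/-- For nested nilradicals `n_Ts ⊆ n_Tb`, the algebra of `exp(q)`-invariants in
`S(n_Ts) ⊆ S(n_Tb)`, realised inside the functions on `n_Tb⁻ ≅ n_Tb*`:
`S(n_Ts)` is generated by the linear functionals factoring through the projection onto
`n_Ts⁻`. -/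
def relInv (Tb Ts : Finset SR) (q : LieSubalgebra ℂ L) :
    Subalgebra ℂ (↥(td.negNilSub Tb) → ℂ) where
  carrier := {F | F ∈ Algebra.adjoin ℂ
      {f : ↥(td.negNilSub Tb) → ℂ |
        ∃ l : Module.Dual ℂ L, f = fun w : ↥(td.negNilSub Tb) => l (td.proj (td.negSet Ts) (w : L))} ∧
      ∀ x ∈ q, ∀ w, F (td.coactOn Tb x w) = F w}
  mul_mem' := by
    rintro F G ⟨hF1, hF2⟩ ⟨hG1, hG2⟩
    refine ⟨mul_mem hF1 hG1, fun x hx w => ?_⟩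
    simp only [Pi.mul_apply, hF2 x hx w, hG2 x hx w]
  add_mem' := by
    rintro F G ⟨hF1, hF2⟩ ⟨hG1, hG2⟩
    refine ⟨add_mem hF1 hG1, fun x hx w => ?_⟩
    simp only [Pi.add_apply, hF2 x hx w, hG2 x hx w]
  algebraMap_mem' := by
    intro c
    exact ⟨Subalgebra.algebraMap_mem _ c, fun x hx w => rfl⟩

end TriangularData

/-- The transcendence degree of a commutative `ℂ`-algebra. -/
def trdegC (A : Type*) [CommRing A] [Algebra ℂ A] : Cardinal :=
  ⨆ s : {s : Set A // AlgebraicIndependent ℂ ((↑) : s → A)}, Cardinal.mk s.1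


namespace CPF

/-- Abstract root system with heights, inside an additive group `M`. -/
structure RS (M : Type*) [AddCommGroup M] where
  Φ : Set M
  p : M → M →+ ℤ
  ht : M →+ ℤ
  neg_mem : ∀ α ∈ Φ, -α ∈ Φ
  p_self : ∀ β ∈ Φ, p β β = 2
  p_neg : ∀ β ∈ Φ, ∀ x, p (-β) x = - p β x
  refl_mem : ∀ α ∈ Φ, ∀ β ∈ Φ, α - p β α • β ∈ Φ
  pos_symm : ∀ α ∈ Φ, ∀ β ∈ Φ, 0 < p β α → 0 < p α β
  sub_mem : ∀ α ∈ Φ, ∀ β ∈ Φ, 0 < p β α → α ≠ β → α - β ∈ Φ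
  ht_ne : ∀ α ∈ Φ, ht α ≠ 0
  irr : ∀ X : Set M, X ⊆ Φ → X.Nonempty → (∀ α ∈ X, ∀ β ∈ Φ, β ∉ X → p α β = 0) → X = Φ

namespace RS
variable {M : Type*} [AddCommGroup M] (R : RS M)

theorem add_mem {α β : M} (ha : α ∈ R.Φ) (hb : β ∈ R.Φ) (h : R.p β α < 0) (hne : α ≠ -β) :
    α + β ∈ R.Φ := by
  have := R.sub_mem α ha (-β) (R.neg_mem β hb) (by rw [R.p_neg β hb]; omega) hne
  simpa using this

theorem sub_mem_comm {α β : M} (h : α - β ∈ R.Φ) : β - α ∈ R.Φ := by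
  simpa using R.neg_mem _ h

theorem neg_symm {α β : M} (ha : α ∈ R.Φ) (hb : β ∈ R.Φ) (h : R.p β α < 0) : R.p α β < 0 := by
  have := R.pos_symm α ha (-β) (R.neg_mem β hb) (by rw [R.p_neg β hb]; omega)
  rw [map_neg] at this; omega

theorem zero_symm {α β : M} (ha : α ∈ R.Φ) (hb : β ∈ R.Φ) (h : R.p β α = 0) : R.p α β = 0 := by
  rcases lt_trichotomy (R.p α β) 0 with h1 | h1 | h1
  · have := R.neg_symm hb ha h1; omega
  · exact h1
  · have := R.pos_symm β hb α ha h1; omega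

end RS

/-- greedy sequence of pairwise orthogonal roots -/
structure Greedy {M : Type*} [AddCommGroup M] (R : RS M) (N : Set M) where
  k : ℕ
  β : ℕ → M
  mem : ∀ i < k, β i ∈ N
  orth : ∀ i l, i < l → l < k → R.p (β i) (β l) = 0
  max : ∀ i < k, ∀ γ ∈ N, (∀ l < i, R.p (β l) γ = 0) → R.ht γ ≤ R.ht (β i)
  exhaust : ∀ γ ∈ N, ∃ i < k, R.p (β i) γ ≠ 0

theorem exists_greedy {M : Type*} [AddCommGroup M] (R : RS M) (X : Finset M)
    (hX : (X : Set M) ⊆ R.Φ) : Nonempty (Greedy R (X : Set M)) := by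
  induction' hn : X.card using Nat.strong_induction_on with n ih generalizing X
  rcases X.eq_empty_or_nonempty with rfl | hne
  · exact ⟨⟨0, fun _ => 0, by simp, by simp, by simp, by simp⟩⟩
  · obtain ⟨b, hb, hmax⟩ := X.exists_max_image R.ht hne
    obtain ⟨G⟩ := ih (X.filter fun γ => R.p b γ = 0).card (by
        rw [← hn]
        apply Finset.card_lt_card
        refine Finset.filter_ssubset.2 ⟨b, hb, ?_⟩
        rw [R.p_self b (hX hb)]; norm_num) (X.filter fun γ => R.p b γ = 0)
        (fun x hx => hX (by simp at hx; exact hx.1)) rfl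
    have hm := G.mem
    simp only [Finset.coe_filter, Set.mem_setOf_eq] at hm
    refine ⟨⟨G.k + 1, fun i => Nat.casesOn i b G.β, ?_, ?_, ?_, ?_⟩⟩
    · rintro (_ | i) hi
      · exact hb
      · exact (hm i (by omega)).1
    · rintro (_ | i) (_ | l) h1 h2
      · omega
      · exact (hm l (by omega)).2
      · omega
      · exact G.orth i l (by omega) (by omega)
    · rintro (_ | i) hi γ hγ h
      · exact hmax γ hγ
      · apply G.max i (by omega)
        · simp only [Finset.coe_filter, Set.mem_setOf_eq]
          exact ⟨hγ, h 0 (by omega)⟩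
        · intro l hl; exact h (l+1) (by omega)
    · intro γ hγ
      by_cases h0 : R.p b γ = 0
      · obtain ⟨i, hi, h⟩ := G.exhaust γ (by simp only [Finset.coe_filter, Set.mem_setOf_eq]; exact ⟨hγ, h0⟩)
        exact ⟨i+1, by omega, h⟩
      · exact ⟨0, by omega, h0⟩

/-- `N` is an upper closed set of positive roots. -/
structure Upper {M : Type*} [AddCommGroup M] (R : RS M) (N : Set M) : Prop where
  sub : N ⊆ R.Φ
  pos : ∀ γ ∈ N, 0 < R.ht γ
  closed : ∀ γ ∈ N, ∀ α ∈ R.Φ, 0 < R.ht α → γ + α ∈ R.Φ → γ + α ∈ N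

namespace Greedy
variable {M : Type*} [AddCommGroup M] {R : RS M} {N : Set M} (G : Greedy R N)

/-- pairing with the `i`-th greedy root -/
def P (i : ℕ) : M →+ ℤ := R.p (G.β i)

/-- roots reachable from the greedy roots by adding positive roots -/
inductive Q : M → Prop
  | base (i : ℕ) (hi : i < G.k) : Q (G.β i)
  | step (γ α : M) (h : Q γ) (ha : α ∈ R.Φ) (hp : 0 < R.ht α) (hs : γ + α ∈ R.Φ) : Q (γ + α)


theorem mem_Φ (hU : Upper R N) {i : ℕ} (hi : i < G.k) : G.β i ∈ R.Φ := hU.sub (G.mem i hi)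
theorem ht_pos (hU : Upper R N) {i : ℕ} (hi : i < G.k) : 0 < R.ht (G.β i) := hU.pos _ (G.mem i hi)
theorem P_self (hU : Upper R N) {i : ℕ} (hi : i < G.k) : G.P i (G.β i) = 2 := R.p_self _ (G.mem_Φ hU hi)
theorem P_ne (hU : Upper R N) {i l : ℕ} (hi : i < G.k) (hl : l < G.k) (h : i ≠ l) : G.P i (G.β l) = 0 := by
  rcases lt_or_gt_of_ne h with h | h
  · exact G.orth i l h hl
  · exact R.zero_symm (G.mem_Φ hU hi) (G.mem_Φ hU hl) (G.orth l i h hi)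

theorem Q_N (hU : Upper R N) {γ : M} (h : G.Q γ) : γ ∈ N := by
  induction h with
  | base i hi => exact G.mem i hi
  | step γ α h ha hp hs ih => exact hU.closed γ ih α ha hp hs

theorem G2 (hU : Upper R N) {α : M} (ha : α ∈ R.Φ) (hp : 0 < R.ht α) {m : ℕ} (hm : m < G.k)
    (h0 : ∀ l < m, G.P l α = 0) : 0 ≤ G.P m α := by
  by_contra hneg
  push Not at hneg
  have hs : α + G.β m ∈ R.Φ := R.add_mem ha (G.mem_Φ hU hm) hneg (by
    intro h; rw [h, map_neg] at hp; have := G.ht_pos hU hm; omega)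
  rw [add_comm] at hs
  have hN := hU.closed _ (G.mem m hm) _ ha hp hs
  have := G.max m hm _ hN (by
    intro l hl
    have h1 := G.P_ne hU (hl.trans hm) hm hl.ne
    have h2 := h0 l hl
    unfold P at h1 h2
    rw [map_add, h1, h2, add_zero])
  rw [map_add] at this; omega

theorem G1 (hU : Upper R N) {γ : M} (hγ : γ ∈ N) : ∃ m < G.k, (∀ l < m, G.P l γ = 0) ∧ 0 < G.P m γ ∧
    (γ = G.β m ∨ (G.P m γ = 1 ∧ G.β m - γ ∈ R.Φ ∧ 0 < R.ht (G.β m - γ))) := by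
  have hex : ∃ m, m < G.k ∧ G.P m γ ≠ 0 := G.exhaust γ hγ
  obtain ⟨hm, hne⟩ := Nat.find_spec hex
  set m := Nat.find hex with hmdef
  have h0 : ∀ l < m, G.P l γ = 0 := by
    intro l hl
    have := Nat.find_min hex hl
    by_contra hc
    exact this ⟨hl.trans hm, hc⟩
  have hge := G.G2 hU (hU.sub hγ) (hU.pos _ hγ) hm h0
  have hpos : 0 < G.P m γ := by omega
  refine ⟨m, hm, h0, hpos, ?_⟩
  by_cases he : γ = G.β m
  · exact Or.inl he
  right
  have hd : G.β m - γ ∈ R.Φ := R.sub_mem_comm (R.sub_mem γ (hU.sub hγ) _ (G.mem_Φ hU hm) hpos he)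
  have hle := G.max m hm γ hγ h0
  have hne0 := R.ht_ne _ hd
  rw [map_sub] at hne0
  have hdp : 0 < R.ht (G.β m - γ) := by rw [map_sub]; omega
  refine ⟨?_, hd, hdp⟩
  have h1 : ∀ l < m, G.P l (G.β m - γ) = 0 := fun l hl => by
    rw [map_sub, G.P_ne hU (hl.trans hm) hm hl.ne, h0 l hl, sub_zero]
  have h2 := G.G2 hU hd hdp hm h1
  rw [map_sub, G.P_self hU hm] at h2
  by_contra hn1
  have h3 : G.P m γ = 2 := by omega
  have h4 := R.refl_mem γ (hU.sub hγ) _ (G.mem_Φ hU hm)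
  change γ - G.P m γ • G.β m ∈ _ at h4
  rw [h3] at h4
  have h5 : G.β m + (G.β m - γ) ∈ R.Φ := by
    have := R.neg_mem _ h4
    convert this using 1
    rw [two_zsmul]; abel
  have h6 := G.max m hm _ (hU.closed _ (G.mem m hm) _ hd hdp h5) (by
    intro l hl
    change G.P l _ = 0
    rw [map_add, h1 l hl, G.P_ne hU (hl.trans hm) hm hl.ne, add_zero])
  rw [map_add] at h6; omega

theorem strong_add (hU : Upper R N) {i l : ℕ} (hi : i < G.k) (hl : l < G.k) (h : i ≠ l) :
    G.β i + G.β l ∉ R.Φ := by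
  wlog hlt : i < l generalizing i l
  · rw [add_comm]; exact this hl hi h.symm (by omega)
  intro hs
  have h6 := G.max i hi _ (hU.closed _ (G.mem i hi) _ (G.mem_Φ hU hl) (G.ht_pos hU hl) hs) (by
    intro r hr
    change G.P r _ = 0
    rw [map_add, G.P_ne hU (hr.trans hi) hi hr.ne, G.P_ne hU (hr.trans hi) hl (by omega), add_zero])
  rw [map_add] at h6
  have := G.ht_pos hU hl
  omega

theorem strong_sub (hU : Upper R N) {i l : ℕ} (hi : i < G.k) (hl : l < G.k) (h : i ≠ l) :
    G.β i - G.β l ∉ R.Φ := by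
  intro hs
  have h4 := R.refl_mem _ hs _ (G.mem_Φ hU hl)
  change _ - G.P l _ • G.β l ∈ _ at h4
  rw [map_sub, G.P_self hU hl, G.P_ne hU hl hi h.symm] at h4
  apply G.strong_add hU hi hl h
  convert h4 using 1
  simp [two_zsmul]; abel


theorem Q_nonneg (hU : Upper R N) (hab : ∀ γ η, G.Q γ → G.Q η → γ + η ∉ R.Φ)
    {γ : M} (h : G.Q γ) {i : ℕ} (hi : i < G.k) : 0 ≤ G.P i γ := by
  by_contra hneg
  push Not at hneg
  have hN := G.Q_N hU h
  refine hab γ _ h (.base i hi) (R.add_mem (hU.sub hN) (G.mem_Φ hU hi) hneg ?_)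
  intro he
  have := hU.pos _ hN
  rw [he, map_neg] at this
  have := G.ht_pos hU hi
  omega

theorem LemQ_aux (hU : Upper R N) (hab : ∀ γ η, G.Q γ → G.Q η → γ + η ∉ R.Φ)
    {γ : M} (h : G.Q γ) {m : ℕ} (hm : m < G.k) (h0 : ∀ l < m, G.P l γ = 0)
    (h1 : G.P m γ = 1) (hd : G.β m - γ ∈ R.Φ) (hdp : 0 < R.ht (G.β m - γ))
    {i : ℕ} (hi : i < G.k) (him : i ≠ m) (hpi : 0 < G.P i γ) :
    G.P i γ = 1 ∧ ∀ l < G.k, l ≠ i → l ≠ m → G.P l γ = 0 := by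
  have hγ := hU.sub (G.Q_N hU h)
  have hmi := G.P_ne hU hm hi him.symm
  have him' := G.P_ne hU hi hm him
  have hs : (G.β m - γ) + G.β i ∈ R.Φ := R.add_mem hd (G.mem_Φ hU hi) (by
    change G.P i _ < 0
    rw [map_sub, him']; omega) (by
    intro he; rw [he, map_neg] at hdp; have := G.ht_pos hU hi; omega)
  rw [add_comm] at hs
  have hQ' : G.Q (G.β i + (G.β m - γ)) := .step _ _ (.base i hi) hd hdp hs
  have h2 : G.P i γ ≤ 2 := by
    have := G.Q_nonneg hU hab hQ' hi
    rw [map_add, map_sub, G.P_self hU hi, him'] at this; omega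
  refine ⟨?_, ?_⟩
  · by_contra hne
    have h22 : G.P i γ = 2 := by omega
    have h4 := R.refl_mem γ hγ _ (G.mem_Φ hU hi)
    change _ - G.P i _ • G.β i ∈ _ at h4
    rw [h22] at h4
    have hρm : G.P m (γ - (2:ℤ) • G.β i) = 1 := by rw [map_sub, map_zsmul, hmi, h1]; simp
    have hρl : ∀ l < m, G.P l (γ - (2:ℤ) • G.β i) = 0 := by
      intro l hl
      have : l ≠ i := by rintro rfl; have := h0 l hl; omega
      rw [map_sub, map_zsmul, h0 l hl, G.P_ne hU (hl.trans hm) hi this]; simp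
    have hρp : 0 < R.ht (γ - (2:ℤ) • G.β i) := by
      by_contra hc
      have hne0 := R.ht_ne _ h4
      have := G.G2 hU (R.neg_mem _ h4) (by rw [map_neg]; omega) hm (by
        intro l hl; rw [map_neg, hρl l hl, neg_zero])
      rw [map_neg, hρm] at this; omega
    have hs2 : G.β i + (γ - (2:ℤ) • G.β i) ∈ R.Φ := by
      have := R.sub_mem γ hγ _ (G.mem_Φ hU hi) hpi (by
        rintro rfl; omega)
      convert this using 1
      rw [two_zsmul]; abel
    have hQ2 := Q.step _ _ (Q.base (G := G) i hi) h4 hρp hs2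
    apply hab _ _ (Q.base i hi) hQ2
    convert hγ using 1
    rw [two_zsmul]; abel
  · intro l hl hli hlm
    have := G.Q_nonneg hU hab hQ' hl
    rw [map_add, map_sub, G.P_ne hU hl hi hli, G.P_ne hU hl hm hlm] at this
    have := G.Q_nonneg hU hab h hl
    omega

theorem LemQ (hU : Upper R N) (hab : ∀ γ η, G.Q γ → G.Q η → γ + η ∉ R.Φ)
    {γ : M} (h : G.Q γ) : (∃ m < G.k, γ = G.β m) ∨
    (∃ m < G.k, G.P m γ = 1 ∧ ∀ i < G.k, i ≠ m → G.P i γ = 0) ∨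
    (∃ m i, m < i ∧ i < G.k ∧ G.P m γ = 1 ∧ G.P i γ = 1 ∧
      ∀ l < G.k, l ≠ i → l ≠ m → G.P l γ = 0) := by
  obtain ⟨m, hm, h0, hpos, he | ⟨h1, hd, hdp⟩⟩ := G.G1 hU (G.Q_N hU h)
  · exact Or.inl ⟨m, hm, he⟩
  right
  by_cases hex : ∃ i < G.k, i ≠ m ∧ G.P i γ ≠ 0
  · obtain ⟨i, hi, him, hne⟩ := hex
    have hnn := G.Q_nonneg hU hab h hi
    obtain ⟨a, b⟩ := G.LemQ_aux hU hab h hm h0 h1 hd hdp hi him (by omega)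
    right
    refine ⟨m, i, ?_, hi, h1, a, b⟩
    by_contra hc
    have := h0 i (by omega)
    omega
  · push Not at hex
    exact Or.inl ⟨m, hm, h1, hex⟩

theorem Q_ge_two (hU : Upper R N) (hab : ∀ γ η, G.Q γ → G.Q η → γ + η ∉ R.Φ)
    {γ : M} (h : G.Q γ) {i : ℕ} (hi : i < G.k) (h2 : 2 ≤ G.P i γ) : γ = G.β i := by
  rcases G.LemQ hU hab h with ⟨m, hm, rfl⟩ | ⟨m, hm, h1, h0⟩ | ⟨m, s, hms, hs, h1, h1', h0⟩
  · by_cases him : i = m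
    · rw [him]
    · rw [G.P_ne hU hi hm him] at h2; omega
  · by_cases him : i = m
    · subst him; omega
    · have := h0 i hi him; omega
  · by_cases him : i = m
    · subst him; omega
    · by_cases his : i = s
      · subst his; omega
      · have := h0 i hi his him; omega

theorem L2 (hU : Upper R N) (hab : ∀ γ η, G.Q γ → G.Q η → γ + η ∉ R.Φ)
    {κ : M} (hκ : κ ∈ R.Φ) {i : ℕ} (hi : i < G.k) (h2 : 2 ≤ G.P i κ) : κ = G.β i := by
  have hβ := G.mem_Φ hU hi
  have hself := G.P_self hU hi
  have key : ∀ x ∈ R.Φ, 2 ≤ G.P i x → 0 ≤ R.ht (x - G.β i) → x = G.β i := by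
    intro x hx hx2 hh
    by_contra hne
    have hd := R.sub_mem x hx _ hβ (show 0 < G.P i x by omega) hne
    have := R.ht_ne _ hd
    have hq : G.Q (G.β i + (x - G.β i)) := .step _ _ (.base i hi) hd (by omega) (by
      convert hx using 1; abel)
    rw [add_sub_cancel] at hq
    exact hne (G.Q_ge_two hU hab hq hi hx2)
  have h4 := R.neg_mem _ (R.refl_mem κ hκ _ hβ)
  change -(_ - G.P i _ • G.β i) ∈ _ at h4
  by_cases hh : 0 ≤ R.ht (κ - G.β i)
  · exact key κ hκ h2 hh
  · have := key _ h4 (by rw [map_neg, map_sub, map_zsmul, hself]; simp; omega) (by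
      rw [map_sub] at hh
      rw [map_sub, map_neg, map_sub, map_zsmul]
      have := G.ht_pos hU hi
      simp only [smul_eq_mul]
      nlinarith)
    have h5 : G.P i κ = 2 := by
      have h6 := congrArg (G.P i) this
      rw [map_neg, map_sub, map_zsmul, hself] at h6
      simp only [smul_eq_mul] at h6
      omega
    rw [h5, two_zsmul] at this
    have h7 : κ = G.β i + G.β i - -(κ - (G.β i + G.β i)) := by abel
    rw [this] at h7
    rw [h7]; abel

theorem Lemα (hU : Upper R N) (hab : ∀ γ η, G.Q γ → G.Q η → γ + η ∉ R.Φ)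
    {α : M} (ha : α ∈ R.Φ) (hp : 0 < R.ht α) : (∀ i < G.k, 0 ≤ G.P i α) ∨
    ∃ m s, m < s ∧ s < G.k ∧ G.P m α = 1 ∧ G.P s α = -1 ∧
      ∀ l < G.k, l ≠ s → l ≠ m → G.P l α = 0 := by
  by_cases hex : ∀ i < G.k, 0 ≤ G.P i α
  · exact Or.inl hex
  right
  push Not at hex
  obtain ⟨s, hs, hneg⟩ := hex
  have hβ := G.mem_Φ hU hs
  have hζ : G.β s + α ∈ R.Φ := by
    rw [add_comm]
    refine R.add_mem ha hβ hneg ?_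
    intro h; rw [h, map_neg] at hp; have := G.ht_pos hU hs; omega
  have hQ : G.Q (G.β s + α) := .step _ _ (.base s hs) ha hp hζ
  have hm1 : G.P s α = -1 := by
    by_contra hc
    have := G.L2 hU hab (R.neg_mem _ ha) hs (by rw [map_neg]; omega)
    have h1 := congrArg R.ht this
    rw [map_neg] at h1
    have := G.ht_pos hU hs; omega
  have hPs : G.P s (G.β s + α) = 1 := by rw [map_add, G.P_self hU hs]; omega
  have hPl : ∀ l < G.k, l ≠ s → G.P l (G.β s + α) = G.P l α := by
    intro l hl hls; rw [map_add, G.P_ne hU hl hs hls, zero_add]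
  rcases G.LemQ hU hab hQ with ⟨m, hm, he⟩ | ⟨m, hm, h1, h0⟩ | ⟨m, i, hmi, hi, h1, h1', h0⟩
  · rw [he] at hPs
    by_cases hsm : s = m
    · subst hsm; rw [G.P_self hU hs] at hPs; omega
    · rw [G.P_ne hU hs hm hsm] at hPs; omega
  · have hsm : s = m := by
      by_contra hc; have := h0 s hs hc; omega
    subst hsm
    exfalso
    have := G.G2 hU ha hp hs (fun l hl => by
      rw [← hPl l (hl.trans hs) hl.ne]; exact h0 l (hl.trans hs) hl.ne)
    omega
  · by_cases hsm : s = m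
    · subst hsm
      exfalso
      have := G.G2 hU ha hp hs (fun l hl => by
        rw [← hPl l (hl.trans hs) hl.ne]; exact h0 l (hl.trans hs) (by omega) (by omega))
      omega
    · have hsi : s = i := by
        by_contra hc; have := h0 s hs hc hsm; omega
      subst hsi
      refine ⟨m, s, hmi, hs, ?_, hm1, ?_⟩
      · rw [← hPl m (hmi.trans hs) (by omega)]; exact h1
      · intro l hl hls hlm
        rw [← hPl l hl hls]; exact h0 l hl hls hlm

/-- two positive pairings force membership in `Q` -/
theorem two_pos (hU : Upper R N) (hab : ∀ γ η, G.Q γ → G.Q η → γ + η ∉ R.Φ)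
    {η : M} (hη : η ∈ R.Φ) {i l : ℕ} (hil : i < l) (hl : l < G.k)
    (h1 : 0 < G.P i η) (h2 : 0 < G.P l η) : G.Q η ∧ G.P i η = 1 ∧ G.P l η = 1 ∧
    (∀ r < G.k, r ≠ i → r ≠ l → G.P r η = 0) ∧ η - G.β l ∈ R.Φ ∧ 0 < R.ht (η - G.β l) := by
  have hi := hil.trans hl
  have e1 : G.P i η = 1 := by
    by_contra hc
    have := G.L2 hU hab hη hi (by omega)
    rw [this, G.P_ne hU hl hi hil.ne'] at h2; omega
  have e2 : G.P l η = 1 := by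
    by_contra hc
    have := G.L2 hU hab hη hl (by omega)
    rw [this, G.P_ne hU hi hl hil.ne] at h1; omega
  have hd : η - G.β l ∈ R.Φ := R.sub_mem η hη _ (G.mem_Φ hU hl) h2 (by
    rintro rfl; rw [G.P_ne hU hi hl hil.ne] at h1; omega)
  have d1 : G.P i (η - G.β l) = 1 := by rw [map_sub, e1, G.P_ne hU hi hl hil.ne]; rfl
  have d2 : G.P l (η - G.β l) = -1 := by rw [map_sub, e2, G.P_self hU hl]; rfl
  have hdp : 0 < R.ht (η - G.β l) := by
    by_contra hc
    have := R.ht_ne _ hd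
    rcases G.Lemα hU hab (R.neg_mem _ hd) (by rw [map_neg]; omega) with h | ⟨m, s, hms, hs, a, b, c⟩
    · have := h i hi; rw [map_neg] at this; omega
    · rw [map_neg] at a b
      have c1 : l = m := by
        by_contra hc1
        by_cases hc2 : l = s
        · subst hc2; omega
        · have := c l hl hc2 hc1; rw [map_neg] at this; omega
      have c2 : i = s := by
        by_contra hc1
        by_cases hc2 : i = m
        · subst hc2; omega
        · have := c i hi hc1 hc2; rw [map_neg] at this; omega
      omega
  have hQ : G.Q η := by
    have : G.Q (G.β l + (η - G.β l)) := .step _ _ (.base l hl) hd hdp (by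
      convert hη using 1; abel)
    rwa [add_sub_cancel] at this
  refine ⟨hQ, e1, e2, ?_, hd, hdp⟩
  intro r hr hri hrl
  rcases G.LemQ hU hab hQ with ⟨m, hm, he⟩ | ⟨m, hm, h1, h0⟩ | ⟨m, s, hmi, hs, h1, h1', h0⟩
  · exfalso
    rw [he] at e1 e2
    by_cases h : i = m
    · rw [G.P_ne hU hl hm (by omega)] at e2; omega
    · rw [G.P_ne hU hi hm h] at e1; omega
  · exfalso
    have a1 : i = m := by by_contra hc; have := h0 i hi hc; omega
    have a2 : l = m := by by_contra hc; have := h0 l hl hc; omega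
    omega
  · have a1 : i = s ∨ i = m := by
      by_contra hc; push Not at hc; have := h0 i hi hc.1 hc.2; omega
    have a2 : l = s ∨ l = m := by
      by_contra hc; push Not at hc; have := h0 l hl hc.1 hc.2; omega
    exact h0 r hr (by omega) (by omega)

theorem compl_mem (hU : Upper R N) (hab : ∀ γ η, G.Q γ → G.Q η → γ + η ∉ R.Φ)
    {η : M} (hη : η ∈ R.Φ) {i l : ℕ} (hil : i < l) (hl : l < G.k)
    (h1 : 0 < G.P i η) (h2 : 0 < G.P l η) : G.β i + G.β l - η ∈ R.Φ := by
  have hi := hil.trans hl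
  obtain ⟨-, e1, e2, -, hd, -⟩ := G.two_pos hU hab hη hil hl h1 h2
  have d1 : G.P i (η - G.β l) = 1 := by rw [map_sub, e1, G.P_ne hU hi hl hil.ne]; rfl
  have d2 : G.P l (η - G.β l) = -1 := by rw [map_sub, e2, G.P_self hU hl]; rfl
  have := R.sub_mem _ hd _ (G.mem_Φ hU hi) (show 0 < G.P i _ by omega) (by
    intro h; rw [h, G.P_ne hU hl hi hil.ne'] at d2; omega)
  convert R.neg_mem _ this using 1
  abel

end Greedy
end CPF

namespace CPF
namespace Greedy
variable {M : Type*} [AddCommGroup M] {R : RS M} {N : Set M} (G : Greedy R N)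

/-- irreducibility: a root pairing nontrivially with two given greedy roots -/
theorem exists_link (hU : Upper R N) {i l : ℕ} (hi : i < G.k) (hl : l < G.k) :
    ∃ η ∈ R.Φ, G.P i η ≠ 0 ∧ R.p η (G.β l) ≠ 0 := by
  by_contra hcon
  push Not at hcon
  have hX := R.irr {α ∈ R.Φ | ∃ η ∈ R.Φ, G.P i η ≠ 0 ∧ R.p η α ≠ 0} (fun x hx => hx.1)
    ⟨G.β i, G.mem_Φ hU hi, G.β i, G.mem_Φ hU hi, by rw [G.P_self hU hi]; norm_num, by
      rw [R.p_self _ (G.mem_Φ hU hi)]; norm_num⟩ (by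
    rintro α ⟨hα, η, hη, h1, h2⟩ ζ hζ hn
    have hz : ∀ η ∈ R.Φ, G.P i η ≠ 0 → R.p η ζ = 0 := by
      intro η hη h1
      by_contra h2
      exact hn ⟨hζ, η, hη, h1, h2⟩
    by_cases h0 : G.P i α = 0
    · have hz1 := R.zero_symm hζ hη (hz η hη h1)
      apply R.zero_symm hα hζ
      rcases lt_or_gt_of_ne h2 with h3 | h3
      · have hs := R.add_mem hα hη h3 (by
          rintro rfl; rw [map_neg] at h0; omega)
        have h4 := R.zero_symm hζ hs (hz _ hs (by rw [map_add]; omega))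
        rw [map_add] at h4; omega
      · have hs := R.sub_mem α hα η hη h3 (by
          rintro rfl; omega)
        have h4 := R.zero_symm hζ hs (hz _ hs (by rw [map_sub]; omega))
        rw [map_sub] at h4; omega
    · exact hz α hα h0)
  have : G.β l ∈ R.Φ := G.mem_Φ hU hl
  rw [← hX] at this
  obtain ⟨-, η, hη, h1, h2⟩ := this
  exact h2 (hcon η hη h1)


theorem exists_J0 (hU : Upper R N) (hab : ∀ γ η, G.Q γ → G.Q η → γ + η ∉ R.Φ)
    {l : ℕ} (h0l : 0 < l) (hl : l < G.k) :
    ∃ η ∈ R.Φ, 0 < G.P 0 η ∧ 0 < G.P l η := by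
  have h0 := h0l.trans hl
  obtain ⟨η, hη, h1, h2⟩ := G.exists_link hU h0 hl
  have h2' : G.P l η ≠ 0 := fun h => h2 (R.zero_symm hη (G.mem_Φ hU hl) h)
  have flip : ∀ i < G.k, ∀ r < G.k, r ≠ i → ∀ x ∈ R.Φ, ∃ y ∈ R.Φ, G.P i y = - G.P i x ∧ G.P r y = G.P r x := by
    intro i hi r hr hri x hx
    refine ⟨_, R.refl_mem x hx _ (G.mem_Φ hU hi), ?_, ?_⟩
    · change G.P i (x - G.P i x • G.β i) = _
      rw [map_sub, map_zsmul, G.P_self hU hi]; simp; ring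
    · change G.P r (x - G.P i x • G.β i) = _
      rw [map_sub, map_zsmul, G.P_ne hU hr hi hri]; simp
  obtain ⟨y, hy, hy1, hy2⟩ : ∃ y ∈ R.Φ, 0 < G.P 0 y ∧ G.P l y ≠ 0 := by
    by_cases h : 0 < G.P 0 η
    · exact ⟨η, hη, h, h2'⟩
    · obtain ⟨y, hy, a, b⟩ := flip 0 h0 l hl h0l.ne' η hη
      exact ⟨y, hy, by omega, by omega⟩
  by_cases h : 0 < G.P l y
  · exact ⟨y, hy, hy1, h⟩
  · obtain ⟨z, hz, a, b⟩ := flip l hl 0 h0 h0l.ne y hy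
    exact ⟨z, hz, by omega, by omega⟩

theorem exists_J (hU : Upper R N) (hab : ∀ γ η, G.Q γ → G.Q η → γ + η ∉ R.Φ)
    {i l : ℕ} (hil : i < l) (hl : l < G.k) :
    ∃ η ∈ R.Φ, 0 < G.P i η ∧ 0 < G.P l η := by
  rcases Nat.eq_zero_or_pos i with rfl | hi0
  · exact G.exists_J0 hU hab hil hl
  have hi := hil.trans hl
  have h0 := hi0.trans hi
  obtain ⟨η, hη, a1, a2⟩ := G.exists_J0 hU hab hi0 hi
  obtain ⟨η', hη', b1, b2⟩ := G.exists_J0 hU hab (hi0.trans hil) hl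
  obtain ⟨-, a1, a2, a3, -, -⟩ := G.two_pos hU hab hη hi0 hi a1 a2
  obtain ⟨-, b1, b2, b3, -, -⟩ := G.two_pos hU hab hη' (hi0.trans hil) hl b1 b2
  have a4 := a3 l hl (by omega) (by omega)
  have b4 := b3 i hi (by omega) (by omega)
  have hc := G.compl_mem hU hab hη hi0 hi (by omega) (by omega)
  have main : ∀ x ∈ R.Φ, G.P i x = 1 → G.P l x = 0 → 0 < R.p η' x →
      ∃ η ∈ R.Φ, 0 < G.P i η ∧ 0 < G.P l η := by
    intro x hx x1 x2 x3
    have hd := R.sub_mem x hx η' hη' x3 (by rintro rfl; omega)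
    have d1 : G.P i (x - η') = 1 := by rw [map_sub]; omega
    have d2 : G.P l (x - η') = -1 := by rw [map_sub]; omega
    refine ⟨x - η' + G.β l, R.add_mem hd (G.mem_Φ hU hl) (show G.P l _ < 0 by omega) ?_, ?_, ?_⟩
    · intro h; rw [h, map_neg, G.P_ne hU hi hl (by omega)] at d1; omega
    · rw [map_add, d1, G.P_ne hU hi hl (by omega)]; omega
    · rw [map_add, d2, G.P_self hU hl]; omega
  have s0 : 0 < R.p η' (G.β 0) := R.pos_symm η' hη' _ (G.mem_Φ hU h0) (show 0 < G.P 0 η' by omega)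
  have si : R.p η' (G.β i) = 0 := R.zero_symm hη' (G.mem_Φ hU hi) b4
  by_cases hx : 0 < R.p η' η
  · exact main η hη a2 a4 hx
  · refine main _ hc ?_ ?_ ?_
    · rw [map_sub, map_add, G.P_self hU hi, G.P_ne hU hi h0 (by omega)]; omega
    · rw [map_sub, map_add, G.P_ne hU hl hi (by omega), G.P_ne hU hl h0 (by omega)]; omega
    · rw [map_sub, map_add]; omega

theorem sum_nonneg (hU : Upper R N) (hab : ∀ γ η, G.Q γ → G.Q η → γ + η ∉ R.Φ)
    {α : M} (ha : α ∈ R.Φ) (hp : 0 < R.ht α) {j : ℕ} (hj : j < G.k) :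
    0 ≤ ∑ i ∈ Finset.range (j+1), G.P i α := by
  rcases G.Lemα hU hab ha hp with h | ⟨m, s, hms, hs, a, b, c⟩
  · exact Finset.sum_nonneg fun i hi => h i (by have := Finset.mem_range.1 hi; omega)
  · by_cases hsj : s ≤ j
    · rw [Finset.sum_eq_add_of_mem m s (Finset.mem_range.2 (by omega)) (Finset.mem_range.2 (by omega)) hms.ne
        (fun r hr hrr => c r (by have := Finset.mem_range.1 hr; omega) hrr.2 hrr.1), a, b]
      norm_num
    · refine Finset.sum_nonneg fun i hi => ?_
      have := Finset.mem_range.1 hi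
      by_cases him : i = m
      · subst him; omega
      · rw [c i (by omega) (by omega) him]

theorem Q_sum_le (hU : Upper R N) (hab : ∀ γ η, G.Q γ → G.Q η → γ + η ∉ R.Φ)
    {γ : M} (h : G.Q γ) {j : ℕ} (hj : j < G.k) :
    ∑ i ∈ Finset.range (j+1), G.P i γ ≤ 2 := by
  have hle : ∑ i ∈ Finset.range (j+1), G.P i γ ≤ ∑ i ∈ Finset.range G.k, G.P i γ := by
    apply Finset.sum_le_sum_of_subset_of_nonneg
    · intro x; simp only [Finset.mem_range]; omega
    · intro i hi _
      exact G.Q_nonneg hU hab h (Finset.mem_range.1 hi)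
  refine hle.trans ?_
  rcases G.LemQ hU hab h with ⟨m, hm, rfl⟩ | ⟨m, hm, h1, h0⟩ | ⟨m, s, hms, hs, h1, h1', h0⟩
  · rw [Finset.sum_eq_single_of_mem m (Finset.mem_range.2 hm) (fun r hr hrm =>
      G.P_ne hU (Finset.mem_range.1 hr) hm hrm), G.P_self hU hm]
  · rw [Finset.sum_eq_single_of_mem m (Finset.mem_range.2 hm) (fun r hr hrm =>
      h0 r (Finset.mem_range.1 hr) hrm), h1]; norm_num
  · rw [Finset.sum_eq_add_of_mem m s (Finset.mem_range.2 (by omega)) (Finset.mem_range.2 (by omega)) hms.ne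
        (fun r hr hrr => h0 r (by have := Finset.mem_range.1 hr; omega) hrr.2 hrr.1), h1, h1']
    norm_num

theorem Q_of_sum (hU : Upper R N) (hab : ∀ γ η, G.Q γ → G.Q η → γ + η ∉ R.Φ)
    {γ : M} (hγ : γ ∈ R.Φ) {j : ℕ} (hj : j < G.k)
    (h2 : ∑ i ∈ Finset.range (j+1), G.P i γ = 2) : G.Q γ := by
  have hp : 0 < R.ht γ := by
    by_contra hc
    have := R.ht_ne _ hγ
    have := G.sum_nonneg hU hab (R.neg_mem _ hγ) (by rw [map_neg]; omega) hj
    simp only [map_neg, Finset.sum_neg_distrib] at this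
    omega
  obtain ⟨i, hi, hpi⟩ : ∃ i ∈ Finset.range (j+1), 0 < G.P i γ := by
    apply Finset.exists_lt_of_sum_lt
    rw [h2]; simp
  have hi' := Finset.mem_range.1 hi
  by_cases hi2 : 2 ≤ G.P i γ
  · rw [G.L2 hU hab hγ (by omega) hi2]; exact .base i (by omega)
  obtain ⟨l, hl, hpl⟩ : ∃ l ∈ (Finset.range (j+1)).erase i, 0 < G.P l γ := by
    apply Finset.exists_lt_of_sum_lt
    rw [← Finset.add_sum_erase _ _ hi] at h2
    simp only [Finset.sum_const_zero]; omega
  have hl' := Finset.mem_range.1 (Finset.mem_of_mem_erase hl)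
  have hne := Finset.ne_of_mem_erase hl
  rcases lt_or_gt_of_ne hne with h | h
  · exact (G.two_pos hU hab hγ h (by omega) hpl hpi).1
  · exact (G.two_pos hU hab hγ h (by omega) hpi hpl).1

theorem sum_add (hU : Upper R N) (hab : ∀ γ η, G.Q γ → G.Q η → γ + η ∉ R.Φ)
    {γ α : M} (hγ : γ ∈ R.Φ) {j : ℕ} (hj : j < G.k)
    (h2 : ∑ i ∈ Finset.range (j+1), G.P i γ = 2) (ha : α ∈ R.Φ) (hp : 0 < R.ht α)
    (hs : γ + α ∈ R.Φ) : ∑ i ∈ Finset.range (j+1), G.P i α = 0 := by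
  have h1 := G.Q_sum_le hU hab (.step _ _ (G.Q_of_sum hU hab hγ hj h2) ha hp hs) hj
  have h3 := G.sum_nonneg hU hab ha hp hj
  simp only [map_add, Finset.sum_add_distrib] at h1
  omega

/-- complementary pair: difference is not a root -/
theorem pair_diff (hU : Upper R N) (hab : ∀ γ η, G.Q γ → G.Q η → γ + η ∉ R.Φ)
    {γ γ' : M} (hγ : γ ∈ R.Φ) {i l : ℕ} (hil : i < l) (hl : l < G.k)
    (h1 : 0 < G.P i γ) (h2 : 0 < G.P l γ) (he : γ + γ' = G.β i + G.β l) (hne : γ ≠ γ') :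
    γ - γ' ∉ R.Φ := by
  have hi := hil.trans hl
  intro hd
  have he' : γ' = G.β i + G.β l - γ := by rw [← he]; abel
  have hγ' : γ' ∈ R.Φ := by rw [he']; exact G.compl_mem hU hab hγ hil hl h1 h2
  obtain ⟨q, e1, e2, -, -, -⟩ := G.two_pos hU hab hγ hil hl h1 h2
  have e1' : G.P i γ' = 1 := by
    rw [he', map_sub, map_add, G.P_self hU hi, G.P_ne hU hi hl hil.ne]; omega
  have e2' : G.P l γ' = 1 := by
    rw [he', map_sub, map_add, G.P_self hU hl, G.P_ne hU hl hi hil.ne']; omega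
  obtain ⟨q', -, -, -, -, -⟩ := G.two_pos hU hab hγ' hil hl (by omega) (by omega)
  have hpos : 0 < R.p γ' γ := by
    by_contra hc
    rcases lt_or_eq_of_le (not_lt.1 hc) with h | h
    · refine hab _ _ q q' (R.add_mem hγ hγ' h ?_)
      intro hh; rw [hh, map_neg] at e1; omega
    · have := R.refl_mem _ hd _ hγ'
      rw [map_sub, h, R.p_self _ hγ'] at this
      apply hab _ _ q q'
      convert this using 1
      simp [two_zsmul]; abel
  have hsum : R.p γ' (G.β i) + R.p γ' (G.β l) = R.p γ' γ + 2 := by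
    rw [← map_add, ← he, map_add, R.p_self _ hγ']
  have fin : ∀ a b, a < G.k → b < G.k → a ≠ b → G.P b γ' = 1 → γ + γ' = G.β a + G.β b →
      2 ≤ R.p γ' (G.β a) → False := by
    intro a b ha hb hab' hPb hab2 hc
    have hk := R.neg_mem _ (R.refl_mem _ (G.mem_Φ hU ha) _ hγ')
    have hPk : G.P b (-(G.β a - R.p γ' (G.β a) • γ')) = R.p γ' (G.β a) := by
      rw [map_neg, map_sub, map_zsmul, hPb, G.P_ne hU hb ha hab'.symm]; simp
    have hkb := G.L2 hU hab hk hb (by omega)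
    rw [hkb, G.P_self hU hb] at hPk
    rw [← hPk, two_zsmul] at hkb
    apply hne
    have : γ + γ' = γ' + γ' := by rw [hab2, ← hkb]; abel
    exact add_right_cancel this
  by_cases hc : 2 ≤ R.p γ' (G.β i)
  · exact fin i l hi hl hil.ne e2' he hc
  · exact fin l i hl hi hil.ne' e1' (by rw [he]; abel) (by omega)

/-- numbers of the pair are balanced -/
theorem pair_balance (hU : Upper R N) (hab : ∀ γ η, G.Q γ → G.Q η → γ + η ∉ R.Φ)
    {γ : M} (hγ : γ ∈ R.Φ) {i l : ℕ} (hil : i < l) (hl : l < G.k)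
    (h1 : 0 < G.P i γ) (h2 : 0 < G.P l γ) : R.p γ (G.β i) = R.p γ (G.β l) := by
  have hi := hil.trans hl
  have hγ' := G.compl_mem hU hab hγ hil hl h1 h2
  obtain ⟨q, e1, e2, -, -, -⟩ := G.two_pos hU hab hγ hil hl h1 h2
  have a1 := R.pos_symm γ hγ _ (G.mem_Φ hU hi) h1
  have a2 := R.pos_symm γ hγ _ (G.mem_Φ hU hl) h2
  have hsum : R.p γ (G.β i) + R.p γ (G.β l) = R.p γ (G.β i + G.β l - γ) + 2 := by
    rw [map_sub, map_add, R.p_self _ hγ]; ring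
  have fin : ∀ a b, a < G.k → b < G.k → a ≠ b → G.P b γ = 1 →
      2 ≤ R.p γ (G.β a) → R.p γ (G.β a) = 2 ∧ G.β a + G.β b = γ + γ := by
    intro a b ha hb hab' hPb hc
    have hk := R.neg_mem _ (R.refl_mem _ (G.mem_Φ hU ha) _ hγ)
    have hPk : G.P b (-(G.β a - R.p γ (G.β a) • γ)) = R.p γ (G.β a) := by
      rw [map_neg, map_sub, map_zsmul, hPb, G.P_ne hU hb ha hab'.symm]; simp
    have hkb := G.L2 hU hab hk hb (by omega)
    rw [hkb, G.P_self hU hb] at hPk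
    rw [← hPk, two_zsmul] at hkb
    refine ⟨hPk.symm, ?_⟩
    rw [← hkb]; abel
  by_cases hc : 2 ≤ R.p γ (G.β i)
  · obtain ⟨b1, b2⟩ := fin i l hi hl hil.ne e2 hc
    rw [b2, add_sub_cancel_right, R.p_self _ hγ] at hsum; omega
  by_cases hc' : 2 ≤ R.p γ (G.β l)
  · obtain ⟨b1, b2⟩ := fin l i hl hi hil.ne' e1 hc'
    rw [add_comm (G.β i), b2, add_sub_cancel_right, R.p_self _ hγ] at hsum; omega
  omega

/-- The strongly orthogonal family attached to `j`. -/
theorem exists_family (hU : Upper R N) (hab : ∀ γ η, G.Q γ → G.Q η → γ + η ∉ R.Φ)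
    {j : ℕ} (hj : j < G.k) : ∃ g : ℕ → M,
    (∀ i ≤ j, g i ∈ R.Φ ∧ (∑ r ∈ Finset.range (j+1), G.P r (g i) = 2) ∧
      (∀ r ≤ j, G.P r (g i) = G.P (j - r) (g i)) ∧ ∀ r, j < r → r < G.k → G.P r (g i) = 0) ∧
    (∀ i ≤ j, ∀ i' ≤ j, g i ≠ g i' → g i - g i' ∉ R.Φ) ∧
    ∑ i ∈ Finset.range (j+1), g i = ∑ i ∈ Finset.range (j+1), G.β i := by
  have hex : ∀ i, ∃ η, i < j - i → η ∈ R.Φ ∧ 0 < G.P i η ∧ 0 < G.P (j - i) η := by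
    intro i
    by_cases h : i < j - i
    · obtain ⟨η, a, b, c⟩ := G.exists_J hU hab h (by omega)
      exact ⟨η, fun _ => ⟨a, b, c⟩⟩
    · exact ⟨0, fun h' => absurd h' h⟩
  choose η hη using hex
  let g : ℕ → M := fun i => if i < j - i then η i else if i = j - i then G.β i else
    G.β (j - i) + G.β i - η (j - i)
  have g1 : ∀ i, i < j - i → g i = η i := fun i h => by simp only [g, if_pos h]
  have g2 : ∀ i, i = j - i → g i = G.β i := fun i h => by
    simp only [g, if_neg (show ¬ i < j - i by omega), if_pos h]
  have g3 : ∀ i, j - i < i → g i = G.β (j - i) + G.β i - η (j - i) := fun i h => by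
    simp only [g, if_neg (show ¬ i < j - i by omega), if_neg (show ¬ i = j - i by omega)]
  -- pairings
  have key : ∀ i ≤ j, i ≠ j - i → g i ∈ R.Φ ∧ G.P i (g i) = 1 ∧ G.P (j - i) (g i) = 1 ∧
      ∀ r < G.k, r ≠ i → r ≠ j - i → G.P r (g i) = 0 := by
    intro i hi hne
    rcases lt_or_gt_of_ne hne with h | h
    · rw [g1 i h]
      obtain ⟨a, b, c⟩ := hη i h
      obtain ⟨-, e1, e2, e3, -⟩ := G.two_pos hU hab a h (by omega) b c
      exact ⟨a, e1, e2, e3⟩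
    · rw [g3 i h]
      have h' : j - i < j - (j - i) := by omega
      have hji : j - (j - i) = i := by omega
      obtain ⟨a, b, c⟩ := hη (j - i) h'
      rw [hji] at c
      obtain ⟨-, e1, e2, e3, -⟩ := G.two_pos hU hab a h (by omega) b c
      refine ⟨G.compl_mem hU hab a h (by omega) b c, ?_, ?_, ?_⟩
      · rw [map_sub, map_add, G.P_self hU (by omega), G.P_ne hU (by omega) (by omega) (by omega)]; omega
      · rw [map_sub, map_add, G.P_self hU (by omega), G.P_ne hU (by omega) (by omega) (by omega)]; omega
      · intro r hr h1 h2
        rw [map_sub, map_add, G.P_ne hU hr (by omega) (by omega), G.P_ne hU hr (by omega) (by omega),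
          e3 r hr h2 h1]; omega
  have pairsum : ∀ i ≤ j, g i + g (j - i) = G.β i + G.β (j - i) := by
    intro i hi
    have hji : j - (j - i) = i := by omega
    rcases lt_trichotomy i (j - i) with h | h | h
    · rw [g1 i h, g3 (j - i) (by omega), hji]; abel
    · rw [← h, g2 i h]
    · rw [g3 i h, g1 (j - i) (by omega)]; abel
  refine ⟨g, ?_, ?_, ?_⟩
  · intro i hi
    by_cases hne : i = j - i
    · rw [g2 i hne]
      have hi' : i < G.k := by omega
      refine ⟨G.mem_Φ hU hi', ?_, ?_, ?_⟩
      · rw [Finset.sum_eq_single_of_mem i (Finset.mem_range.2 (by omega)) (fun r hr hrm =>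
          G.P_ne hU (by have := Finset.mem_range.1 hr; omega) hi' hrm), G.P_self hU hi']
      · intro r hr
        by_cases hri : r = i
        · rw [hri, ← hne]
        · rw [G.P_ne hU (by omega) hi' hri, G.P_ne hU (by omega) hi' (by omega)]
      · intro r hr hrk; exact G.P_ne hU hrk hi' (by omega)
    · obtain ⟨a, b, c, d⟩ := key i hi hne
      refine ⟨a, ?_, ?_, ?_⟩
      · rw [Finset.sum_eq_add_of_mem i (j - i) (Finset.mem_range.2 (by omega)) (Finset.mem_range.2 (by omega)) hne
          (fun r hr hrr => d r (by have := Finset.mem_range.1 hr; omega) hrr.1 hrr.2), b, c]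
        norm_num
      · intro r hr
        by_cases h1 : r = i
        · rw [h1, b, c]
        by_cases h2 : r = j - i
        · rw [show j - r = i by omega, h2, b, c]
        rw [d r (by omega) h1 h2, d (j - r) (by omega) (by omega) (by omega)]
      · intro r hr hrk; exact d r hrk (by omega) (by omega)
  · intro i hi i' hi' hne hd
    -- generic contradiction lemma via a root with two distinct indices
    by_cases hm : i = j - i
    · by_cases hm' : i' = j - i'
      · exact hne (by rw [show i = i' by omega])
      · obtain ⟨a, b, c, d⟩ := key i' hi' hm'
        rw [g2 i hm] at hd hne
        have hP : G.P i (G.β i - g i') = 2 := by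
          rw [map_sub, G.P_self hU (by omega), d i (by omega) (by omega) (by omega)]; rfl
        have := G.L2 hU hab hd (by omega) hP.ge
        have h0 : g i' = 0 := by simpa using this
        rw [h0] at b; simp at b
    · obtain ⟨a, b, c, d⟩ := key i hi hm
      by_cases hm' : i' = j - i'
      · rw [g2 i' hm'] at hd
        have hP : G.P i' (G.β i' - g i) = 2 := by
          rw [map_sub, G.P_self hU (by omega), d i' (by omega) (by omega) (by omega)]; rfl
        have := G.L2 hU hab (R.sub_mem_comm hd) (by omega) hP.ge
        have h0 : g i = 0 := by simpa using this
        rw [h0] at b; simp at b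
      · obtain ⟨a', b', c', d'⟩ := key i' hi' hm'
        by_cases hii : i' = j - i
        · subst hii
          rcases lt_or_gt_of_ne hm with h | h
          · exact G.pair_diff hU hab a h (by omega) (by omega) (by omega) (pairsum i hi) hne hd
          · have := G.pair_diff hU hab a (i := j - i) (l := i) h (by omega) (by omega) (by omega)
              (by rw [pairsum i hi]; abel) hne
            exact this hd
        · have hne2 : i ≠ i' := by rintro rfl; exact hne rfl
          have x1 : G.P i (g i - g i') = 1 := by
            rw [map_sub, b, d' i (by omega) (by omega) (by omega)]; rfl
          have x2 : G.P (j - i) (g i - g i') = 1 := by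
            rw [map_sub, c, d' (j - i) (by omega) (by omega) (by omega)]; rfl
          have x3 : G.P i' (g i - g i') = -1 := by
            rw [map_sub, b', d i' (by omega) (by omega) (by omega)]; rfl
          have x4 : G.P (j - i') (g i - g i') = -1 := by
            rw [map_sub, c', d (j - i') (by omega) (by omega) (by omega)]; rfl
          have nope : ∀ x ∈ R.Φ, 0 < R.ht x → ∀ a b, a < G.k → b < G.k → a ≠ b → G.P a x = -1 →
              G.P b x = -1 → False := by
            intro x hx hxp a b ha hb hab' y1 y2
            rcases G.Lemα hU hab hx hxp with h | ⟨m, s, hms, hs, z1, z2, z3⟩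
            · have := h a ha; omega
            · have w1 : a = s := by
                by_contra hc
                by_cases hc2 : a = m
                · subst hc2; omega
                · have := z3 a ha hc hc2; omega
              have w2 : b = s := by
                by_contra hc
                by_cases hc2 : b = m
                · subst hc2; omega
                · have := z3 b hb hc hc2; omega
              omega
          have hh := R.ht_ne _ hd
          rcases lt_or_gt_of_ne hh with h | h
          · exact nope _ (R.neg_mem _ hd) (by rw [map_neg]; omega) i (j - i) (by omega) (by omega)
              hm (by rw [map_neg, x1]) (by rw [map_neg, x2])
          · exact nope _ hd h i' (j - i') (by omega) (by omega) hm' x3 x4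
  · have e1 : ∀ f : ℕ → M, ∑ i ∈ Finset.range (j+1), f (j - i) = ∑ i ∈ Finset.range (j+1), f i := by
      intro f
      have := Finset.sum_range_reflect f (j+1)
      rw [← this]
      apply Finset.sum_congr rfl
      intro i hi
      congr 1
    -- swap halves
    have hlow : ∀ i ∈ Finset.range (j+1), g i - G.β i = -(g (j - i) - G.β (j - i)) := by
      intro i hi
      have := pairsum i (by have := Finset.mem_range.1 hi; omega)
      have h2 : g i = G.β i + G.β (j - i) - g (j - i) := by rw [← this]; abel
      rw [h2]; abel
    rw [← sub_eq_zero, ← Finset.sum_sub_distrib]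
    refine Finset.sum_involution (fun i _ => j - i) ?_ ?_ ?_ ?_
    · intro i hi; rw [hlow i hi]; abel
    · intro i hi h1 h2
      apply h1
      rw [g2 i h2.symm, sub_self]
    · intro i hi; simp
    · intro i hi; have := Finset.mem_range.1 hi; omega

/-- the special positive root attached to `i < l` -/
theorem exists_delta (hU : Upper R N) (hab : ∀ γ η, G.Q γ → G.Q η → γ + η ∉ R.Φ)
    {i l : ℕ} (hil : i < l) (hl : l < G.k) :
    ∃ δ ∈ R.Φ, 0 < R.ht δ ∧ G.P i δ = 1 ∧ G.P l δ = -1 ∧ ∀ r < G.k, r ≠ i → r ≠ l → G.P r δ = 0 := by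
  have hi := hil.trans hl
  obtain ⟨η, hη, a, b⟩ := G.exists_J hU hab hil hl
  obtain ⟨-, e1, e2, e3, hd, hdp⟩ := G.two_pos hU hab hη hil hl a b
  refine ⟨_, hd, hdp, ?_, ?_, ?_⟩
  · rw [map_sub, e1, G.P_ne hU hi hl hil.ne]; rfl
  · rw [map_sub, e2, G.P_self hU hl]; rfl
  · intro r hr h1 h2; rw [map_sub, e3 r hr h1 h2, G.P_ne hU hr hl h2]; rfl

theorem Q_of_pair (hU : Upper R N) (hab : ∀ γ η, G.Q γ → G.Q η → γ + η ∉ R.Φ)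
    {γ : M} (hγ : γ ∈ R.Φ) {i l : ℕ} (hil : i < l) (hl : l < G.k)
    (h : G.P i γ + G.P l γ = 2) : G.Q γ := by
  by_cases h1 : 2 ≤ G.P i γ
  · rw [G.L2 hU hab hγ (by omega) h1]; exact .base i (by omega)
  by_cases h2 : 2 ≤ G.P l γ
  · rw [G.L2 hU hab hγ (by omega) h2]; exact .base l (by omega)
  exact (G.two_pos hU hab hγ hil hl (by omega) (by omega)).1

end Greedy
end CPF

namespace CPF

section Free
open MvPolynomial

theorem li_of_degree_inj {σ : Type*} (m : MonomialOrder σ) {κ : Type*} (E : κ → MvPolynomial σ ℂ)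
    (h0 : ∀ i, E i ≠ 0) (hinj : Function.Injective fun i => m.degree (E i)) :
    LinearIndependent ℂ E := by
  rw [linearIndependent_iff']
  intro s g hs i hi
  by_contra hgi
  have hne : (s.filter fun i => g i ≠ 0).Nonempty := ⟨i, by simp [hi, hgi]⟩
  obtain ⟨j, hj, hmax⟩ := Finset.exists_max_image _ (fun i => m.toSyn (m.degree (E i))) hne
  simp only [Finset.mem_filter] at hj hmax
  have h1 := congrArg (coeff (m.degree (E j))) hs
  rw [coeff_sum, coeff_zero, Finset.sum_eq_single j] at h1
  · rw [coeff_smul, smul_eq_mul] at h1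
    rcases mul_eq_zero.1 h1 with h | h
    · exact hj.2 h
    · exact (m.coeff_degree_ne_zero_iff.2 (h0 j)) h
  · intro l hl hlj
    rw [coeff_smul, smul_eq_mul]
    by_cases hgl : g l = 0
    · rw [hgl, zero_mul]
    · rw [m.coeff_eq_zero_of_lt, mul_zero]
      refine lt_of_le_of_ne (hmax l ⟨hl, hgl⟩) fun h => hlj (hinj (m.toSyn.injective h))
  · intro h; exact absurd hj.1 h

theorem decomp_exists {σ ι : Type*} [Fintype ι] (d : ι → σ →₀ ℕ)
    (hd : ∀ j, d j ≠ 0) (D : σ →₀ ℕ) :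
    ∃ a : ι →₀ ℕ, ∃ b : σ →₀ ℕ, (∀ j, ¬ d j ≤ b) ∧ D = (∑ j, a j • d j) + b := by
  induction' hn : D.degree using Nat.strong_induction_on with n ih generalizing D
  by_cases h : ∀ j, ¬ d j ≤ D
  · exact ⟨0, D, h, by simp⟩
  · push Not at h
    obtain ⟨j, hj⟩ := h
    obtain ⟨D', rfl⟩ := exists_add_of_le hj
    have hpos : (d j).degree ≠ 0 := by
      rw [Ne, Finsupp.degree_eq_zero_iff]; exact hd j
    obtain ⟨a, b, hb, hab⟩ := ih D'.degree (by rw [← hn, map_add]; omega) D' rfl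
    refine ⟨a + Finsupp.single j 1, b, hb, ?_⟩
    rw [hab, ← add_assoc]
    congr 1
    simp only [Finsupp.add_apply, add_smul, Finset.sum_add_distrib]
    rw [add_comm]
    congr 1
    rw [Finset.sum_eq_single j]
    · simp
    · intro l _ hl; simp [Ne.symm hl]
    · simp

theorem decomp_unique {σ ι : Type*} [Fintype ι] (d : ι → σ →₀ ℕ)
    (hdisj : ∀ i j, i ≠ j → Disjoint (d i).support (d j).support)
    (a a' : ι →₀ ℕ) (b b' : σ →₀ ℕ) (hb : ∀ j, ¬ d j ≤ b) (hb' : ∀ j, ¬ d j ≤ b')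
    (h : (∑ j, a j • d j) + b = (∑ j, a' j • d j) + b') : a = a' ∧ b = b' := by
  have key : ∀ (a a' : ι →₀ ℕ) (b b' : σ →₀ ℕ), (∀ j, ¬ d j ≤ b) →
      (∑ j, a j • d j) + b = (∑ j, a' j • d j) + b' → ∀ j, a' j ≤ a j := by
    intro a a' b b' hb h j
    by_contra hlt
    push Not at hlt
    apply hb j
    intro x
    by_cases hx : d j x = 0
    · rw [hx]; exact Nat.zero_le _
    · have e : ∀ a : ι →₀ ℕ, (∑ j, a j • d j) x = a j * d j x := by
        intro a
        rw [Finsupp.finsetSum_apply, Finset.sum_eq_single j]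
        · simp
        · intro l _ hl
          have := (Finset.disjoint_left.1 (hdisj j l (Ne.symm hl))) (Finsupp.mem_support_iff.2 hx)
          rw [Finsupp.notMem_support_iff] at this
          simp [this]
        · simp
      have h1 := DFunLike.congr_fun h x
      rw [Finsupp.add_apply, Finsupp.add_apply, e, e] at h1
      nlinarith
  have ha : a = a' := by
    ext j; exact le_antisymm (key a' a b' b hb' h.symm j) (key a a' b b' hb h j)
  subst ha
  exact ⟨rfl, by simpa using h⟩

theorem free_of_leading {σ ι : Type*} [Fintype ι] (m : MonomialOrder σ)
    (p : ι → MvPolynomial σ ℂ) (hd : ∀ j, m.degree (p j) ≠ 0)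
    (hdisj : ∀ i j, i ≠ j → Disjoint (m.degree (p i)).support (m.degree (p j)).support)
    (A : Subalgebra ℂ (MvPolynomial σ ℂ)) (hA : A = Algebra.adjoin ℂ (Set.range p)) :
    Module.Free A (MvPolynomial σ ℂ) := by
  have hp : ∀ j, p j ≠ 0 := fun j => m.ne_zero_of_degree_ne_zero (hd j)
  let B := {b : σ →₀ ℕ // ∀ j, ¬ m.degree (p j) ≤ b}
  let E : (Σ _ : B, (ι →₀ ℕ)) → MvPolynomial σ ℂ := fun x =>
    aeval p (monomial x.2 (1 : ℂ)) * monomial x.1.1 1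
  have hpow : ∀ a : ι →₀ ℕ, aeval p (monomial a (1 : ℂ)) = ∏ j, p j ^ a j := by
    intro a
    rw [aeval_monomial, map_one, one_mul, Finsupp.prod_fintype]
    simp
  have hpow0 : ∀ a : ι →₀ ℕ, ∏ j, p j ^ a j ≠ 0 := fun a =>
    Finset.prod_ne_zero_iff.2 fun j _ => pow_ne_zero _ (hp j)
  have hE0 : ∀ x, E x ≠ 0 := by
    intro x
    simp only [E]
    rw [hpow]
    exact mul_ne_zero (hpow0 _) (by simp)
  have hEd : ∀ x, m.degree (E x) = (∑ j, x.2 j • m.degree (p j)) + x.1.1 := by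
    intro x
    simp only [E]
    rw [hpow, m.degree_mul (hpow0 _) (by simp), m.degree_monomial, if_neg one_ne_zero,
      m.degree_prod (fun j _ => pow_ne_zero _ (hp j))]
    congr 1
    exact Finset.sum_congr rfl fun j _ => m.degree_pow _ _
  have hinj : Function.Injective fun x => m.degree (E x) := by
    rintro ⟨b, a⟩ ⟨b', a'⟩ h
    simp only [hEd] at h
    obtain ⟨h1, h2⟩ := decomp_unique _ hdisj a a' b.1 b'.1 b.2 b'.2 h
    obtain rfl : b = b' := Subtype.ext h2
    rw [h1]
  have hLI := li_of_degree_inj m E hE0 hinj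
  have hmem : ∀ P : MvPolynomial ι ℂ, aeval p P ∈ A := by
    intro P; rw [hA, Algebra.adjoin_range_eq_range_aeval]; exact ⟨P, rfl⟩
  have hex : ∀ x : A, ∃ P : MvPolynomial ι ℂ, aeval p P = (x : MvPolynomial σ ℂ) := by
    intro x
    have hx2 : (x : MvPolynomial σ ℂ) ∈ A := x.2
    have h2 : A = (aeval p : MvPolynomial ι ℂ →ₐ[ℂ] _).range := by
      rw [hA, Algebra.adjoin_range_eq_range_aeval]
    generalize (x : MvPolynomial σ ℂ) = y at hx2 ⊢
    rw [h2] at hx2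
    exact hx2
  let v : B → MvPolynomial σ ℂ := fun b => monomial b.1 1
  have hvLI : LinearIndependent A v := by
    rw [linearIndependent_iff']
    intro s g hs i hi
    choose P hP using fun b => hex (g b)
    rw [linearIndependent_iff'] at hLI
    have hz : ∀ b ∈ s, P b = 0 := by
      intro b hb
      ext a
      by_cases ha : a ∈ (P b).support
      swap
      · rw [notMem_support_iff.1 ha, coeff_zero]
      · rw [coeff_zero]
        refine hLI (s.sigma fun b => (P b).support) (fun x => coeff x.2 (P x.1)) ?_ ⟨b, a⟩
          (by simpa using ⟨hb, by simpa using ha⟩)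
        rw [Finset.sum_sigma, ← hs]
        refine Finset.sum_congr rfl fun b _ => ?_
        simp only [E, v]
        rw [Subalgebra.smul_def, smul_eq_mul, ← hP b]
        conv_rhs => rw [(P b).as_sum, map_sum, Finset.sum_mul]
        refine Finset.sum_congr rfl fun a _ => ?_
        rw [← smul_mul_assoc, ← map_smul, smul_monomial, smul_eq_mul, mul_one]
    have := hP i
    rw [hz i hi, map_zero] at this
    exact Subtype.ext this.symm
  have hspan : ∀ D : m.syn, ∀ f : MvPolynomial σ ℂ, (∀ d ∈ f.support, m.toSyn d ≤ D) →
      f ∈ Submodule.span A (Set.range v) := by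
    intro D
    induction D using WellFoundedLT.induction with
    | _ D ih =>
    intro f hf
    obtain ⟨a, b, hb, hab⟩ := decomp_exists _ hd (m.toSyn.symm D)
    let x : (Σ _ : B, (ι →₀ ℕ)) := ⟨⟨b, hb⟩, a⟩
    have hx : m.degree (E x) = m.toSyn.symm D := by rw [hEd, hab]
    have hEm : E x ∈ Submodule.span A (Set.range v) := by
      have : E x = (⟨_, hmem (monomial a 1)⟩ : A) • v ⟨b, hb⟩ := rfl
      rw [this]
      exact Submodule.smul_mem _ _ (Submodule.subset_span ⟨_, rfl⟩)
    set c : ℂ := coeff (m.toSyn.symm D) f / m.leadingCoeff (E x) with hc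
    set g := f - (⟨_, A.algebraMap_mem c⟩ : A) • E x with hg
    have hgs : ∀ d ∈ g.support, m.toSyn d < D := by
      intro d hdg
      have hcoef : coeff d g = coeff d f - c * coeff d (E x) := by
        rw [hg, coeff_sub, Subalgebra.smul_def, smul_eq_mul]
        change coeff d f - coeff d (C c * E x) = _
        rw [coeff_C_mul]
      rcases lt_trichotomy (m.toSyn d) D with h | h | h
      · exact h
      · exfalso
        apply mem_support_iff.1 hdg
        have hd' : d = m.toSyn.symm D := by rw [← h]; simp
        have hlc : m.leadingCoeff (E x) ≠ 0 := m.leadingCoeff_ne_zero_iff.2 (hE0 x)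
        have : coeff d (E x) = m.leadingCoeff (E x) := by
          rw [MonomialOrder.leadingCoeff, hx, hd']
        rw [hcoef, this, hc, div_mul_cancel₀ _ hlc, hd', sub_self]
      · exfalso
        apply mem_support_iff.1 hdg
        rw [hcoef, m.coeff_eq_zero_of_lt (f := E x) (by rw [hx]; simpa using h), mul_zero, sub_zero]
        by_contra h'
        exact absurd (hf d (mem_support_iff.2 h')) (not_le.2 h)
    have hgm : g ∈ Submodule.span A (Set.range v) := by
      by_cases hg0 : g = 0
      · rw [hg0]; exact Submodule.zero_mem _
      · exact ih _ (hgs _ (m.degree_mem_support hg0)) g fun d hd => m.le_degree hd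
    have : f = g + (⟨_, A.algebraMap_mem c⟩ : A) • E x := by rw [hg]; ring
    rw [this]
    exact Submodule.add_mem _ hgm (Submodule.smul_mem _ _ hEm)
  exact Module.Free.of_basis (Basis.mk hvLI fun f _ =>
    hspan (m.toSyn (m.degree f)) f fun d hd => m.le_degree hd)

/-- exponents, ordered first by a weight -/
structure WSyn (σ : Type*) (w : (σ →₀ ℕ) →+ ℕ) where
  val : σ →₀ ℕ

def wKey {σ : Type*} [LinearOrder σ] (w : (σ →₀ ℕ) →+ ℕ) (d : WSyn σ w) : ℕ ×ₗ Lex (σ →₀ ℕ) :=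
  toLex (w d.val, toLex d.val)

theorem wKey_inj {σ : Type*} [LinearOrder σ] (w : (σ →₀ ℕ) →+ ℕ) :
    Function.Injective (wKey w) := by
  rintro ⟨a⟩ ⟨b⟩ h
  have := congrArg (fun x => ofLex ((ofLex x).2)) h
  simp only [wKey] at this
  congr

def wEquiv {σ : Type*} (w : (σ →₀ ℕ) →+ ℕ) : WSyn σ w ≃ (σ →₀ ℕ) :=
  ⟨fun a => a.val, fun a => ⟨a⟩, fun _ => rfl, fun _ => rfl⟩

instance {σ : Type*} (w : (σ →₀ ℕ) →+ ℕ) : AddCommMonoid (WSyn σ w) := (wEquiv w).addCommMonoid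

instance {σ : Type*} [LinearOrder σ] (w : (σ →₀ ℕ) →+ ℕ) : LinearOrder (WSyn σ w) :=
  LinearOrder.lift' (wKey w) (wKey_inj w)

theorem wSyn_le {σ : Type*} [LinearOrder σ] (w : (σ →₀ ℕ) →+ ℕ) (a b : WSyn σ w) :
    a ≤ b ↔ w a.val < w b.val ∨ (w a.val = w b.val ∧ toLex a.val ≤ toLex b.val) := by
  change wKey w a ≤ wKey w b ↔ _
  rw [Prod.Lex.le_iff]
  rfl

def wOrder {σ : Type*} [LinearOrder σ] [Finite σ] (w : (σ →₀ ℕ) →+ ℕ) : MonomialOrder σ where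
  syn := WSyn σ w
  toSyn := { (wEquiv w).symm with map_add' := fun _ _ => rfl }
  isOrderedAddMonoid_syn := by
    suffices H : ∀ a b : WSyn σ w, a ≤ b → ∀ c, a + c ≤ b + c from
      ⟨H, fun a b h c => by rw [add_comm c a, add_comm c b]; exact H a b h c⟩
    intro a b h c
    rw [wSyn_le] at h ⊢
    have e1 : ∀ a b : WSyn σ w, (a + b).val = a.val + b.val := fun _ _ => rfl
    have e2 : ∀ a b : σ →₀ ℕ, toLex (a + b) = toLex a + toLex b := fun _ _ => rfl
    simp only [e1, map_add, e2]
    rcases h with h | ⟨h, h'⟩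
    · left; omega
    · right; exact ⟨by omega, by gcongr⟩
  toSyn_monotone := by
    intro a b h
    obtain ⟨c, rfl⟩ := exists_add_of_le h
    rw [wSyn_le]
    have e0 : ∀ a, ((wEquiv w).symm a).val = a := fun _ => rfl
    change w a < w (a + c) ∨ (w a = w (a + c) ∧ toLex a ≤ toLex (a + c))
    rw [map_add]
    rcases Nat.eq_zero_or_pos (w c) with h0 | h0
    · right; exact ⟨by omega, Finsupp.toLex_monotone h⟩
    · left; omega
  wellFoundedLT_syn := by
    have : WellFounded ((· < ·) : ℕ ×ₗ Lex (σ →₀ ℕ) → _ → Prop) := wellFounded_lt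
    exact ⟨InvImage.wf (wKey w) this⟩

theorem wOrder_le {σ : Type*} [LinearOrder σ] [Finite σ] (w : (σ →₀ ℕ) →+ ℕ) {a b : σ →₀ ℕ}
    (h : (wOrder w).toSyn a ≤ (wOrder w).toSyn b) : w a ≤ w b := by
  have := (wSyn_le w _ _).1 h
  rcases this with h | h
  · exact h.le
  · exact h.1.le

end Free
end CPF

namespace CPF

/-- A Lie algebra with a Chevalley-type system of root vectors for an abstract root system. -/
structure Setup (L : Type*) [LieRing L] [LieAlgebra ℂ L] {M : Type*} [AddCommGroup M]
    (R : RS M) where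
  e : M → L
  t : M →+ L
  B : M →+ M →+ ℂ
  kill : ∀ l ∈ R.Φ, ∀ m ∈ R.Φ, killingForm ℂ L (e l) (e m) = if l + m = 0 then 1 else 0
  kill_t : ∀ m, ∀ l ∈ R.Φ, killingForm ℂ L (t m) (e l) = 0
  br_zero : ∀ l ∈ R.Φ, ∀ m ∈ R.Φ, l + m ≠ 0 → l + m ∉ R.Φ → ⁅e l, e m⁆ = 0
  br_ne : ∀ l ∈ R.Φ, ∀ m ∈ R.Φ, l + m ∈ R.Φ → ∃ c : ℂ, c ≠ 0 ∧ ⁅e l, e m⁆ = c • e (l + m)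
  br_t : ∀ l ∈ R.Φ, ⁅e l, e (-l)⁆ = t l
  t_br : ∀ m, ∀ l ∈ R.Φ, ⁅t m, e l⁆ = B m l • e l
  B_symm : ∀ l ∈ R.Φ, ∀ m ∈ R.Φ, B l m = B m l
  B_p : ∀ l ∈ R.Φ, ∀ m ∈ R.Φ, 2 * B l m = (R.p m l : ℂ) * B m m
  B_ne : ∀ l ∈ R.Φ, B l l ≠ 0
  nilp : ∀ x ∈ Submodule.span ℂ (e '' {α | α ∈ R.Φ ∧ 0 < R.ht α}),
    (LieAlgebra.ad ℂ L x) ^ (Module.finrank ℂ L + 1) = 0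

theorem RS.zero_notMem {M : Type*} [AddCommGroup M] (R : RS M) : (0 : M) ∉ R.Φ := fun h =>
  R.ht_ne 0 h (map_zero _)

namespace Setup
open MvPolynomial
variable {L : Type*} [LieRing L] [LieAlgebra ℂ L] {M : Type*} [AddCommGroup M] {R : RS M}
  (S : Setup L R) (N : Finset M)

/-- the nilpotent algebra spanned by positive root vectors -/
def u : Submodule ℂ L := Submodule.span ℂ (S.e '' {α | α ∈ R.Φ ∧ 0 < R.ht α})

/-- the nilradical -/
def n : Submodule ℂ L := Submodule.span ℂ (S.e '' (N : Set M))

/-- the point of `n⁻` with given coordinates -/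
def pt : (↥N → ℂ) →ₗ[ℂ] L := ∑ η : ↥N, (LinearMap.proj η).smulRight (S.e (-η.1))

theorem pt_apply (c : ↥N → ℂ) : S.pt N c = ∑ η : ↥N, c η • S.e (-η.1) := by
  simp [pt]

theorem e_mem_u {α : M} (ha : α ∈ R.Φ) (hp : 0 < R.ht α) : S.e α ∈ S.u :=
  Submodule.subset_span ⟨α, ⟨ha, hp⟩, rfl⟩

theorem e_mem_n {γ : M} (h : γ ∈ N) : S.e γ ∈ S.n N := Submodule.subset_span ⟨γ, h, rfl⟩

variable {N}

theorem kill_pt (hU : Upper R (N : Set M)) (γ : ↥N) (c : ↥N → ℂ) :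
    killingForm ℂ L (S.e γ) (S.pt N c) = c γ := by
  rw [pt_apply, map_sum, Finset.sum_eq_single γ]
  · rw [map_smul, S.kill _ (hU.sub γ.2) _ (R.neg_mem _ (hU.sub γ.2))]; simp
  · intro η _ h
    rw [map_smul, S.kill _ (hU.sub γ.2) _ (R.neg_mem _ (hU.sub η.2)), if_neg, smul_zero]
    intro h'
    exact h (Subtype.ext (by rw [← sub_eq_add_neg, sub_eq_zero] at h'; exact h'.symm))
  · simp

theorem kill_n (hU : Upper R (N : Set M)) {z : L} (hz : z ∈ S.n N) (y : L) :
    killingForm ℂ L z y = killingForm ℂ L z (S.pt N fun γ => killingForm ℂ L (S.e γ) y) := by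
  induction hz using Submodule.span_induction with
  | mem x h =>
    obtain ⟨γ, hγ, rfl⟩ := h
    exact (S.kill_pt hU ⟨γ, hγ⟩ fun γ => killingForm ℂ L (S.e γ) y).symm
  | zero => simp
  | add a b _ _ ha hb => simp only [map_add, LinearMap.add_apply]; rw [ha, hb]
  | smul c a _ ha => simp only [map_smul, LinearMap.smul_apply]; rw [ha]

theorem ad_e_n (hU : Upper R (N : Set M)) {α γ : M} (ha : α ∈ R.Φ) (hp : 0 < R.ht α)
    (hγ : γ ∈ N) : ⁅S.e α, S.e γ⁆ ∈ S.n N := by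
  by_cases h : α + γ ∈ R.Φ
  · obtain ⟨c, _, hc⟩ := S.br_ne α ha γ (hU.sub hγ) h
    rw [hc]
    refine Submodule.smul_mem _ _ (S.e_mem_n N ?_)
    rw [add_comm] at h ⊢
    exact hU.closed γ hγ α ha hp h
  · rw [S.br_zero α ha γ (hU.sub hγ) _ h]
    · exact Submodule.zero_mem _
    · intro h0
      have := congrArg R.ht h0
      rw [map_add, map_zero] at this
      have := hU.pos γ hγ
      omega

theorem ad_u_n (hU : Upper R (N : Set M)) {x z : L} (hx : x ∈ S.u) (hz : z ∈ S.n N) :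
    ⁅x, z⁆ ∈ S.n N := by
  induction hx using Submodule.span_induction with
  | mem x h =>
    obtain ⟨α, ⟨ha, hp⟩, rfl⟩ := h
    induction hz using Submodule.span_induction with
    | mem x h => obtain ⟨γ, hγ, rfl⟩ := h; exact S.ad_e_n hU ha hp hγ
    | zero => simp
    | add a b _ _ ha hb => rw [lie_add]; exact Submodule.add_mem _ ha hb
    | smul c a _ ha => rw [lie_smul]; exact Submodule.smul_mem _ _ ha
  | zero => simp
  | add a b _ _ ha hb => rw [add_lie]; exact Submodule.add_mem _ ha hb
  | smul c a _ ha => rw [smul_lie]; exact Submodule.smul_mem _ _ ha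

theorem kill_ad (x y z : L) : killingForm ℂ L ⁅x, y⁆ z = - killingForm ℂ L y ⁅x, z⁆ := by
  have h := LieModule.traceForm_apply_lie_apply ℂ L L y x z
  rw [killingForm, ← h, ← lie_skew, map_neg, LinearMap.neg_apply]

/-- coordinates of `ad x y` only depend on coordinates of `y` -/
theorem kill_ad_coord (hU : Upper R (N : Set M)) {x : L} (hx : x ∈ S.u) (γ : ↥N) (y : L) :
    killingForm ℂ L (S.e γ) ⁅x, y⁆ =
      ∑ η : ↥N, killingForm ℂ L (S.e γ) ⁅x, S.e (-η.1)⁆ * killingForm ℂ L (S.e η) y := by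
  have h1 := kill_ad x (S.e γ) y
  have h2 := S.kill_n hU (S.ad_u_n hU hx (S.e_mem_n N γ.2)) y
  rw [h1, kill_ad, pt_apply] at h2
  rw [neg_inj] at h2
  rw [h2, lie_sum, map_sum]
  refine Finset.sum_congr rfl fun η _ => ?_
  rw [lie_smul, map_smul, smul_eq_mul, mul_comm]

variable (N)

/-- linear form `w ↦ κ(e_γ, A w)` as a polynomial -/
def lin (γ : ↥N) (A : Module.End ℂ L) : MvPolynomial ↥N ℂ :=
  ∑ η : ↥N, C (killingForm ℂ L (S.e γ) (A (S.e (-η.1)))) * X η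

/-- the derivation given by the infinitesimal coadjoint action -/
def D (x : L) : Derivation ℂ (MvPolynomial ↥N ℂ) (MvPolynomial ↥N ℂ) :=
  mkDerivation ℂ fun γ => S.lin N γ (LieAlgebra.ad ℂ L x)

variable {N}

theorem D_X (x : L) (γ : ↥N) : S.D N x (X γ) = S.lin N γ (LieAlgebra.ad ℂ L x) := by
  rw [D, mkDerivation_X]

theorem lin_add (γ : ↥N) (A A' : Module.End ℂ L) :
    S.lin N γ (A + A') = S.lin N γ A + S.lin N γ A' := by
  simp [lin, add_mul, Finset.sum_add_distrib]

theorem lin_smul (γ : ↥N) (c : ℂ) (A : Module.End ℂ L) :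
    S.lin N γ (c • A) = C c * S.lin N γ A := by
  simp [lin, Finset.mul_sum, mul_assoc]

theorem lin_zero (γ : ↥N) : S.lin N γ 0 = 0 := by simp [lin]

theorem lin_one (hU : Upper R (N : Set M)) (γ : ↥N) : S.lin N γ 1 = X γ := by
  rw [lin, Finset.sum_eq_single γ]
  · rw [Module.End.one_apply, S.kill _ (hU.sub γ.2) _ (R.neg_mem _ (hU.sub γ.2))]; simp
  · intro η _ h
    rw [Module.End.one_apply, S.kill _ (hU.sub γ.2) _ (R.neg_mem _ (hU.sub η.2)), if_neg]
    · simp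
    intro h'
    exact h (Subtype.ext (by rw [← sub_eq_add_neg, sub_eq_zero] at h'; exact h'.symm))
  · simp

theorem eval_lin (γ : ↥N) (A : Module.End ℂ L) (c : ↥N → ℂ) :
    eval c (S.lin N γ A) = killingForm ℂ L (S.e γ) (A (S.pt N c)) := by
  rw [lin, pt_apply, map_sum, map_sum, map_sum]
  refine Finset.sum_congr rfl fun η _ => ?_
  rw [map_mul, eval_C, eval_X, map_smul, map_smul, smul_eq_mul, mul_comm]

theorem lin_comp (hU : Upper R (N : Set M)) {x : L} (hx : x ∈ S.u) (γ : ↥N)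
    (A : Module.End ℂ L) :
    ∑ η : ↥N, C (killingForm ℂ L (S.e γ) (LieAlgebra.ad ℂ L x (S.e (-η.1)))) * S.lin N η A =
      S.lin N γ (LieAlgebra.ad ℂ L x * A) := by
  simp only [lin, Finset.mul_sum]
  rw [Finset.sum_comm]
  refine Finset.sum_congr rfl fun ζ _ => ?_
  simp only [← mul_assoc, ← C_mul]
  rw [← Finset.sum_mul, ← map_sum]
  congr 2
  exact (S.kill_ad_coord hU hx γ _).symm

theorem D_add (x y : L) : S.D N (x + y) = S.D N x + S.D N y := by
  apply derivation_ext
  intro i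
  rw [Derivation.add_apply, D_X, D_X, D_X, map_add, lin_add]

theorem D_smul (c : ℂ) (x : L) : S.D N (c • x) = c • S.D N x := by
  apply derivation_ext
  intro i
  rw [Derivation.smul_apply, D_X, D_X, map_smul, lin_smul, smul_eq_C_mul]

variable (N)

/-- the flow of `D x` -/
def fl (x : L) : MvPolynomial ↥N ℂ →ₐ[ℂ] Polynomial (MvPolynomial ↥N ℂ) :=
  aeval fun γ => ∑ i ∈ Finset.range (Module.finrank ℂ L + 1),
    Polynomial.monomial i (C ((i.factorial : ℂ)⁻¹) * S.lin N γ (LieAlgebra.ad ℂ L x ^ i))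

/-- the coadjoint action in coordinates -/
def act (x : L) (c : ↥N → ℂ) : ↥N → ℂ := fun γ =>
  killingForm ℂ L (S.e γ) (nilExp (LieAlgebra.ad ℂ L x) (S.pt N c))

variable {N}

theorem fl_X (x : L) (γ : ↥N) : S.fl N x (X γ) =
    ∑ i ∈ Finset.range (Module.finrank ℂ L + 1),
    Polynomial.monomial i (C ((i.factorial : ℂ)⁻¹) * S.lin N γ (LieAlgebra.ad ℂ L x ^ i)) := by
  rw [fl, aeval_X]

theorem fl_C (x : L) (a : ℂ) : S.fl N x (C a) = Polynomial.C (C a) := by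
  rw [fl, aeval_C]; rfl

theorem derivative_fl (hU : Upper R (N : Set M)) {x : L} (hx : x ∈ S.u)
    (f : MvPolynomial ↥N ℂ) :
    Polynomial.derivative (S.fl N x f) = S.fl N x (S.D N x f) := by
  induction f using MvPolynomial.induction_on with
  | C a => rw [fl_C, Polynomial.derivative_C, ← algebraMap_eq, Derivation.map_algebraMap, map_zero]
  | add f g hf hg => simp only [map_add, hf, hg]
  | mul_X f γ hf =>
    rw [map_mul, Polynomial.derivative_mul, hf, Derivation.leibniz, map_add, smul_eq_mul,
      smul_eq_mul, map_mul, map_mul]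
    have key : Polynomial.derivative (S.fl N x (X γ)) = S.fl N x (S.D N x (X γ)) := by
      rw [D_X, lin, map_sum, fl_X]
      simp only [map_mul, fl_C, fl_X, Finset.mul_sum, Polynomial.C_mul_monomial]
      rw [Finset.sum_comm]
      simp only [← map_sum]
      have e1 : ∀ i : ℕ, (∑ η : ↥N, C (killingForm ℂ L (S.e γ) (LieAlgebra.ad ℂ L x (S.e (-η.1)))) *
          (C ((i.factorial : ℂ)⁻¹) * S.lin N η (LieAlgebra.ad ℂ L x ^ i))) =
          C ((i.factorial : ℂ)⁻¹) * S.lin N γ (LieAlgebra.ad ℂ L x ^ (i + 1)) := by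
        intro i
        rw [pow_succ', ← S.lin_comp hU hx, Finset.mul_sum]
        refine Finset.sum_congr rfl fun η _ => by ring
      rw [Finset.sum_congr rfl fun i _ => congrArg (Polynomial.monomial i) (e1 i), Polynomial.derivative_sum]
      rw [Finset.sum_range_succ']
      rw [Finset.sum_range_succ (n := Module.finrank ℂ L)]
      rw [S.nilp x hx, lin_zero, mul_zero, Polynomial.monomial_zero_right, add_zero]
      simp only [Polynomial.derivative_monomial, Nat.cast_zero, mul_zero,
        Polynomial.monomial_zero_right, add_zero, Nat.add_sub_cancel]
      refine Finset.sum_congr rfl fun i _ => ?_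
      congr 1
      rw [mul_right_comm]
      congr 1
      rw [← map_natCast (C : ℂ →+* MvPolynomial ↥N ℂ), ← C_mul]
      congr 1
      rw [Nat.factorial_succ]
      push_cast
      have h1 : (i.factorial : ℂ) ≠ 0 := by exact_mod_cast i.factorial_ne_zero
      have h2 : (i : ℂ) + 1 ≠ 0 := by exact_mod_cast Nat.succ_ne_zero i
      field_simp
    rw [key]
    ring

theorem fl_eval_zero (hU : Upper R (N : Set M)) (x : L) (f : MvPolynomial ↥N ℂ) :
    Polynomial.eval 0 (S.fl N x f) = f := by
  have : ((Polynomial.aeval (0 : MvPolynomial ↥N ℂ)).restrictScalars ℂ).comp (S.fl N x) =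
      AlgHom.id ℂ _ := by
    apply MvPolynomial.algHom_ext
    intro γ
    rw [AlgHom.comp_apply, fl_X]
    simp only [AlgHom.restrictScalars_apply, map_sum, Polynomial.aeval_monomial, AlgHom.id_apply]
    rw [Finset.sum_range_succ', Finset.sum_eq_zero]
    · simp [S.lin_one hU]
    · intro i _; simp
  have h := DFunLike.congr_fun this f
  simpa [Polynomial.aeval_def] using h

theorem fl_inj (hU : Upper R (N : Set M)) (x : L) {f : MvPolynomial ↥N ℂ}
    (h : S.fl N x f = 0) : f = 0 := by
  rw [← S.fl_eval_zero hU x f, h, Polynomial.eval_zero]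

theorem fl_eval (x : L) (s : ℂ) (c : ↥N → ℂ) (f : MvPolynomial ↥N ℂ) :
    Polynomial.eval s ((S.fl N x f).map (eval c)) = eval (S.act N (s • x) c) f := by
  have h1 : ((Polynomial.evalRingHom s).comp (Polynomial.mapRingHom (eval c))).comp
      (S.fl N x).toRingHom = eval (S.act N (s • x) c) := by
    apply MvPolynomial.ringHom_ext
    · intro a
      simp
    · intro γ
      change Polynomial.eval s ((S.fl N x (X γ)).map (eval c)) = _
      rw [fl_X, eval_X, act, nilExp, Polynomial.map_sum, Polynomial.eval_finsetSum,
        LinearMap.sum_apply, map_sum]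
      refine Finset.sum_congr rfl fun i _ => ?_
      rw [Polynomial.map_monomial, Polynomial.eval_monomial, map_mul, eval_C, eval_lin, map_smul,
        smul_pow, LinearMap.smul_apply, LinearMap.smul_apply, map_smul, map_smul, smul_eq_mul,
        smul_eq_mul]
      ring
  exact DFunLike.congr_fun h1 f

theorem fl_eq_C (hU : Upper R (N : Set M)) {x : L} (hx : x ∈ S.u) {f : MvPolynomial ↥N ℂ}
    (h : S.D N x f = 0) : S.fl N x f = Polynomial.C f := by
  have h1 := S.derivative_fl hU hx f
  rw [h, map_zero] at h1
  have h2 := Polynomial.eq_C_of_derivative_eq_zero h1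
  rw [h2]
  have h3 := S.fl_eval_zero hU x f
  rw [h2, Polynomial.eval_C] at h3
  rw [h3]

theorem D_of_fl_C (hU : Upper R (N : Set M)) {x : L} (hx : x ∈ S.u) {f g : MvPolynomial ↥N ℂ}
    (h : S.fl N x f = Polynomial.C g) : S.D N x f = 0 := by
  apply S.fl_inj hU x
  rw [← S.derivative_fl hU hx, h, Polynomial.derivative_C]

/-- killed by the derivation implies invariant -/
theorem inv_of_D (hU : Upper R (N : Set M)) {x : L} (hx : x ∈ S.u) {f : MvPolynomial ↥N ℂ}
    (h : S.D N x f = 0) (c : ↥N → ℂ) : eval (S.act N x c) f = eval c f := by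
  have h1 := S.fl_eval x 1 c f
  rw [S.fl_eq_C hU hx h, one_smul] at h1
  simpa using h1.symm

theorem D_eval_zero (hU : Upper R (N : Set M)) {x : L} (hx : x ∈ S.u) {f : MvPolynomial ↥N ℂ}
    (c : ↥N → ℂ) (a : ℂ) (h : ∀ s : ℂ, eval (S.act N (s • x) c) f = a) :
    eval c (S.D N x f) = 0 := by
  have h1 : (S.fl N x f).map (eval c) = Polynomial.C a := by
    apply Polynomial.funext
    intro s
    rw [S.fl_eval, h, Polynomial.eval_C]
  have h2 := congrArg Polynomial.derivative h1
  rw [Polynomial.derivative_map, S.derivative_fl hU hx, Polynomial.derivative_C] at h2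
  have h3 := congrArg (Polynomial.eval 0) h2
  rw [← map_zero (eval c), Polynomial.eval_map_apply, S.fl_eval_zero hU] at h3
  simpa using h3

theorem D_of_inv (hU : Upper R (N : Set M)) {x : L} (hx : x ∈ S.u) {f : MvPolynomial ↥N ℂ}
    (h : ∀ c, ∀ s : ℂ, eval (S.act N (s • x) c) f = eval c f) : S.D N x f = 0 := by
  apply MvPolynomial.funext
  intro c
  rw [S.D_eval_zero hU hx c _ (h c), map_zero]

theorem D_factor (hU : Upper R (N : Set M)) {x : L} (hx : x ∈ S.u) {f g : MvPolynomial ↥N ℂ}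
    (h : S.D N x (f * g) = 0) (h0 : f * g ≠ 0) : S.D N x f = 0 := by
  have h1 := S.fl_eq_C hU hx h
  rw [map_mul] at h1
  have hz : S.fl N x f * S.fl N x g ≠ 0 := by rw [h1]; simpa using h0
  have h2 := congrArg Polynomial.natDegree h1
  rw [Polynomial.natDegree_mul (left_ne_zero_of_mul hz) (right_ne_zero_of_mul hz),
    Polynomial.natDegree_C] at h2
  exact S.D_of_fl_C hU hx (Polynomial.eq_C_of_natDegree_eq_zero (by omega))

variable (N)

/-- the algebra of `U`-invariants -/
def A' : Subalgebra ℂ (MvPolynomial ↥N ℂ) where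
  carrier := {f | ∀ α ∈ R.Φ, 0 < R.ht α → S.D N (S.e α) f = 0}
  mul_mem' := by
    intro f g hf hg α ha hp
    rw [Derivation.leibniz, hf α ha hp, hg α ha hp]; simp
  add_mem' := by
    intro f g hf hg α ha hp
    rw [map_add, hf α ha hp, hg α ha hp, add_zero]
  algebraMap_mem' := by
    intro c α ha hp
    rw [Derivation.map_algebraMap]

variable {N}

theorem mem_A' {f : MvPolynomial ↥N ℂ} :
    f ∈ S.A' N ↔ ∀ α ∈ R.Φ, 0 < R.ht α → S.D N (S.e α) f = 0 := Iff.rfl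

theorem A'_D {f : MvPolynomial ↥N ℂ} (hf : f ∈ S.A' N) {x : L} (hx : x ∈ S.u) :
    S.D N x f = 0 := by
  induction hx using Submodule.span_induction with
  | mem x h => obtain ⟨α, ⟨ha, hp⟩, rfl⟩ := h; exact hf α ha hp
  | zero =>
    have := S.D_smul (N := N) 0 0
    rw [zero_smul, zero_smul] at this
    rw [this]; rfl
  | add a b _ _ ha hb => rw [D_add, Derivation.add_apply, ha, hb, add_zero]
  | smul c a _ ha => rw [D_smul, Derivation.smul_apply, ha, smul_zero]

theorem A'_inv (hU : Upper R (N : Set M)) {f : MvPolynomial ↥N ℂ} (hf : f ∈ S.A' N) {x : L}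
    (hx : x ∈ S.u) (c : ↥N → ℂ) : eval (S.act N x c) f = eval c f :=
  S.inv_of_D hU hx (S.A'_D hf hx) c

theorem A'_of_inv (hU : Upper R (N : Set M)) {f : MvPolynomial ↥N ℂ}
    (h : ∀ α ∈ R.Φ, 0 < R.ht α → ∀ (s : ℂ) c, eval (S.act N (s • S.e α) c) f = eval c f) :
    f ∈ S.A' N := fun α ha hp =>
  S.D_of_inv hU (S.e_mem_u ha hp) fun c s => h α ha hp s c

theorem A'_factor (hU : Upper R (N : Set M)) {f g : MvPolynomial ↥N ℂ}
    (h : f * g ∈ S.A' N) (h0 : f * g ≠ 0) : f ∈ S.A' N := fun α ha hp =>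
  S.D_factor hU (S.e_mem_u ha hp) (h α ha hp) h0

end Setup
end CPF

namespace CPF
namespace Setup
open MvPolynomial
variable {L : Type*} [LieRing L] [LieAlgebra ℂ L] {M : Type*} [AddCommGroup M] {R : RS M}
  (S : Setup L R) {N : Finset M}

theorem kill_br_zero {a b d : M} (ha : a ∈ R.Φ) (hb : b ∈ R.Φ) (hd : d ∈ R.Φ) (h : a + b + d ≠ 0) :
    killingForm ℂ L (S.e a) ⁅S.e b, S.e d⁆ = 0 := by
  by_cases h1 : b + d = 0
  · obtain rfl : d = -b := by rw [add_comm] at h1; exact eq_neg_of_add_eq_zero_left h1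
    rw [S.br_t b hb, LieModule.traceForm_comm, S.kill_t _ _ ha]
  by_cases h2 : b + d ∈ R.Φ
  · obtain ⟨c, _, hc⟩ := S.br_ne b hb d hd h2
    rw [hc, map_smul, S.kill _ ha _ h2, if_neg (by rw [← add_assoc]; exact h), smul_zero]
  · rw [S.br_zero b hb d hd h1 h2, map_zero]

theorem kill_br_ne {a b d : M} (ha : a ∈ R.Φ) (hb : b ∈ R.Φ) (hd : d ∈ R.Φ) (h : a + b + d = 0) :
    killingForm ℂ L (S.e a) ⁅S.e b, S.e d⁆ ≠ 0 := by
  have h2 : b + d ∈ R.Φ := by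
    have : b + d = -a := by rw [add_assoc] at h; rw [add_comm] at h; exact eq_neg_of_add_eq_zero_left h
    rw [this]; exact R.neg_mem _ ha
  obtain ⟨c, hc0, hc⟩ := S.br_ne b hb d hd h2
  rw [hc, map_smul, S.kill _ ha _ h2, if_pos (by rw [← add_assoc]; exact h)]
  simpa using hc0

theorem der_sum {ι A : Type*} [CommRing A] [Algebra ℂ A] (s : Finset ι) (d : ι → Derivation ℂ A A)
    (f : A) : (∑ i ∈ s, d i) f = ∑ i ∈ s, d i f := by
  induction s using Finset.induction_on with
  | empty => simp
  | insert a s ha ih => rw [Finset.sum_insert ha, Finset.sum_insert ha, Derivation.add_apply, ih]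

theorem D_eq (x : L) : S.D N x = ∑ γ : ↥N, S.lin N γ (LieAlgebra.ad ℂ L x) • pderiv γ := by
  apply derivation_ext
  intro η
  rw [D_X, der_sum, Finset.sum_eq_single η]
  · simp
  · intro γ _ h; simp [pderiv_X_of_ne (Ne.symm h)]
  · simp

theorem D_apply (x : L) (f : MvPolynomial ↥N ℂ) :
    S.D N x f = ∑ γ : ↥N, S.lin N γ (LieAlgebra.ad ℂ L x) * pderiv γ f := by
  rw [D_eq, der_sum]; rfl

theorem pderiv_lin (γ η : ↥N) (A : Module.End ℂ L) :
    pderiv γ (S.lin N η A) = C (killingForm ℂ L (S.e η) (A (S.e (-γ.1)))) := by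
  rw [lin, map_sum, Finset.sum_eq_single γ]
  · simp
  · intro ζ _ h; simp [pderiv_X_of_ne h]
  · simp

theorem D_pderiv (x : L) (γ : ↥N) (f : MvPolynomial ↥N ℂ) :
    S.D N x (pderiv γ f) = pderiv γ (S.D N x f) -
      ∑ η : ↥N, C (killingForm ℂ L (S.e η) ⁅x, S.e (-γ.1)⁆) * pderiv η f := by
  have : ⁅S.D N x, (pderiv γ : Derivation ℂ (MvPolynomial ↥N ℂ) (MvPolynomial ↥N ℂ))⁆ = - ∑ η : ↥N,
      (C (killingForm ℂ L (S.e η) ⁅x, S.e (-γ.1)⁆) : MvPolynomial ↥N ℂ) •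
        (pderiv η : Derivation ℂ (MvPolynomial ↥N ℂ) (MvPolynomial ↥N ℂ)) := by
    apply derivation_ext
    intro ζ
    rw [Derivation.commutator_apply, Derivation.neg_apply, der_sum, D_X, pderiv_lin,
      Finset.sum_eq_single ζ]
    · rw [pderiv_X, Pi.single_apply]
      split_ifs with h <;> simp
    · intro η _ h; simp [pderiv_X_of_ne (Ne.symm h)]
    · simp
  have h := DFunLike.congr_fun this f
  rw [Derivation.commutator_apply, Derivation.neg_apply, der_sum] at h
  rw [sub_eq_iff_eq_add] at h
  rw [h, add_comm, ← sub_eq_add_neg]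
  rfl

variable (G : Greedy R (N : Set M))

/-- the roots `β_i` as elements of `N` -/
def bb (i : Fin G.k) : ↥N := ⟨G.β i, G.mem i i.2⟩

theorem bb_inj (hU : Upper R (N : Set M)) : Function.Injective (bb G) := by
  intro i j h
  by_contra hne
  have h1 : G.β i = G.β j := congrArg Subtype.val h
  have h2 := G.P_ne hU i.2 j.2 (fun h => hne (Fin.ext h))
  rw [← h1, G.P_self hU i.2] at h2
  omega

/-- restriction to the span of the `e_{-β_i}` -/
def rho : MvPolynomial ↥N ℂ →ₐ[ℂ] MvPolynomial (Fin G.k) ℂ :=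
  aeval fun γ => ∑ i : Fin G.k, if bb G i = γ then X i else 0

/-- the points of the span of the `e_{-β_i}` -/
def ept (t : Fin G.k → ℂ) : ↥N → ℂ := fun γ => ∑ i : Fin G.k, if bb G i = γ then t i else 0

theorem rho_X (γ : ↥N) : rho G (X γ) = ∑ i : Fin G.k, if bb G i = γ then X i else 0 := by
  rw [rho, aeval_X]

theorem rho_X_bb (hU : Upper R (N : Set M)) (i : Fin G.k) : rho G (X (bb G i)) = X i := by
  rw [rho_X, Finset.sum_eq_single i]
  · simp
  · intro j _ h; rw [if_neg (fun h' => h (bb_inj G hU h'))]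
  · simp

theorem rho_X_not {γ : ↥N} (h : ∀ i, bb G i ≠ γ) : rho G (X γ) = 0 := by
  rw [rho_X, Finset.sum_eq_zero]
  intro i _; rw [if_neg (h i)]

theorem eval_rho (t : Fin G.k → ℂ) (f : MvPolynomial ↥N ℂ) :
    eval t (rho G f) = eval (ept G t) f := by
  have : (eval t).comp (rho G).toRingHom = eval (ept G t) := by
    apply MvPolynomial.ringHom_ext
    · intro a
      change eval t (rho G (C a)) = _
      rw [rho, aeval_C, algebraMap_eq, eval_C, eval_C]
    · intro γ
      change eval t (rho G (X γ)) = _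
      rw [rho_X, eval_X, ept, map_sum]
      refine Finset.sum_congr rfl fun i _ => ?_
      split_ifs <;> simp
  exact DFunLike.congr_fun this f

theorem pderiv_rho (hU : Upper R (N : Set M)) (i : Fin G.k) (f : MvPolynomial ↥N ℂ) :
    pderiv i (rho G f) = rho G (pderiv (bb G i) f) := by
  induction f using MvPolynomial.induction_on with
  | C a => rw [pderiv_C, map_zero, rho, aeval_C, algebraMap_eq, pderiv_C]
  | add f g hf hg => simp only [map_add, hf, hg]
  | mul_X f γ hf =>
    rw [map_mul, pderiv_mul, pderiv_mul, map_add, map_mul, map_mul, hf]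
    congr 2
    by_cases h : ∃ j, bb G j = γ
    · obtain ⟨j, rfl⟩ := h
      rw [rho_X_bb G hU]
      by_cases hij : j = i
      · rw [hij, pderiv_X_self, pderiv_X_self, map_one]
      · rw [pderiv_X_of_ne hij, pderiv_X_of_ne (fun h => hij (bb_inj G hU h)), map_zero]
    · push Not at h
      rw [rho_X_not G h, map_zero, pderiv_X_of_ne (fun h' => h i h'.symm), map_zero]

theorem constCoeff_rho (f : MvPolynomial ↥N ℂ) : coeff 0 f = eval 0 (rho G f) := by
  rw [eval_rho]
  have : ept G 0 = 0 := by funext γ; simp [ept]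
  rw [this, ← constantCoeff_eq, eval_zero]

/-- the key computation on the cascade subspace -/
theorem delta_bracket (hU : Upper R (N : Set M)) {m : ℕ} (hm : m < G.k) {γ : ↥N}
    (h0 : ∀ l < m, G.P l γ = 0) (h1 : G.P m γ = 1) (hd : G.β m - γ ∈ R.Φ)
    (hdp : 0 < R.ht (G.β m - γ)) {l : ℕ} (hl : l < G.k) (hlm : l ≠ m)
    {η : M} (hη : η ∈ N) : η + (G.β m - γ) + -G.β l ≠ 0 := by
  intro h
  have hP : ∀ r, G.P r η = G.P r (G.β l) - (G.P r (G.β m) - G.P r γ) := by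
    intro r
    have := congrArg (G.P r) h
    rw [map_add, map_add, map_neg, map_zero, map_sub] at this
    omega
  have hηe : η = G.β l - (G.β m - γ) := by
    rw [eq_sub_iff_add_eq]; rw [← sub_eq_add_neg, sub_eq_zero] at h; exact h
  rcases lt_or_gt_of_ne hlm with hlt | hgt
  · -- reflect in `β_l`
    have hs := R.refl_mem _ (hU.sub hη) _ (G.mem_Φ hU hl)
    have e1 : R.p (G.β l) η = 2 := by
      have := hP l
      rw [G.P_self hU hl, G.P_ne hU hl hm hlm, h0 l hlt] at this
      simpa [Greedy.P] using this
    rw [e1, hηe] at hs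
    have hs2 := R.neg_mem _ hs
    have e2 : -(G.β l - (G.β m - ↑γ) - (2 : ℤ) • G.β l) = G.β l + (G.β m - γ) := by
      rw [two_smul]; abel
    rw [e2] at hs2
    have hN := hU.closed _ (G.mem l hl) _ hd hdp hs2
    have := G.max l hl _ hN (by
      intro r hr
      have h2 := G.P_ne hU (hr.trans hl) hl hr.ne
      have h3 := G.P_ne hU (hr.trans hl) hm (by omega)
      have h4 := h0 r (by omega)
      simp only [Greedy.P] at h2 h3 h4
      rw [map_add, map_sub, h2, h3, h4]; rfl)
    rw [map_add] at this
    omega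
  · obtain ⟨r, hr, hr0, hrp, _⟩ := G.G1 hU hη
    rcases lt_trichotomy r m with h' | h' | h'
    · rw [hP, G.P_ne hU hr hl (by omega), G.P_ne hU hr hm (by omega), h0 r h'] at hrp
      omega
    · subst h'
      rw [hP, G.P_ne hU hr hl (by omega), G.P_self hU hr, h1] at hrp
      omega
    · have := hr0 m h'
      rw [hP, G.P_ne hU hm hl (by omega), G.P_self hU hm, h1] at this
      omega

theorem pt_ept (hU : Upper R (N : Set M)) (t : Fin G.k → ℂ) :
    S.pt N (ept G t) = ∑ i : Fin G.k, t i • S.e (-G.β i) := by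
  rw [pt_apply]
  simp only [ept, Finset.sum_smul]
  rw [Finset.sum_comm]
  refine Finset.sum_congr rfl fun i _ => ?_
  rw [Finset.sum_eq_single (bb G i)]
  · simp [bb]
  · intro γ _ h; rw [if_neg (Ne.symm h), zero_smul]
  · simp

theorem pderiv_vanish (hU : Upper R (N : Set M)) {f : MvPolynomial ↥N ℂ} (hf : rho G f = 0)
    (hD : ∀ α ∈ R.Φ, 0 < R.ht α → rho G (S.D N (S.e α) f) = 0) (γ : ↥N) :
    rho G (pderiv γ f) = 0 := by
  by_cases h : ∃ i, bb G i = γ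
  · obtain ⟨i, rfl⟩ := h
    rw [← pderiv_rho G hU, hf, map_zero]
  push Not at h
  obtain ⟨m, hm, h0, _, h2⟩ := G.G1 hU γ.2
  rcases h2 with h2 | ⟨h1, hd, hdp⟩
  · exact absurd (Subtype.ext h2.symm) (h ⟨m, hm⟩)
  have hz := hD _ hd hdp
  rw [D_apply, map_sum, Finset.sum_eq_single γ] at hz
  · rw [map_mul] at hz
    rcases mul_eq_zero.1 hz with h3 | h3
    swap
    · exact h3
    exfalso
    have h4 := congrArg (eval fun _ => (1 : ℂ)) h3
    rw [eval_rho, eval_lin, S.pt_ept G hU, map_sum, map_sum, map_zero,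
      Finset.sum_eq_single ⟨m, hm⟩] at h4
    · rw [one_smul] at h4
      exact S.kill_br_ne (hU.sub γ.2) hd (R.neg_mem _ (G.mem_Φ hU hm)) (by abel) h4
    · intro l _ hl
      rw [one_smul]
      exact S.kill_br_zero (hU.sub γ.2) hd (R.neg_mem _ (G.mem_Φ hU l.2))
        (delta_bracket G hU hm h0 h1 hd hdp l.2 (fun h => hl (Fin.ext h)) γ.2)
    · simp
  · intro η _ hη
    rw [map_mul]
    have : rho G (S.lin N η ((LieAlgebra.ad ℂ L) (S.e (G.β m - γ)))) = 0 := by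
      apply MvPolynomial.funext
      intro t
      rw [eval_rho, eval_lin, S.pt_ept G hU, map_sum, map_sum, map_zero]
      refine Finset.sum_eq_zero fun l _ => ?_
      rw [map_smul, map_smul]
      by_cases hl : l.1 = m
      · rw [LieAlgebra.ad_apply, S.kill_br_zero (hU.sub η.2) hd (R.neg_mem _ (G.mem_Φ hU l.2)), smul_zero]
        intro h'
        apply hη
        rw [hl] at h'
        apply Subtype.ext
        have : (η : M) - γ = 0 := by rw [← h']; abel
        exact sub_eq_zero.1 this
      · rw [LieAlgebra.ad_apply, S.kill_br_zero (hU.sub η.2) hd (R.neg_mem _ (G.mem_Φ hU l.2))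
          (delta_bracket G hU hm h0 h1 hd hdp l.2 hl η.2), smul_zero]
    rw [this, zero_mul]
  · simp

theorem coeff_vanish (hU : Upper R (N : Set M)) (n : ℕ) : ∀ (m : ↥N →₀ ℕ), m.degree = n →
    ∀ K : Submodule ℂ (MvPolynomial ↥N ℂ),
    (∀ f ∈ K, ∀ α ∈ R.Φ, 0 < R.ht α → S.D N (S.e α) f ∈ K) → (∀ f ∈ K, rho G f = 0) →
    ∀ f ∈ K, coeff m f = 0 := by
  induction n with
  | zero =>
    intro m hm K _ hv f hf
    rw [Finsupp.degree_eq_zero_iff] at hm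
    rw [hm, constCoeff_rho G, hv f hf, map_zero]
  | succ n ih =>
    intro m hm K hs hv f hf
    obtain ⟨γ, hγ⟩ : ∃ γ, m γ ≠ 0 := by
      by_contra h
      push Not at h
      have : m = 0 := Finsupp.ext h
      rw [this] at hm; simp at hm
    obtain ⟨m', rfl⟩ : ∃ m', m = m' + Finsupp.single γ 1 := by
      have : Finsupp.single γ 1 ≤ m := by
        rw [Finsupp.single_le_iff]; omega
      obtain ⟨m', rfl⟩ := exists_add_of_le this
      exact ⟨m', add_comm _ _⟩
    let K' : Submodule ℂ (MvPolynomial ↥N ℂ) :=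
      Submodule.span ℂ ({g | ∃ γ : ↥N, ∃ f ∈ K, g = pderiv γ f})
    have h1 : coeff m' (pderiv γ f) = 0 := by
      refine ih m' (by rw [map_add] at hm; simpa using hm) K' ?_ ?_ _
        (Submodule.subset_span ⟨γ, f, hf, rfl⟩)
      · intro g hg α ha hp
        induction hg using Submodule.span_induction with
        | mem x h =>
          obtain ⟨γ, f, hf, rfl⟩ := h
          rw [D_pderiv]
          refine Submodule.sub_mem _ (Submodule.subset_span ⟨γ, _, hs f hf α ha hp, rfl⟩)
            (Submodule.sum_mem _ fun η _ => ?_)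
          rw [← smul_eq_C_mul]
          exact Submodule.smul_mem _ _ (Submodule.subset_span ⟨η, f, hf, rfl⟩)
        | zero => rw [map_zero]; exact Submodule.zero_mem _
        | add a b _ _ ha hb => rw [map_add]; exact Submodule.add_mem _ ha hb
        | smul c a _ ha => rw [Derivation.map_smul]; exact Submodule.smul_mem _ _ ha
      · intro g hg
        induction hg using Submodule.span_induction with
        | mem x h =>
          obtain ⟨γ, f, hf, rfl⟩ := h
          exact S.pderiv_vanish G hU (hv f hf) (fun α ha hp => hv _ (hs f hf α ha hp)) γ
        | zero => rw [map_zero]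
        | add a b _ _ ha hb => rw [map_add, ha, hb, add_zero]
        | smul c a _ ha => rw [map_smul, ha, smul_zero]
    rw [coeff_pderiv] at h1
    rcases mul_eq_zero.1 h1 with h | h
    · exact h
    · exact absurd h (by exact_mod_cast Nat.succ_ne_zero (m' γ))

theorem eq_zero_of_vanish (hU : Upper R (N : Set M)) (K : Submodule ℂ (MvPolynomial ↥N ℂ))
    (hs : ∀ f ∈ K, ∀ α ∈ R.Φ, 0 < R.ht α → S.D N (S.e α) f ∈ K) (hv : ∀ f ∈ K, rho G f = 0)
    {f : MvPolynomial ↥N ℂ} (hf : f ∈ K) : f = 0 := by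
  ext m
  rw [S.coeff_vanish G hU _ m rfl K hs hv f hf, coeff_zero]

theorem rho_inj (hU : Upper R (N : Set M)) {f : MvPolynomial ↥N ℂ} (hf : f ∈ S.A' N)
    (h : rho G f = 0) : f = 0 := by
  refine S.eq_zero_of_vanish G hU (Submodule.span ℂ {f}) ?_ ?_ (Submodule.mem_span_singleton_self f)
  · intro g hg α ha hp
    obtain ⟨c, rfl⟩ := Submodule.mem_span_singleton.1 hg
    rw [Derivation.map_smul, hf α ha hp, smul_zero]; exact Submodule.zero_mem _
  · intro g hg
    obtain ⟨c, rfl⟩ := Submodule.mem_span_singleton.1 hg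
    rw [map_smul, h, smul_zero]

/-- the `U`-saturation of the cascade subspace -/
inductive Orb : (↥N → ℂ) → Prop
  | base (t : Fin G.k → ℂ) : Orb (ept G t)
  | step (c : ↥N → ℂ) (s : ℂ) (α : M) (h : Orb c) (ha : α ∈ R.Φ) (hp : 0 < R.ht α) :
      Orb (S.act N (s • S.e α) c)

theorem exists_orb (hU : Upper R (N : Set M)) {f : MvPolynomial ↥N ℂ} (hf : f ≠ 0) :
    ∃ c, S.Orb G c ∧ eval c f ≠ 0 := by
  by_contra hcon
  push Not at hcon
  apply hf
  let K : Submodule ℂ (MvPolynomial ↥N ℂ) :=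
    { carrier := {g | ∀ c, S.Orb G c → eval c g = 0}
      add_mem' := by
        intro a b ha hb c hc
        rw [map_add, ha c hc, hb c hc, add_zero]
      zero_mem' := fun c _ => map_zero _
      smul_mem' := by
        intro r a ha c hc
        rw [smul_eval, ha c hc, mul_zero] }
  refine S.eq_zero_of_vanish G hU K ?_ ?_ (f := f) hcon
  · intro g hg α ha hp c hc
    exact S.D_eval_zero hU (S.e_mem_u ha hp) c 0 fun s => hg _ (Orb.step c s α hc ha hp)
  · intro g hg
    apply MvPolynomial.funext
    intro t
    rw [eval_rho, map_zero]
    exact hg _ (Orb.base t)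

end Setup
end CPF

namespace CPF

theorem isotropic_ker_le {V : Type*} [AddCommGroup V] [Module ℂ V] [FiniteDimensional ℂ V]
    (B : LinearMap.BilinForm ℂ V) (hB : B.IsAlt) (a : Submodule ℂ V)
    (ha : ∀ x ∈ a, ∀ y ∈ a, B x y = 0)
    (hd : 2 * finrank ℂ a = finrank ℂ V + finrank ℂ (LinearMap.ker B)) : LinearMap.ker B ≤ a := by
  have h1 := LinearMap.BilinForm.finrank_add_finrank_orthogonal' (B := B) a
  have h2 : a ⊔ LinearMap.ker B ≤ B.orthogonal a := by
    refine sup_le ?_ ?_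
    · intro x hx y hy
      exact ha y hy x hx
    · intro x hx y hy
      change B y x = 0
      rw [← neg_eq_zero, hB.neg_eq, LinearMap.mem_ker.1 hx, LinearMap.zero_apply]
  have h3 := Submodule.finrank_mono h2
  have h4 := Submodule.finrank_sup_add_finrank_inf_eq a (LinearMap.ker B)
  have h5 : finrank ℂ (a ⊓ LinearMap.ker B : Submodule ℂ V) ≤ finrank ℂ (LinearMap.ker B) :=
    Submodule.finrank_mono inf_le_right
  have h6 : (a ⊓ LinearMap.ker B : Submodule ℂ V) = LinearMap.ker B :=
    Submodule.eq_of_le_of_finrank_eq inf_le_right (by omega)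
  exact inf_eq_right.1 h6

theorem mem_of_poly {V : Type*} [AddCommGroup V] [Module ℂ V] (W : Submodule ℂ V) (n : ℕ)
    (v : ℕ → V) (h : ∀ s : ℂ, ∑ i ∈ Finset.range n, s ^ i • v i ∈ W) (i : ℕ) (hi : i < n) :
    v i ∈ W := by
  by_contra hv
  obtain ⟨f, hf, hW⟩ := Submodule.exists_le_ker_of_notMem hv
  have : (∑ i ∈ Finset.range n, Polynomial.monomial i (f (v i)) : Polynomial ℂ) = 0 := by
    apply Polynomial.funext
    intro s
    rw [Polynomial.eval_finsetSum, Polynomial.eval_zero]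
    have h1 := LinearMap.mem_ker.1 (hW (h s))
    rw [map_sum] at h1
    rw [← h1]
    refine Finset.sum_congr rfl fun i _ => ?_
    rw [Polynomial.eval_monomial, map_smul, smul_eq_mul, mul_comm]
  have h2 := congrArg (fun p => Polynomial.coeff p i) this
  simp only [Polynomial.finsetSum_coeff, Polynomial.coeff_monomial, Polynomial.coeff_zero] at h2
  rw [Finset.sum_ite_eq' (Finset.range n) i, if_pos (Finset.mem_range.2 hi)] at h2
  exact hf h2

/-- the exponential of a nilpotent inner derivation as an automorphism -/
theorem exists_exp {L : Type*} [LieRing L] [LieAlgebra ℂ L] (x : L)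
    (h : (LieAlgebra.ad ℂ L x) ^ (Module.finrank ℂ L + 1) = 0) :
    ∃ E : L ≃ₗ⁅ℂ⁆ L, ∀ y, E y = nilExp (LieAlgebra.ad ℂ L x) y := by
  let _ : Module ℚ L := Module.compHom L (algebraMap ℚ ℂ)
  let _ : LieAlgebra ℚ L :=
    { lie_smul := fun t x y => lie_smul (algebraMap ℚ ℂ t) x y }
  have h0 : ((LieDerivation.ad ℂ L x).toLinearMap) = LieAlgebra.ad ℂ L x := by
    ext y; simp
  have h1 : ((LieDerivation.ad ℂ L x).toLinearMap) ^ (Module.finrank ℂ L + 1) = 0 := by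
    rw [h0]; exact h
  have h2 : IsNilpotent ((LieDerivation.ad ℂ L x).toLinearMap) := ⟨_, h1⟩
  refine ⟨LieDerivation.exp (LieDerivation.ad ℂ L x) h2, fun y => ?_⟩
  rw [LieDerivation.exp_map_apply]
  rw [IsNilpotent.exp_eq_sum h1, h0, nilExp, LinearMap.sum_apply, LinearMap.sum_apply]
  refine Finset.sum_congr rfl fun i _ => ?_
  change algebraMap ℚ ℂ ((i.factorial : ℚ)⁻¹) • ((LieAlgebra.ad ℂ L x) ^ i) y = _
  simp

namespace Setup
open MvPolynomial
variable {L : Type*} [LieRing L] [LieAlgebra ℂ L] {M : Type*} [AddCommGroup M] {R : RS M}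
  (S : Setup L R) {N : Finset M}

/-- the automorphism `exp(ad x)` for `x` in `u` -/
def E {x : L} (hx : x ∈ S.u) : L ≃ₗ⁅ℂ⁆ L := (exists_exp x (S.nilp x hx)).choose

theorem E_apply {x : L} (hx : x ∈ S.u) (y : L) : S.E hx y = nilExp (LieAlgebra.ad ℂ L x) y :=
  (exists_exp x (S.nilp x hx)).choose_spec y

theorem nilExp_mem {V : Type*} [AddCommGroup V] [Module ℂ V] (W : Submodule ℂ V) (f : End ℂ V)
    (h : ∀ z ∈ W, f z ∈ W) {z : V} (hz : z ∈ W) : nilExp f z ∈ W := by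
  rw [nilExp, LinearMap.sum_apply]
  refine Submodule.sum_mem _ fun i _ => ?_
  rw [LinearMap.smul_apply]
  refine Submodule.smul_mem _ _ ?_
  clear * - h hz
  induction i with
  | zero => exact hz
  | succ i ih => rw [pow_succ']; exact h _ ih

theorem E_mem_n (hU : Upper R (N : Set M)) {x : L} (hx : x ∈ S.u) {z : L} (hz : z ∈ S.n N) :
    S.E hx z ∈ S.n N := by
  rw [E_apply]
  exact nilExp_mem _ _ (fun z hz => S.ad_u_n hU hx hz) hz

/-- the alternating form attached to a point -/
def Bf (c : ↥N → ℂ) : LinearMap.BilinForm ℂ ↥(S.n N) :=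
  LinearMap.mk₂ ℂ (fun x y => killingForm ℂ L (S.pt N c) ⁅(x : L), (y : L)⁆)
    (by intros; simp) (by intros; simp) (by intros; simp) (by intros; simp)

theorem Bf_apply (c : ↥N → ℂ) (x y : ↥(S.n N)) :
    S.Bf c x y = killingForm ℂ L (S.pt N c) ⁅(x : L), (y : L)⁆ := rfl

theorem Bf_alt (c : ↥N → ℂ) : (S.Bf c).IsAlt := by
  intro x
  rw [Bf_apply, lie_self, map_zero]

/-- the coadjoint stabiliser -/
def stab (c : ↥N → ℂ) : Submodule ℂ ↥(S.n N) := LinearMap.ker (S.Bf c)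

theorem mem_stab {c : ↥N → ℂ} {x : ↥(S.n N)} :
    x ∈ S.stab c ↔ ∀ y : ↥(S.n N), killingForm ℂ L (S.pt N c) ⁅(x : L), (y : L)⁆ = 0 := by
  rw [stab, LinearMap.mem_ker]
  constructor
  · intro h y; rw [← Bf_apply, h, LinearMap.zero_apply]
  · intro h; ext y; exact h y

theorem n_lie (hU : Upper R (N : Set M)) {x y : L} (hx : x ∈ S.n N) (hy : y ∈ S.n N) :
    ⁅x, y⁆ ∈ S.n N := by
  refine S.ad_u_n hU ?_ hy
  refine Submodule.span_mono ?_ hx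
  rintro _ ⟨γ, hγ, rfl⟩
  exact ⟨γ, ⟨hU.sub hγ, hU.pos γ hγ⟩, rfl⟩

theorem kill_pt_act (hU : Upper R (N : Set M)) {x : L} (hx : x ∈ S.u) (c : ↥N → ℂ) {z : L}
    (hz : z ∈ S.n N) :
    killingForm ℂ L (S.pt N (S.act N x c)) (S.E hx z) = killingForm ℂ L (S.pt N c) z := by
  rw [LieModule.traceForm_comm]
  have := S.kill_n hU (S.E_mem_n hU hx hz) (S.E hx (S.pt N c))
  have e1 : (fun γ : ↥N => killingForm ℂ L (S.e γ) (S.E hx (S.pt N c))) = S.act N x c := by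
    funext γ; rw [act, E_apply]
  rw [e1] at this
  change killingForm ℂ L _ _ = _
  rw [← this, killingForm_of_equiv_apply, LieModule.traceForm_comm]

variable [FiniteDimensional ℂ L]

/-- the automorphism restricted to `n` -/
def En (hU : Upper R (N : Set M)) {x : L} (hx : x ∈ S.u) : ↥(S.n N) ≃ₗ[ℂ] ↥(S.n N) :=
  LinearEquiv.ofInjectiveEndo
    ((S.E hx : L →ₗ[ℂ] L).restrict fun z hz => S.E_mem_n hU hx hz) (by
      intro a b h
      apply Subtype.ext
      exact (S.E hx).injective (congrArg Subtype.val h))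

theorem En_coe (hU : Upper R (N : Set M)) {x : L} (hx : x ∈ S.u) (z : ↥(S.n N)) :
    ((S.En hU hx z : ↥(S.n N)) : L) = S.E hx z := rfl

theorem stab_act (hU : Upper R (N : Set M)) {x : L} (hx : x ∈ S.u) (c : ↥N → ℂ) :
    S.stab (S.act N x c) = (S.stab c).map (S.En hU hx : ↥(S.n N) →ₗ[ℂ] ↥(S.n N)) := by
  have key : ∀ a : ↥(S.n N), S.En hU hx a ∈ S.stab (S.act N x c) ↔ a ∈ S.stab c := by
    intro a
    rw [mem_stab, mem_stab]
    constructor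
    · intro h y
      have := h (S.En hU hx y)
      rw [En_coe, En_coe, ← LieEquiv.map_lie, S.kill_pt_act hU hx c (S.n_lie hU a.2 y.2)] at this
      exact this
    · intro h y
      obtain ⟨y, rfl⟩ := (S.En hU hx).surjective y
      rw [En_coe, En_coe, ← LieEquiv.map_lie, S.kill_pt_act hU hx c (S.n_lie hU a.2 y.2)]
      exact h y
  ext a
  obtain ⟨a, rfl⟩ := (S.En hU hx).surjective a
  rw [key]
  constructor
  · intro h; exact ⟨a, h, rfl⟩
  · rintro ⟨b, hb, he⟩
    rwa [← (S.En hU hx).injective he]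

theorem finrank_stab_act (hU : Upper R (N : Set M)) {x : L} (hx : x ∈ S.u) (c : ↥N → ℂ) :
    finrank ℂ (S.stab (S.act N x c)) = finrank ℂ (S.stab c) := by
  rw [S.stab_act hU hx]
  exact LinearEquiv.finrank_map_eq (S.En hU hx) _

theorem exists_poly (c0 : ↥N → ℂ) : ∃ f : MvPolynomial ↥N ℂ, f ≠ 0 ∧
    ∀ c, eval c f ≠ 0 → finrank ℂ (S.stab c) ≤ finrank ℂ (S.stab c0) := by
  obtain ⟨C, hC⟩ := Submodule.exists_isCompl (S.stab c0)
  let b := Module.finBasis ℂ C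
  let A : Matrix (Fin (finrank ℂ C)) (Fin (finrank ℂ C)) (MvPolynomial ↥N ℂ) :=
    fun i j => ∑ η : ↥N, MvPolynomial.C
      (killingForm ℂ L (S.e (-η.1)) ⁅((b i : ↥(S.n N)) : L), ((b j : ↥(S.n N)) : L)⁆) * X η
  have hev : ∀ c, eval c A.det = (LinearMap.BilinForm.toMatrix b ((S.Bf c).restrict C)).det := by
    intro c
    rw [RingHom.map_det]
    congr 1
    ext i j
    rw [LinearMap.BilinForm.toMatrix_apply]
    change eval c (A i j) = S.Bf c (b i) (b j)
    rw [Bf_apply, pt_apply, map_sum, map_sum, LinearMap.sum_apply]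
    refine Finset.sum_congr rfl fun η _ => ?_
    rw [map_mul, eval_C, eval_X, map_smul, LinearMap.smul_apply, smul_eq_mul, mul_comm]
  refine ⟨A.det, ?_, ?_⟩
  · intro h
    have h1 := hev c0
    rw [h, map_zero] at h1
    refine (LinearMap.BilinForm.nondegenerate_iff_det_ne_zero b).1 ?_ h1.symm
    rw [LinearMap.BilinForm.nondegenerate_iff_ker_eq_bot, LinearMap.ker_eq_bot']
    intro x hx
    have : (x : ↥(S.n N)) ∈ S.stab c0 := by
      rw [stab, LinearMap.mem_ker]
      ext y
      obtain ⟨y1, hy1, y2, hy2, rfl⟩ : ∃ y1 ∈ S.stab c0, ∃ y2 ∈ C, y1 + y2 = y :=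
        Submodule.mem_sup.1 (by rw [hC.sup_eq_top]; trivial)
      have e1 : S.Bf c0 x y1 = 0 := by
        rw [← neg_eq_zero, (S.Bf_alt c0).neg_eq, LinearMap.mem_ker.1 hy1, LinearMap.zero_apply]
      have e2 : S.Bf c0 x y2 = 0 := DFunLike.congr_fun hx ⟨y2, hy2⟩
      rw [map_add, e1, e2]; simp
    exact Subtype.ext (by
      have := hC.inf_eq_bot.le ⟨this, x.2⟩
      simpa using this)
  · intro c hc
    rw [hev c, ← LinearMap.BilinForm.nondegenerate_iff_det_ne_zero,
      LinearMap.BilinForm.nondegenerate_iff_ker_eq_bot, LinearMap.ker_eq_bot'] at hc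
    have h1 : S.stab c ⊓ C = ⊥ := by
      rw [eq_bot_iff]
      rintro x ⟨hx1, hx2⟩
      have := hc ⟨x, hx2⟩ (by
        ext y
        have h5 : S.Bf c x = 0 := hx1
        change S.Bf c x y = 0
        rw [h5]; rfl)
      simpa using congrArg Subtype.val this
    have h2 := Submodule.finrank_sup_add_finrank_inf_eq (S.stab c) C
    have h3 := Submodule.finrank_add_eq_of_isCompl hC
    have h4 := Submodule.finrank_le (S.stab c ⊔ C)
    rw [h1, finrank_bot] at h2
    omega

variable (G : Greedy R (N : Set M))

theorem e_beta_stab (hU : Upper R (N : Set M)) (t : Fin G.k → ℂ) {i : ℕ} (hi : i < G.k) :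
    (⟨S.e (G.β i), S.e_mem_n N (G.mem i hi)⟩ : ↥(S.n N)) ∈ S.stab (ept G t) := by
  rw [mem_stab]
  rintro ⟨y, hy⟩
  change killingForm ℂ L _ ⁅S.e (G.β i), y⁆ = 0
  rw [S.pt_ept G hU, map_sum, LinearMap.sum_apply]
  refine Finset.sum_eq_zero fun l _ => ?_
  rw [map_smul, LinearMap.smul_apply]
  have : killingForm ℂ L (S.e (-G.β l)) ⁅S.e (G.β i), y⁆ = 0 := by
    induction hy using Submodule.span_induction with
    | mem x h =>
      obtain ⟨γ, hγ, rfl⟩ := h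
      apply S.kill_br_zero (R.neg_mem _ (G.mem_Φ hU l.2)) (G.mem_Φ hU hi) (hU.sub hγ)
      intro h
      have h1 : γ = G.β l - G.β i := by
        rw [← sub_eq_zero, ← h]; abel
      have h2 := hU.sub hγ
      rw [h1] at h2
      by_cases hli : (l : ℕ) = i
      · rw [hli, sub_self] at h2; exact R.zero_notMem h2
      · exact G.strong_sub hU l.2 hi hli h2
    | zero => simp
    | add a b _ _ ha hb => rw [lie_add, map_add, ha, hb, add_zero]
    | smul c a _ ha => rw [lie_smul, map_smul, ha, smul_zero]
  rw [this, smul_zero]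

/-- a commutative polarisation forces the root spaces of the semiradical to commute -/
theorem hab_of_CP (hU : Upper R (N : Set M)) (a : Submodule ℂ ↥(S.n N))
    (ha : ∀ x ∈ a, ∀ y ∈ a, ⁅(x : L), (y : L)⁆ = 0) (c0 : ↥N → ℂ)
    (hmin : ∀ c : ↥N → ℂ, finrank ℂ (S.stab c0) ≤ finrank ℂ (S.stab c))
    (hd : 2 * finrank ℂ a = finrank ℂ ↥(S.n N) + finrank ℂ (S.stab c0)) :
    ∀ γ η, G.Q γ → G.Q η → γ + η ∉ R.Φ := by
  set d0 := finrank ℂ (S.stab c0) with hd0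
  have hreg : ∃ t, finrank ℂ (S.stab (ept G t)) = d0 := by
    obtain ⟨f, hf0, hf⟩ := S.exists_poly c0
    obtain ⟨c, hc, hc0⟩ := S.exists_orb G hU hf0
    have h1 : finrank ℂ (S.stab c) = d0 := le_antisymm (hf c hc0) (hmin c)
    clear hc0
    induction hc with
    | base t => exact ⟨t, h1⟩
    | step c s α h ha hp ih =>
      apply ih
      rw [← h1, S.finrank_stab_act hU (Submodule.smul_mem _ _ (S.e_mem_u ha hp))]
  let V : Submodule ℂ ↥(S.n N) := ⨆ c : {c : ↥N → ℂ // finrank ℂ (S.stab c) = d0}, S.stab c.1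
  have hVa : V ≤ a := by
    refine iSup_le fun c => ?_
    refine isotropic_ker_le (S.Bf c.1) (S.Bf_alt c.1) a ?_ ?_
    · intro x hx y hy; rw [Bf_apply, ha x hx y hy, map_zero]
    · rw [hd]; congr 1; exact c.2.symm
  have hVE : ∀ {x : L} (hx : x ∈ S.u), V.map (S.En hU hx : ↥(S.n N) →ₗ[ℂ] ↥(S.n N)) ≤ V := by
    intro x hx
    rw [Submodule.map_iSup]
    refine iSup_le fun c => ?_
    rw [← S.stab_act hU hx]
    exact le_iSup (fun c : {c : ↥N → ℂ // finrank ℂ (S.stab c) = d0} => S.stab c.1)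
      ⟨_, (S.finrank_stab_act hU hx c.1).trans c.2⟩
  let W : Submodule ℂ L := V.map (S.n N).subtype
  have hWad : ∀ α ∈ R.Φ, 0 < R.ht α → ∀ z ∈ W, ⁅S.e α, z⁆ ∈ W := by
    rintro α hα hp _ ⟨z, hz, rfl⟩
    have key := mem_of_poly W (finrank ℂ L + 1)
      (fun i => ((i.factorial : ℂ)⁻¹) • (LieAlgebra.ad ℂ L (S.e α) ^ i) z) ?_ 1 ?_
    · simpa using key
    · intro s
      have hx := Submodule.smul_mem _ s (S.e_mem_u hα hp)
      have h1 : ((S.En hU hx z : ↥(S.n N)) : L) ∈ W :=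
        ⟨_, hVE hx ⟨z, hz, rfl⟩, rfl⟩
      rw [En_coe, E_apply, nilExp, LinearMap.sum_apply] at h1
      convert h1 using 1
      refine Finset.sum_congr rfl fun i _ => ?_
      rw [map_smul, smul_pow, LinearMap.smul_apply, LinearMap.smul_apply, smul_comm]
    · by_contra hlt
      have h0 : finrank ℂ L = 0 := by omega
      have : Subsingleton L := Module.finrank_zero_iff.1 h0
      exact S.B_ne α hα (by
        have h1 := S.t_br α α hα
        have h2 : S.e α = 0 := Subsingleton.elim _ _
        have h3 := S.kill α hα (-α) (R.neg_mem _ hα)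
        rw [h2] at h3
        simp at h3)
  have hQ : ∀ γ, G.Q γ → S.e γ ∈ W := by
    intro γ h
    induction h with
    | base i hi =>
      obtain ⟨t, ht⟩ := hreg
      exact ⟨_, le_iSup (fun c : {c : ↥N → ℂ // finrank ℂ (S.stab c) = d0} => S.stab c.1)
        ⟨_, ht⟩ (S.e_beta_stab G hU t hi), rfl⟩
    | step γ α h hα hp hs ih =>
      have h1 := hWad α hα hp _ ih
      have h2 : γ ∈ R.Φ := hU.sub (G.Q_N hU h)
      obtain ⟨c, hc0, hc⟩ := S.br_ne α hα γ h2 (by rw [add_comm]; exact hs)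
      rw [hc] at h1
      have h3 := Submodule.smul_mem _ c⁻¹ h1
      rwa [smul_smul, inv_mul_cancel₀ hc0, one_smul, add_comm] at h3
  intro γ η hγ hη hs
  obtain ⟨x, hx, hx'⟩ := hQ γ hγ
  obtain ⟨y, hy, hy'⟩ := hQ η hη
  have h1 := ha x (hVa hx) y (hVa hy)
  obtain ⟨c, hc0, hc⟩ := S.br_ne γ (hU.sub (G.Q_N hU hγ)) η (hU.sub (G.Q_N hU hη)) hs
  rw [← hx', ← hy'] at hc
  change ⁅(x : L), (y : L)⁆ = _ at hc
  rw [h1] at hc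
  have h3 := S.kill (γ + η) hs (-(γ + η)) (R.neg_mem _ hs)
  have h4 : S.e (γ + η) = 0 := by
    rcases smul_eq_zero.1 hc.symm with h | h
    · exact absurd h hc0
    · exact h
  rw [h4] at h3
  simp at h3

end Setup
end CPF

namespace CPF
namespace Setup
open MvPolynomial
variable {L : Type*} [LieRing L] [LieAlgebra ℂ L] {M : Type*} [AddCommGroup M] {R : RS M}
  (S : Setup L R) {N : Finset M}

/-- the span of the root vectors in `J` -/
def aJ (J : Finset ↥N) : Submodule ℂ L := Submodule.span ℂ (Set.range fun γ : ↥J => S.e γ.1.1)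

/-- the `J`-part of a point -/
def xi (J : Finset ↥N) (c : ↥N → ℂ) : L := ∑ η ∈ J, c η • S.e (-η.1)

/-- the determinant polynomial -/
def FJ (J : Finset ↥N) : MvPolynomial ↥N ℂ :=
  Matrix.det (Matrix.of fun γ γ' : ↥J => ∑ η ∈ J, ∑ η' ∈ J,
    C (killingForm ℂ L (S.e γ.1.1) ⁅S.e (-η.1), ⁅S.e (-η'.1), S.e γ'.1.1⁆⁆) * (X η * X η'))

theorem eval_FJ (J : Finset ↥N) (c : ↥N → ℂ) : eval c (S.FJ J) =
    Matrix.det (Matrix.of fun γ γ' : ↥J =>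
      killingForm ℂ L (S.e γ.1.1) ⁅S.xi J c, ⁅S.xi J c, S.e γ'.1.1⁆⁆) := by
  rw [FJ, RingHom.map_det]
  congr 1
  ext γ γ'
  simp only [RingHom.mapMatrix_apply, Matrix.map_apply, Matrix.of_apply, xi, sum_lie, lie_sum,
    map_sum, map_mul, eval_C, eval_X, smul_lie, lie_smul, map_smul, smul_eq_mul]
  rw [Finset.sum_comm]
  refine Finset.sum_congr rfl fun η _ => ?_
  rw [Finset.mul_sum]
  refine Finset.sum_congr rfl fun η' _ => ?_
  ring

theorem aJ_kill (hU : Upper R (N : Set M)) (J : Finset ↥N) (v : ↥J → ℂ) (γ : ↥J) :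
    killingForm ℂ L (∑ η : ↥J, v η • S.e η.1.1) (S.e (-γ.1.1)) = v γ := by
  rw [map_sum, LinearMap.sum_apply, Finset.sum_eq_single γ]
  · rw [map_smul, LinearMap.smul_apply, S.kill _ (hU.sub γ.1.2) _ (R.neg_mem _ (hU.sub γ.1.2))]
    simp
  · intro η _ h
    rw [map_smul, LinearMap.smul_apply, S.kill _ (hU.sub η.1.2) _ (R.neg_mem _ (hU.sub γ.1.2)),
      if_neg, smul_zero]
    intro h'
    exact h (Subtype.ext (Subtype.ext (by
      rw [← sub_eq_add_neg, sub_eq_zero] at h'; exact h')))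
  · simp

theorem FJ_ne_iff (hU : Upper R (N : Set M)) (J : Finset ↥N) (c : ↥N → ℂ) :
    eval c (S.FJ J) ≠ 0 ↔ ∀ y ∈ S.aJ J,
      (∀ z ∈ S.aJ J, killingForm ℂ L z ⁅S.xi J c, ⁅S.xi J c, y⁆⁆ = 0) → y = 0 := by
  rw [eval_FJ, ne_eq, ← Matrix.exists_mulVec_eq_zero_iff]
  have hmv : ∀ (v : ↥J → ℂ) (γ : ↥J), ((Matrix.of fun γ γ' : ↥J =>
      killingForm ℂ L (S.e γ.1.1) ⁅S.xi J c, ⁅S.xi J c, S.e γ'.1.1⁆⁆).mulVec v) γ =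
      killingForm ℂ L (S.e γ.1.1) ⁅S.xi J c, ⁅S.xi J c, ∑ η : ↥J, v η • S.e η.1.1⁆⁆ := by
    intro v γ
    simp only [Matrix.mulVec, dotProduct, Matrix.of_apply, lie_sum, map_sum, lie_smul, map_smul,
      smul_eq_mul]
    refine Finset.sum_congr rfl fun η _ => mul_comm _ _
  constructor
  · intro h y hy hz
    obtain ⟨v, rfl⟩ := (Submodule.mem_span_range_iff_exists_fun ℂ).1 hy
    by_contra hne
    refine h ⟨v, ?_, ?_⟩
    · rintro rfl; simp at hne
    · funext γ
      rw [hmv]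
      exact hz _ (Submodule.subset_span ⟨γ, rfl⟩)
  · rintro h ⟨v, hv, hm⟩
    apply hv
    have : ∑ η : ↥J, v η • S.e η.1.1 = 0 := by
      refine h _ ((Submodule.mem_span_range_iff_exists_fun ℂ).2 ⟨v, rfl⟩) ?_
      intro z hz
      induction hz using Submodule.span_induction with
      | mem x h => obtain ⟨γ, rfl⟩ := h; rw [← hmv, hm]; rfl
      | zero => simp
      | add a b _ _ ha hb => rw [map_add, LinearMap.add_apply, ha, hb, add_zero]
      | smul c a _ ha => rw [map_smul, LinearMap.smul_apply, ha, smul_zero]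
    funext γ
    rw [← S.aJ_kill hU J v γ, this]; simp

theorem aJ_le_n (J : Finset ↥N) : S.aJ J ≤ S.n N := by
  refine Submodule.span_le.2 ?_
  rintro _ ⟨γ, rfl⟩
  exact S.e_mem_n N γ.1.2

theorem aJ_kill_pt (hU : Upper R (N : Set M)) (J : Finset ↥N) {z : L} (hz : z ∈ S.aJ J)
    (c : ↥N → ℂ) : killingForm ℂ L z (S.pt N c) = killingForm ℂ L z (S.xi J c) := by
  induction hz using Submodule.span_induction with
  | mem x h =>
    obtain ⟨γ, rfl⟩ := h
    rw [S.kill_pt hU γ.1, xi, map_sum, Finset.sum_eq_single γ.1]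
    · rw [map_smul, S.kill _ (hU.sub γ.1.2) _ (R.neg_mem _ (hU.sub γ.1.2))]; simp
    · intro η _ h
      rw [map_smul, S.kill _ (hU.sub γ.1.2) _ (R.neg_mem _ (hU.sub η.2)), if_neg, smul_zero]
      intro h'
      exact h (Subtype.ext (by rw [← sub_eq_add_neg, sub_eq_zero] at h'; exact h'.symm))
    · intro h; exact absurd γ.2 h
  | zero => simp
  | add a b _ _ ha hb => rw [map_add, LinearMap.add_apply, ha, hb, LinearMap.add_apply]
  | smul c a _ ha => rw [map_smul, LinearMap.smul_apply, ha, LinearMap.smul_apply]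

/-- the span of the negative root vectors in `J` -/
def aJm (J : Finset ↥N) : Submodule ℂ L := Submodule.span ℂ (Set.range fun γ : ↥J => S.e (-γ.1.1))

theorem xi_mem (J : Finset ↥N) (c : ↥N → ℂ) : S.xi J c ∈ S.aJm J :=
  Submodule.sum_mem _ fun η hη => Submodule.smul_mem _ _ (Submodule.subset_span ⟨⟨η, hη⟩, rfl⟩)

theorem aJm_ext (hU : Upper R (N : Set M)) (J : Finset ↥N) {x : L} (hx : x ∈ S.aJm J)
    (h : ∀ z ∈ S.aJ J, killingForm ℂ L z x = 0) : x = 0 := by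
  obtain ⟨v, rfl⟩ := (Submodule.mem_span_range_iff_exists_fun ℂ).1 hx
  refine Finset.sum_eq_zero fun γ _ => ?_
  have h1 := h _ (Submodule.subset_span ⟨γ, rfl⟩)
  simp only at h1
  rw [map_sum, Finset.sum_eq_single γ] at h1
  · rw [map_smul, S.kill _ (hU.sub γ.1.2) _ (R.neg_mem _ (hU.sub γ.1.2))] at h1
    have : v γ = 0 := by simpa using h1
    rw [this, zero_smul]
  · intro η _ h
    rw [map_smul, S.kill _ (hU.sub γ.1.2) _ (R.neg_mem _ (hU.sub η.1.2)), if_neg, smul_zero]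
    intro h'
    exact h (Subtype.ext (Subtype.ext (by
      rw [← sub_eq_add_neg, sub_eq_zero] at h'; exact h'.symm)))
  · simp

/-- `J` is compatible with the positive root vector `α` -/
def Comp (J : Finset ↥N) (α : M) : Prop :=
  (∀ γ ∈ J, γ.1 + α ∉ R.Φ) ∨
  ((∀ γ ∈ J, γ.1 + α ∈ R.Φ → ∃ η ∈ J, η.1 = γ.1 + α) ∧
   (∀ γ ∈ J, α ≠ γ.1 ∧ (γ.1 - α ∈ R.Φ → ∃ η ∈ J, η.1 = γ.1 - α)))

theorem ad_mem_of_gen {W : Submodule ℂ L} {s : Set L} (hW : W = Submodule.span ℂ s) (x : L)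
    (h : ∀ z ∈ s, ⁅x, z⁆ ∈ W) : ∀ z ∈ W, ⁅x, z⁆ ∈ W := by
  intro z hz
  subst hW
  induction hz using Submodule.span_induction with
  | mem x h' => exact h _ h'
  | zero => simp
  | add a b _ _ ha hb => rw [lie_add]; exact Submodule.add_mem _ ha hb
  | smul c a _ ha => rw [lie_smul]; exact Submodule.smul_mem _ _ ha

variable [FiniteDimensional ℂ L]

theorem E_surj_of_stable {x : L} (hx : x ∈ S.u) (W : Submodule ℂ L) (h : ∀ z ∈ W, S.E hx z ∈ W)
    {y : L} (hy : y ∈ W) : ∃ z ∈ W, S.E hx z = y := by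
  have h1 : W.map ((S.E hx).toLinearEquiv : L →ₗ[ℂ] L) ≤ W := by
    rintro _ ⟨z, hz, rfl⟩; exact h z hz
  have h2 := Submodule.eq_of_le_of_finrank_eq h1 (LinearEquiv.finrank_map_eq _ _)
  rw [← h2] at hy
  obtain ⟨z, hz, hz'⟩ := hy
  exact ⟨z, hz, hz'⟩

theorem FJ_ne_act (hU : Upper R (N : Set M)) (J : Finset ↥N) {α : M} (ha : α ∈ R.Φ)
    (hp : 0 < R.ht α) (hc : Comp (R := R) J α) (s : ℂ) (c : ↥N → ℂ) :
    eval (S.act N (s • S.e α) c) (S.FJ J) = eval c (S.FJ J) ∨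
    (eval (S.act N (s • S.e α) c) (S.FJ J) ≠ 0 ↔ eval c (S.FJ J) ≠ 0) := by
  have hx : s • S.e α ∈ S.u := Submodule.smul_mem _ _ (S.e_mem_u ha hp)
  have hact : ∀ z ∈ S.n N, ∀ w, S.E hx z = w → killingForm ℂ L w (S.pt N (S.act N (s • S.e α) c)) =
      killingForm ℂ L z (S.pt N c) := by
    rintro z hz _ rfl
    have := S.kill_pt_act hU hx c hz
    rw [LieModule.traceForm_comm] at this
    rw [killingForm, this, LieModule.traceForm_comm]
  rcases hc with hc | ⟨hc1, hc2⟩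
  · left
    have hxi : S.xi J (S.act N (s • S.e α) c) = S.xi J c := by
      rw [xi, xi]
      refine Finset.sum_congr rfl fun η hη => ?_
      congr 1
      rw [← S.kill_pt hU η (S.act N (s • S.e α) c), ← S.kill_pt hU η c]
      apply hact _ (S.e_mem_n N η.2)
      rw [E_apply, nilExp, Finset.sum_range_succ', LinearMap.add_apply, LinearMap.sum_apply,
        Finset.sum_eq_zero]
      · simp
      · intro i _
        have h0 : ⁅S.e α, S.e η.1⁆ = 0 := by
          apply S.br_zero _ ha _ (hU.sub η.2)
          · intro h
            have := congrArg R.ht h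
            rw [map_add, map_zero] at this
            have := hU.pos _ η.2
            omega
          · rw [add_comm]; exact hc η hη
        rw [LinearMap.smul_apply, pow_succ, Module.End.mul_apply, LieAlgebra.ad_apply, smul_lie,
          h0, smul_zero, map_zero, smul_zero]
    rw [eval_FJ, eval_FJ, hxi]
  · right
    have hEa : ∀ z ∈ S.aJ J, S.E hx z ∈ S.aJ J := by
      intro z hz
      rw [E_apply]
      refine nilExp_mem _ _ (ad_mem_of_gen rfl _ ?_) hz
      rintro _ ⟨γ, rfl⟩
      rw [smul_lie]
      refine Submodule.smul_mem _ _ ?_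
      by_cases h : α + γ.1.1 ∈ R.Φ
      · obtain ⟨d, _, hd⟩ := S.br_ne α ha γ.1.1 (hU.sub γ.1.2) h
        rw [hd]
        obtain ⟨η, hη, he⟩ := hc1 γ.1 γ.2 (by rw [add_comm]; exact h)
        rw [add_comm, ← he]
        exact Submodule.smul_mem _ _ (Submodule.subset_span ⟨⟨η, hη⟩, rfl⟩)
      · rw [S.br_zero α ha _ (hU.sub γ.1.2) _ h]
        · exact Submodule.zero_mem _
        · intro h
          have := congrArg R.ht h
          rw [map_add, map_zero] at this
          have := hU.pos _ γ.1.2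
          omega
    have hEm : ∀ z ∈ S.aJm J, S.E hx z ∈ S.aJm J := by
      intro z hz
      rw [E_apply]
      refine nilExp_mem _ _ (ad_mem_of_gen rfl _ ?_) hz
      rintro _ ⟨γ, rfl⟩
      rw [smul_lie]
      refine Submodule.smul_mem _ _ ?_
      have hn := R.neg_mem _ (hU.sub γ.1.2)
      by_cases h : α + -γ.1.1 ∈ R.Φ
      · obtain ⟨d, _, hd⟩ := S.br_ne α ha _ hn h
        rw [hd]
        obtain ⟨η, hη, he⟩ := (hc2 γ.1 γ.2).2 (by
          have := R.neg_mem _ h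
          rwa [neg_add, neg_neg, add_comm, ← sub_eq_add_neg] at this)
        have h3 : α + -γ.1.1 = -η.1 := by rw [he]; abel
        rw [h3]
        exact Submodule.smul_mem _ _ (Submodule.subset_span ⟨⟨η, hη⟩, rfl⟩)
      · rw [S.br_zero α ha _ hn _ h]
        · exact Submodule.zero_mem _
        · intro h
          exact (hc2 γ.1 γ.2).1 (by rw [← sub_eq_add_neg, sub_eq_zero] at h; exact h)
    have hxi : S.xi J (S.act N (s • S.e α) c) = S.E hx (S.xi J c) := by
      rw [← sub_eq_zero]
      apply S.aJm_ext hU J (Submodule.sub_mem _ (S.xi_mem J _) (hEm _ (S.xi_mem J _)))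
      intro z hz
      rw [map_sub, ← S.aJ_kill_pt hU J hz]
      obtain ⟨z0, hz0, rfl⟩ := S.E_surj_of_stable hx _ hEa hz
      rw [hact z0 (S.aJ_le_n J hz0) _ rfl, killingForm_of_equiv_apply, S.aJ_kill_pt hU J hz0,
        sub_self]
    have key : ∀ y z : L, killingForm ℂ L (S.E hx z) ⁅S.xi J (S.act N (s • S.e α) c),
        ⁅S.xi J (S.act N (s • S.e α) c), S.E hx y⁆⁆ =
        killingForm ℂ L z ⁅S.xi J c, ⁅S.xi J c, y⁆⁆ := by
      intro y z
      rw [hxi, ← LieEquiv.map_lie, ← LieEquiv.map_lie, killingForm_of_equiv_apply]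
    rw [S.FJ_ne_iff hU, S.FJ_ne_iff hU]
    constructor
    · intro h y hy hz
      have := h (S.E hx y) (hEa _ hy) (by
        intro z hz'
        obtain ⟨z0, hz0, rfl⟩ := S.E_surj_of_stable hx _ hEa hz'
        rw [key]; exact hz z0 hz0)
      exact (S.E hx).injective (this.trans (map_zero _).symm)
    · intro h y hy hz
      obtain ⟨y0, hy0, rfl⟩ := S.E_surj_of_stable hx _ hEa hy
      rw [h y0 hy0 (fun z hz' => by rw [← key]; exact hz _ (hEa _ hz')), map_zero]

theorem act_zero (hU : Upper R (N : Set M)) (c : ↥N → ℂ) : S.act N 0 c = c := by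
  funext γ
  rw [act, nilExp, Finset.sum_range_succ', LinearMap.add_apply, LinearMap.sum_apply,
    Finset.sum_eq_zero]
  · simpa using S.kill_pt hU γ c
  · intro i _
    rw [map_zero, zero_pow (Nat.succ_ne_zero i)]; simp

theorem FJ_mem (hU : Upper R (N : Set M)) (J : Finset ↥N)
    (hc : ∀ α ∈ R.Φ, 0 < R.ht α → Comp (R := R) J α) : S.FJ J ∈ S.A' N := by
  apply S.A'_of_inv hU
  intro α ha hp s c
  by_cases h0 : eval c (S.FJ J) = 0
  · rcases S.FJ_ne_act hU J ha hp (hc α ha hp) s c with h | h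
    · exact h
    · rw [h0]; by_contra h'; exact (h.1 h') h0
  · set q := (S.fl N (S.e α) (S.FJ J)).map (eval c) with hq
    have hne : ∀ r, Polynomial.eval r q ≠ 0 := by
      intro r
      rw [hq, S.fl_eval]
      rcases S.FJ_ne_act hU J ha hp (hc α ha hp) r c with h | h
      · rw [h]; exact h0
      · exact h.2 h0
    have hdeg : q.degree = 0 := by
      by_contra hd
      obtain ⟨r, hr⟩ := IsAlgClosed.exists_root q hd
      exact hne r hr
    have h1 := Polynomial.eq_C_of_degree_eq_zero hdeg
    have h2 := S.fl_eval (S.e α) s c (S.FJ J)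
    have h3 := S.fl_eval (S.e α) 0 c (S.FJ J)
    rw [← hq, h1, Polynomial.eval_C] at h2 h3
    rw [zero_smul, S.act_zero hU] at h3
    rw [← h2, h3]

end Setup
end CPF

namespace CPF
namespace Setup
open MvPolynomial
variable {L : Type*} [LieRing L] [LieAlgebra ℂ L] {M : Type*} [AddCommGroup M] {R : RS M}
  (S : Setup L R) {N : Finset M}

/-- sum of the first coroots of the sequence -/
def sg (G : Greedy R (N : Set M)) (j : ℕ) : M →+ ℤ := ∑ r ∈ Finset.range (j + 1), G.P r

theorem sg_apply (G : Greedy R (N : Set M)) (j : ℕ) (γ : M) :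
    sg G j γ = ∑ r ∈ Finset.range (j + 1), G.P r γ := by
  simp [sg]

/-- roots on which `sg` takes the value two -/
def Jj (G : Greedy R (N : Set M)) (j : ℕ) : Finset ↥N :=
  Finset.univ.filter fun γ => sg G j γ.1 = 2

theorem mem_Jj (G : Greedy R (N : Set M)) (j : ℕ) (γ : ↥N) : γ ∈ Jj G j ↔ sg G j γ.1 = 2 := by
  simp [Jj]

theorem Jj_of (G : Greedy R (N : Set M)) (hU : Upper R (N : Set M))
    (hab : ∀ γ η, G.Q γ → G.Q η → γ + η ∉ R.Φ) {j : ℕ} (hj : j < G.k) {γ : M} (hγ : γ ∈ R.Φ)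
    (h2 : sg G j γ = 2) : ∃ η ∈ Jj G j, η.1 = γ := by
  have hQ := G.Q_of_sum hU hab hγ hj (by rw [← sg_apply]; exact h2)
  exact ⟨⟨γ, by simpa using G.Q_N hU hQ⟩, (mem_Jj G j _).2 h2, rfl⟩

theorem Jj_comp (G : Greedy R (N : Set M)) (hU : Upper R (N : Set M))
    (hab : ∀ γ η, G.Q γ → G.Q η → γ + η ∉ R.Φ) {j : ℕ} (hj : j < G.k) (α : M) (ha : α ∈ R.Φ)
    (hp : 0 < R.ht α) : Comp (R := R) (Jj G j) α := by
  by_cases h : sg G j α = 0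
  · right
    refine ⟨fun γ hγ hs => Jj_of G hU hab hj hs ?_, fun γ hγ => ⟨?_, fun hs =>
      Jj_of G hU hab hj hs ?_⟩⟩
    · rw [map_add, h, add_zero]; exact (mem_Jj G j γ).1 hγ
    · rintro rfl; rw [(mem_Jj G j γ).1 hγ] at h; omega
    · rw [map_sub, h, sub_zero]; exact (mem_Jj G j γ).1 hγ
  · left
    intro γ hγ hs
    apply h
    rw [sg_apply]
    refine G.sum_add hU hab (hU.sub γ.2) hj ?_ ha hp hs
    rw [← sg_apply]; exact (mem_Jj G j γ).1 hγ

theorem B_eq (G : Greedy R (N : Set M)) (hU : Upper R (N : Set M))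
    (hab : ∀ γ η, G.Q γ → G.Q η → γ + η ∉ R.Φ) {i l : ℕ} (hi : i < G.k) (hl : l < G.k) :
    S.B (G.β i) (G.β i) = S.B (G.β l) (G.β l) := by
  wlog h : i < l generalizing i l
  · rcases (not_lt.1 h).lt_or_eq with h | h
    · exact (this hl hi h).symm
    · rw [h]
  obtain ⟨η, hη, a, b⟩ := G.exists_J hU hab h hl
  obtain ⟨-, e1, e2, -, -, -⟩ := G.two_pos hU hab hη h hl a b
  have hb := G.pair_balance hU hab hη h hl a b
  have a1 := S.B_p η hη _ (G.mem_Φ hU hi)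
  have a2 := S.B_p η hη _ (G.mem_Φ hU hl)
  have b1 := S.B_p _ (G.mem_Φ hU hi) η hη
  have b2 := S.B_p _ (G.mem_Φ hU hl) η hη
  rw [S.B_symm _ (G.mem_Φ hU hi) η hη] at b1
  rw [S.B_symm _ (G.mem_Φ hU hl) η hη] at b2
  rw [Greedy.P] at e1 e2
  rw [e1] at a1
  rw [e2] at a2
  rw [hb] at b1
  rw [b1] at a1
  rw [b2] at a2
  rw [a1] at a2
  simpa using a2

theorem t_sum_br (G : Greedy R (N : Set M)) (hU : Upper R (N : Set M))
    (hab : ∀ γ η, G.Q γ → G.Q η → γ + η ∉ R.Φ) {j : ℕ} (hj : j < G.k) {γ : M} (hγ : γ ∈ R.Φ) :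
    ⁅S.t (∑ i ∈ Finset.range (j + 1), G.β i), S.e γ⁆ =
      (S.B (G.β 0) (G.β 0) / 2 * (sg G j γ : ℂ)) • S.e γ := by
  rw [S.t_br _ _ hγ, map_sum, AddMonoidHom.finsetSum_apply, sg_apply]
  congr 1
  push_cast
  rw [Finset.mul_sum]
  refine Finset.sum_congr rfl fun i hi => ?_
  have hi : i < G.k := by rw [Finset.mem_range] at hi; omega
  have h1 := S.B_p γ hγ _ (G.mem_Φ hU hi)
  rw [S.B_symm _ (G.mem_Φ hU hi) γ hγ]
  rw [S.B_eq G hU hab hi (by omega : 0 < G.k)] at h1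
  rw [Greedy.P]
  linear_combination h1 / 2

theorem e_ne {γ : M} (hγ : γ ∈ R.Φ) : S.e γ ≠ 0 := by
  intro h
  have := S.kill γ hγ _ (R.neg_mem _ hγ)
  rw [h] at this
  simp at this

theorem eval_zero_FJ (G : Greedy R (N : Set M)) (hU : Upper R (N : Set M)) {j : ℕ} (hj : j < G.k) :
    eval 0 (S.FJ (Jj G j)) = 0 := by
  by_contra h
  have h0 : 0 < G.k := by omega
  have hm : (⟨G.β 0, by simpa using G.mem 0 h0⟩ : ↥N) ∈ Jj G j := by
    rw [mem_Jj, sg_apply, Finset.sum_eq_single 0]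
    · exact G.P_self hU h0
    · intro r hr hne
      rw [Finset.mem_range] at hr
      exact G.P_ne hU (by omega) h0 hne
    · simp
  have := (S.FJ_ne_iff hU _ _).1 h (S.e (G.β 0)) (Submodule.subset_span ⟨⟨_, hm⟩, rfl⟩) (by
    intro z _
    simp [xi])
  exact S.e_ne (G.mem_Φ hU h0) this

theorem aJ_lie_eig (J : Finset ↥N) (h : L) (q : ℂ)
    (hh : ∀ γ ∈ J, ⁅h, S.e γ.1⁆ = q • S.e γ.1) {y : L} (hy : y ∈ S.aJ J) : ⁅h, y⁆ = q • y := by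
  induction hy using Submodule.span_induction with
  | mem x h => obtain ⟨γ, rfl⟩ := h; exact hh _ γ.2
  | zero => simp
  | add a b _ _ ha hb => rw [lie_add, ha, hb, smul_add]
  | smul c a _ ha => rw [lie_smul, ha, smul_comm]

theorem FJ_eval_ne (G : Greedy R (N : Set M)) (hU : Upper R (N : Set M))
    (hab : ∀ γ η, G.Q γ → G.Q η → γ + η ∉ R.Φ) {j : ℕ} (hj : j < G.k) (g : ℕ → M)
    (hg : ∀ i ≤ j, g i ∈ R.Φ ∧ (∑ r ∈ Finset.range (j+1), G.P r (g i) = 2))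
    (hd : ∀ i ≤ j, ∀ i' ≤ j, g i ≠ g i' → g i - g i' ∉ R.Φ)
    (hs : ∑ i ∈ Finset.range (j+1), g i = ∑ i ∈ Finset.range (j+1), G.β i) :
    eval (fun γ : ↥N => if ∃ i ≤ j, γ.1 = g i then (1 : ℂ) else 0) (S.FJ (Jj G j)) ≠ 0 := by
  have h0 : 0 < G.k := by omega
  set c : ↥N → ℂ := fun γ : ↥N => if ∃ i ≤ j, γ.1 = g i then (1 : ℂ) else 0 with hc
  set J := Jj G j
  set w := S.xi J c with hw
  set q := S.B (G.β 0) (G.β 0) with hq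
  set h := S.t (∑ i ∈ Finset.range (j + 1), G.β i) with hh
  set x := ∑ i ∈ Finset.range (j + 1), S.e (g i) with hx
  have hQ : ∀ γ ∈ J, G.Q γ.1 := fun γ hγ => G.Q_of_sum hU hab (hU.sub γ.2) hj (by
    rw [← sg_apply]; exact (mem_Jj G j γ).1 hγ)
  have hgJ : ∀ i ∈ Finset.range (j + 1), ∃ γ ∈ J, γ.1 = g i := fun i hi =>
    Jj_of G hU hab hj (hg i (by rw [Finset.mem_range] at hi; omega)).1 (by
      rw [sg_apply]; exact (hg i (by rw [Finset.mem_range] at hi; omega)).2)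
  have hq0 : q ≠ 0 := S.B_ne _ (G.mem_Φ hU h0)
  have hhe : ∀ γ ∈ J, ⁅h, S.e γ.1⁆ = q • S.e γ.1 := by
    intro γ hγ
    rw [hh, S.t_sum_br G hU hab hj (hU.sub γ.2), (mem_Jj G j γ).1 hγ]
    congr 1; push_cast; ring
  have hhy : ∀ y ∈ S.aJ J, ⁅h, y⁆ = q • y := fun y hy => S.aJ_lie_eig J h q hhe hy
  have hne : ∀ γ ∈ J, ∀ η ∈ J, γ.1 + η.1 ≠ 0 := by
    intro γ _ η _ h
    have := congrArg R.ht h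
    rw [map_add, map_zero] at this
    have := hU.pos _ γ.2
    have := hU.pos _ η.2
    omega
  have hhw : ⁅h, w⁆ = (-q) • w := by
    rw [hw, xi, lie_sum, Finset.smul_sum]
    refine Finset.sum_congr rfl fun γ hγ => ?_
    rw [lie_smul, hh, S.t_sum_br G hU hab hj (R.neg_mem _ (hU.sub γ.2)), map_neg,
      (mem_Jj G j γ).1 hγ, smul_comm]
    congr 2; push_cast; ring
  have hxy : ∀ y ∈ S.aJ J, ⁅x, y⁆ = 0 := by
    intro y hy
    have := S.aJ_lie_eig J x 0 (by
      intro γ hγ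
      rw [zero_smul, hx, sum_lie]
      refine Finset.sum_eq_zero fun i hi => ?_
      obtain ⟨η, hη, he⟩ := hgJ i hi
      rw [← he]
      exact S.br_zero _ (hU.sub η.2) _ (hU.sub γ.2) (hne η hη γ hγ) (hab _ _ (hQ η hη) (hQ γ hγ))) hy
    rw [this, zero_smul]
  have hxw : ⁅x, w⁆ = h := by
    rw [hh, ← hs, map_sum, hx, sum_lie]
    refine Finset.sum_congr rfl fun i hi => ?_
    obtain ⟨γ, hγ, he⟩ := hgJ i hi
    have hi' : i ≤ j := by rw [Finset.mem_range] at hi; omega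
    rw [hw, xi, lie_sum, Finset.sum_eq_single γ]
    · rw [← he, lie_smul, S.br_t _ (hU.sub γ.2), hc]
      simp only
      rw [if_pos ⟨i, hi', he⟩, one_smul]
    · intro η _ hηγ
      rw [lie_smul, hc]
      simp only
      by_cases hex : ∃ i ≤ j, η.1 = g i
      · obtain ⟨i', hi'', he'⟩ := hex
        have hn : g i ≠ g i' := by
          rw [← he, ← he']; intro h; exact hηγ (Subtype.ext h.symm)
        rw [← he, S.br_zero _ (hU.sub γ.2) _ (R.neg_mem _ (hU.sub η.2)), smul_zero]
        · rw [he, he', ← sub_eq_add_neg]; exact sub_ne_zero.2 hn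
        · rw [he, he', ← sub_eq_add_neg]; exact hd i hi' i' hi'' hn
      · rw [if_neg hex, zero_smul]
    · intro h; exact absurd hγ h
  rw [S.FJ_ne_iff hU]
  intro y hy hz
  have e1 : ⁅x, ⁅w, y⁆⁆ = q • y := by
    rw [leibniz_lie, hxw, hhy y hy, hxy y hy, lie_zero, add_zero]
  have e2 : ⁅h, ⁅w, y⁆⁆ = 0 := by
    rw [leibniz_lie, hhw, hhy y hy, smul_lie, lie_smul, neg_smul, neg_add_cancel]
  have e3 : ⁅x, ⁅w, ⁅w, y⁆⁆⁆ = q • ⁅w, y⁆ := by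
    rw [leibniz_lie, hxw, e2, e1, lie_smul, zero_add]
  have e4 : ⁅x, ⁅x, ⁅w, ⁅w, y⁆⁆⁆⁆ = (q * q) • y := by
    rw [e3, lie_smul, e1, smul_smul]
  have key : ∀ γ ∈ J, killingForm ℂ L y (S.e (-γ.1)) = 0 := by
    intro γ hγ
    have hmem : ⁅x, ⁅x, S.e (-γ.1)⁆⁆ ∈ S.aJ J := by
      rw [hx, sum_lie]
      refine Submodule.sum_mem _ fun i' hi' => ?_
      rw [sum_lie, lie_sum]
      refine Submodule.sum_mem _ fun i hi => ?_
      obtain ⟨η, hη, he⟩ := hgJ i hi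
      obtain ⟨η', hη', he'⟩ := hgJ i' hi'
      rw [← he, ← he']
      by_cases hηγ : η.1 + -γ.1 = 0
      · rw [← sub_eq_add_neg, sub_eq_zero] at hηγ
        rw [← hηγ, S.br_t _ (hU.sub η.2), ← lie_skew, S.t_br _ _ (hU.sub η'.2)]
        exact Submodule.neg_mem _ (Submodule.smul_mem _ _ (Submodule.subset_span ⟨⟨η', hη'⟩, rfl⟩))
      by_cases hr : η.1 + -γ.1 ∈ R.Φ
      · obtain ⟨d, _, hd⟩ := S.br_ne _ (hU.sub η.2) _ (R.neg_mem _ (hU.sub γ.2)) hr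
        rw [hd, lie_smul]
        refine Submodule.smul_mem _ _ ?_
        by_cases hz : η'.1 + (η.1 + -γ.1) = 0
        · exfalso
          have : η'.1 + η.1 = γ.1 := by
            rw [← add_assoc, ← sub_eq_add_neg, sub_eq_zero] at hz; exact hz
          exact hab _ _ (hQ η' hη') (hQ η hη) (by rw [this]; exact hU.sub γ.2)
        by_cases hr' : η'.1 + (η.1 + -γ.1) ∈ R.Φ
        · obtain ⟨d', _, hd'⟩ := S.br_ne _ (hU.sub η'.2) _ hr hr'
          rw [hd']
          obtain ⟨θ, hθ, hθe⟩ := Jj_of G hU hab hj hr' (by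
            rw [map_add, map_add, map_neg, (mem_Jj G j γ).1 hγ, (mem_Jj G j η).1 hη,
              (mem_Jj G j η').1 hη']; rfl)
          rw [← hθe]
          exact Submodule.smul_mem _ _ (Submodule.subset_span ⟨⟨θ, hθ⟩, rfl⟩)
        · rw [S.br_zero _ (hU.sub η'.2) _ hr hz hr']; exact Submodule.zero_mem _
      · rw [S.br_zero _ (hU.sub η.2) _ (R.neg_mem _ (hU.sub γ.2)) hηγ hr, lie_zero]
        exact Submodule.zero_mem _
    have h1 := hz _ hmem
    rw [kill_ad, kill_ad, neg_neg, e4, map_smul, LieModule.traceForm_comm, smul_eq_mul] at h1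
    exact (mul_eq_zero.1 h1).resolve_left (mul_ne_zero hq0 hq0)
  obtain ⟨v, rfl⟩ := (Submodule.mem_span_range_iff_exists_fun ℂ).1 hy
  refine Finset.sum_eq_zero fun γ _ => ?_
  have := key γ.1 γ.2
  rw [S.aJ_kill hU J v γ] at this
  rw [this, zero_smul]

theorem exists_F [FiniteDimensional ℂ L] (G : Greedy R (N : Set M)) (hU : Upper R (N : Set M))
    (hab : ∀ γ η, G.Q γ → G.Q η → γ + η ∉ R.Φ) {j : ℕ} (hj : j < G.k) :
    ∃ c : ↥N → ℂ, (∀ γ, c γ ≠ 0 → sg G j γ.1 = 2 ∧ (∀ r ≤ j, G.P r γ.1 = G.P (j - r) γ.1) ∧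
      ∀ r, j < r → r < G.k → G.P r γ.1 = 0) ∧
      ∃ F ∈ S.A' N, eval 0 F = 0 ∧ eval c F ≠ 0 := by
  obtain ⟨g, h1, h2, h3⟩ := G.exists_family hU hab hj
  refine ⟨_, ?_, S.FJ (Jj G j), S.FJ_mem hU _ (fun α ha hp => Jj_comp G hU hab hj α ha hp),
    S.eval_zero_FJ G hU hj, S.FJ_eval_ne G hU hab hj g (fun i hi => ⟨(h1 i hi).1, (h1 i hi).2.1⟩) h2 h3⟩
  intro γ hγ
  by_cases hex : ∃ i ≤ j, γ.1 = g i
  · obtain ⟨i, hi, he⟩ := hex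
    rw [he, sg_apply]
    exact (h1 i hi).2
  · rw [if_neg hex] at hγ; exact absurd rfl hγ

end Setup
end CPF

namespace CPF
namespace Setup
open MvPolynomial
variable {L : Type*} [LieRing L] [LieAlgebra ℂ L] {M : Type*} [AddCommGroup M] {R : RS M}
  (S : Setup L R) {N : Finset M}

/-- weights of the coordinate functions -/
def wt : ↥N → M × ℤ := fun γ => (γ.1, 1)

theorem lin_homog (hU : Upper R (N : Set M)) {α : M} (ha : α ∈ R.Φ) (γ : ↥N) :
    IsWeightedHomogeneous (wt (N := N)) (S.lin N γ (LieAlgebra.ad ℂ L (S.e α))) (wt γ + (α, 0)) := by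
  rw [lin]
  refine IsWeightedHomogeneous.sum _ _ _ fun η _ => ?_
  by_cases h : γ.1 + α = η.1
  · have : wt γ + (α, 0) = wt η := by simp [wt, h]
    rw [this]
    exact (isWeightedHomogeneous_X ℂ wt η).C_mul _
  · rw [LieAlgebra.ad_apply, S.kill_br_zero (hU.sub γ.2) ha (R.neg_mem _ (hU.sub η.2)), C_0, zero_mul]
    · exact isWeightedHomogeneous_zero ℂ wt _
    · rw [← sub_eq_add_neg]; exact sub_ne_zero.2 h

theorem D_homog (hU : Upper R (N : Set M)) {α : M} (ha : α ∈ R.Φ) {f : MvPolynomial ↥N ℂ}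
    {ν : M × ℤ} (hf : IsWeightedHomogeneous wt f ν) :
    IsWeightedHomogeneous wt (S.D N (S.e α) f) (ν + (α, 0)) := by
  rw [D_apply]
  refine IsWeightedHomogeneous.sum _ _ _ fun γ _ => ?_
  have h1 := hf.pderiv (i := γ) (n' := ν - wt γ) (by abel)
  have h2 := (S.lin_homog hU ha γ).mul h1
  have : wt γ + (α, (0:ℤ)) + (ν - wt γ) = ν + (α, 0) := by abel
  rwa [this] at h2

theorem comp_D (hU : Upper R (N : Set M)) {α : M} (ha : α ∈ R.Φ) (f : MvPolynomial ↥N ℂ)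
    (ν : M × ℤ) : weightedHomogeneousComponent wt (ν + (α, 0)) (S.D N (S.e α) f) =
      S.D N (S.e α) (weightedHomogeneousComponent wt ν f) := by
  induction f using MvPolynomial.induction_on' with
  | monomial u a =>
    have h1 : IsWeightedHomogeneous (wt (N := N)) (monomial u a) (Finsupp.weight wt u) :=
      isWeightedHomogeneous_monomial _ _ _ rfl
    have h2 := S.D_homog hU ha h1
    by_cases h : Finsupp.weight wt u = ν
    · rw [← h, h1.weightedHomogeneousComponent_same, h2.weightedHomogeneousComponent_same]
    · rw [h1.weightedHomogeneousComponent_ne _ (Ne.symm h), map_zero,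
        h2.weightedHomogeneousComponent_ne]
      intro h'; exact h (add_right_cancel h').symm
  | add p q hp hq => simp only [map_add, hp, hq]

theorem comp_mem (hU : Upper R (N : Set M)) {f : MvPolynomial ↥N ℂ} (hf : f ∈ S.A' N)
    (ν : M × ℤ) : weightedHomogeneousComponent wt ν f ∈ S.A' N := by
  rw [mem_A'] at hf ⊢
  intro α ha hp
  rw [← S.comp_D hU ha, hf α ha hp, map_zero]

theorem rho_coeff (G : Greedy R (N : Set M)) (hU : Upper R (N : Set M)) (f : MvPolynomial ↥N ℂ)
    (m : Fin G.k →₀ ℕ) : coeff m (rho G f) = coeff (m.mapDomain (bb G)) f := by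
  induction f using MvPolynomial.induction_on' with
  | monomial u a =>
    by_cases h : (u.support : Set ↥N) ⊆ Set.range (bb G)
    · obtain ⟨u', rfl⟩ : ∃ u', u = Finsupp.mapDomain (bb G) u' :=
        ⟨_, (Finsupp.mapDomain_comapDomain _ (bb_inj G hU) u h).symm⟩
      have h1 : rho G (rename (bb G) (monomial u' a)) = monomial u' a := by
        have : (rho G).comp (rename (bb G)) = AlgHom.id ℂ _ := by
          apply MvPolynomial.algHom_ext
          intro i
          rw [AlgHom.comp_apply, rename_X, rho_X_bb G hU]; rfl
        exact congrArg (fun g => g (monomial u' a)) this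
      rw [rename_monomial] at h1
      rw [h1, coeff_monomial, coeff_monomial]
      by_cases hm : u' = m
      · rw [if_pos hm, if_pos (by rw [hm])]
      · rw [if_neg hm, if_neg (fun h => hm (Finsupp.mapDomain_injective (bb_inj G hU) h))]
    · rw [Set.not_subset] at h
      obtain ⟨γ, hγ, hγ'⟩ := h
      have h1 : rho G (monomial u a) = 0 := by
        rw [monomial_eq, map_mul, Finsupp.prod, map_prod, Finset.prod_eq_zero hγ, mul_zero]
        rw [map_pow, rho_X_not, zero_pow (by simpa using hγ)]
        intro i hi; exact hγ' ⟨i, hi⟩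
      rw [h1, coeff_zero, coeff_monomial, if_neg]
      rintro rfl
      have := Finsupp.mapDomain_support hγ
      rw [Finset.mem_image] at this
      obtain ⟨i, _, hi⟩ := this
      exact hγ' ⟨i, hi⟩
  | add p q hp hq => simp only [map_add, coeff_add, hp, hq]

/-- restriction to a set of coordinates -/
def psi (V : Set ↥N) : MvPolynomial ↥N ℂ →ₐ[ℂ] MvPolynomial ↥N ℂ :=
  aeval fun γ => if γ ∈ V then X γ else 0

theorem psi_coeff (V : Set ↥N) (f : MvPolynomial ↥N ℂ) (d : ↥N →₀ ℕ) :
    coeff d (psi V f) = if (d.support : Set ↥N) ⊆ V then coeff d f else 0 := by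
  induction f using MvPolynomial.induction_on' with
  | monomial u a =>
    by_cases h : (u.support : Set ↥N) ⊆ V
    · have h1 : psi V (monomial u a) = monomial u a := by
        rw [monomial_eq, map_mul, Finsupp.prod, map_prod, psi, algHom_C]
        congr 1
        refine Finset.prod_congr rfl fun γ hγ => ?_
        rw [map_pow, aeval_X, if_pos (h hγ)]
      rw [h1, coeff_monomial]
      by_cases hd : u = d
      · rw [if_pos hd, if_pos (by rw [← hd]; exact h)]
      · rw [if_neg hd, ite_self]
    · have h' := h
      rw [Set.not_subset] at h
      obtain ⟨γ, hγ, hγ'⟩ := h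
      have h1 : psi V (monomial u a) = 0 := by
        rw [monomial_eq, map_mul, Finsupp.prod, map_prod, Finset.prod_eq_zero hγ, mul_zero]
        rw [map_pow, psi, aeval_X, if_neg hγ', zero_pow (by simpa using hγ)]
      rw [h1, coeff_zero, coeff_monomial]
      by_cases hd : u = d
      · rw [if_neg (by rw [← hd]; exact h')]
      · rw [if_neg hd, ite_self]
  | add p q hp hq =>
    simp only [map_add, coeff_add, hp, hq]
    split_ifs <;> simp

theorem psi_homog (V : Set ↥N) {f : MvPolynomial ↥N ℂ} {ν : M × ℤ}
    (hf : IsWeightedHomogeneous wt f ν) : IsWeightedHomogeneous wt (psi V f) ν := by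
  intro d hd
  rw [psi_coeff] at hd
  apply hf
  intro h; rw [h, ite_self] at hd; exact hd rfl

theorem psi_supp (V : Set ↥N) (f : MvPolynomial ↥N ℂ) : psi V f ∈ supported ℂ V := by
  induction f using MvPolynomial.induction_on with
  | C a => rw [psi, algHom_C]; exact Subalgebra.algebraMap_mem _ _
  | add p q hp hq => rw [map_add]; exact add_mem hp hq
  | mul_X p γ hp =>
    rw [map_mul]
    refine mul_mem hp ?_
    rw [psi, aeval_X]
    split_ifs with h
    · exact Algebra.subset_adjoin ⟨γ, h, rfl⟩
    · exact zero_mem _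

theorem D_e_X_zero (hU : Upper R (N : Set M)) {α : M} (ha : α ∈ R.Φ) (γ : ↥N)
    (h : γ.1 + α ∉ N) : S.D N (S.e α) (X γ) = 0 := by
  rw [D_X, lin]
  refine Finset.sum_eq_zero fun η _ => ?_
  rw [LieAlgebra.ad_apply, S.kill_br_zero (hU.sub γ.2) ha (R.neg_mem _ (hU.sub η.2)), C_0, zero_mul]
  rw [← sub_eq_add_neg, sub_ne_zero]
  intro h'; exact h (by rw [h']; exact η.2)

theorem D_e_X (hU : Upper R (N : Set M)) {α : M} (ha : α ∈ R.Φ) (γ η : ↥N)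
    (h : γ.1 + α = η.1) : ∃ c, S.D N (S.e α) (X γ) = C c * X η := by
  refine ⟨killingForm ℂ L (S.e γ.1) ⁅S.e α, S.e (-η.1)⁆, ?_⟩
  rw [D_X, lin, Finset.sum_eq_single η, LieAlgebra.ad_apply]
  · intro ζ _ hζ
    rw [LieAlgebra.ad_apply, S.kill_br_zero (hU.sub γ.2) ha (R.neg_mem _ (hU.sub ζ.2)), C_0, zero_mul]
    rw [← sub_eq_add_neg, sub_ne_zero, h]
    intro h'; exact hζ (Subtype.ext h'.symm)
  · simp

theorem D_psi (hU : Upper R (N : Set M)) {δ : M} (hδ : δ ∈ R.Φ) (V : Set ↥N)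
    (h1 : ∀ γ η : ↥N, γ.1 + δ = η.1 → (γ ∈ V ↔ η ∈ V)) (f : MvPolynomial ↥N ℂ) :
    S.D N (S.e δ) (psi V f) = psi V (S.D N (S.e δ) f) := by
  induction f using MvPolynomial.induction_on with
  | C a => simp [psi, algHom_C]
  | add p q hp hq => simp only [map_add, hp, hq]
  | mul_X p γ hp =>
    have key : S.D N (S.e δ) (psi V (X γ)) = psi V (S.D N (S.e δ) (X γ)) := by
      by_cases hN : γ.1 + δ ∈ N
      · obtain ⟨c, hc⟩ := S.D_e_X hU hδ γ ⟨_, hN⟩ rfl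
        have := h1 γ ⟨_, hN⟩ rfl
        rw [hc]
        by_cases hV : γ ∈ V
        · simp only [psi, map_mul, aeval_X, algHom_C, if_pos hV, if_pos (this.1 hV)]
          exact hc
        · simp only [psi, map_mul, aeval_X, algHom_C, if_neg hV, if_neg (fun h => hV (this.2 h))]
          simp
      · have h0 := S.D_e_X_zero hU hδ γ hN
        rw [h0, map_zero, psi, aeval_X]
        split_ifs
        · exact h0
        · simp
    simp only [map_mul, Derivation.leibniz, hp, key, map_add, smul_eq_mul]

/-- linear form attached to an element of `L` -/
def XX (z : L) : MvPolynomial ↥N ℂ := ∑ η : ↥N, C (killingForm ℂ L z (S.e (-η.1))) * X η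

theorem XX_add (z z' : L) : S.XX (N := N) (z + z') = S.XX z + S.XX z' := by
  simp [XX, add_mul, Finset.sum_add_distrib]

theorem XX_sub (z z' : L) : S.XX (N := N) (z - z') = S.XX z - S.XX z' := by
  simp [XX, sub_mul, Finset.sum_sub_distrib]

theorem XX_smul (c : ℂ) (z : L) : S.XX (N := N) (c • z) = c • S.XX z := by
  simp [XX, Finset.smul_sum, mul_assoc, smul_eq_C_mul]

theorem XX_zero : S.XX (N := N) 0 = 0 := by simp [XX]

theorem XX_e (hU : Upper R (N : Set M)) (γ : ↥N) : S.XX (S.e γ.1) = X γ := by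
  rw [XX, Finset.sum_eq_single γ]
  · rw [S.kill _ (hU.sub γ.2) _ (R.neg_mem _ (hU.sub γ.2))]; simp
  · intro η _ h
    rw [S.kill _ (hU.sub γ.2) _ (R.neg_mem _ (hU.sub η.2)), if_neg, C_0, zero_mul]
    rw [← sub_eq_add_neg, sub_eq_zero]
    intro h'; exact h (Subtype.ext h'.symm)
  · simp

theorem D_XX (hU : Upper R (N : Set M)) (x : L) {z : L} (hz : z ∈ S.n N) :
    S.D N x (S.XX z) = - S.XX ⁅x, z⁆ := by
  induction hz using Submodule.span_induction with
  | mem z h =>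
    obtain ⟨γ, hγ, rfl⟩ := h
    rw [S.XX_e hU ⟨γ, hγ⟩, D_X, lin, XX, ← Finset.sum_neg_distrib]
    refine Finset.sum_congr rfl fun η _ => ?_
    rw [LieAlgebra.ad_apply, kill_ad, C_neg, neg_mul, neg_neg]
  | zero => rw [lie_zero, XX_zero, map_zero, neg_zero]
  | add a b _ _ ha hb => rw [XX_add, map_add, ha, hb, lie_add, XX_add]; abel
  | smul c a _ ha => rw [XX_smul, Derivation.map_smul, ha, lie_smul, XX_smul, smul_neg]

/-- weight derivation -/
def Hd (δ : M) : Derivation ℂ (MvPolynomial ↥N ℂ) (MvPolynomial ↥N ℂ) :=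
  mkDerivation ℂ fun γ => S.B δ γ.1 • X γ

theorem Hd_homog (δ : M) {f : MvPolynomial ↥N ℂ} {ν : M × ℤ}
    (hf : IsWeightedHomogeneous wt f ν) : S.Hd δ f = S.B δ ν.1 • f := by
  have hmon : ∀ (d : ↥N →₀ ℕ) (a : ℂ), S.Hd δ (monomial d a) =
      S.B δ (Finsupp.weight wt d).1 • monomial d a := by
    intro d a
    have hw : S.B δ (Finsupp.weight wt d).1 = d.sum fun γ n => (n : ℂ) * S.B δ γ.1 := by
      have := map_finsuppSum ((S.B δ).comp (AddMonoidHom.fst M ℤ)) d (fun γ n => n • wt γ)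
      rw [Finsupp.weight_apply]
      simpa [wt] using this
    rw [Hd, mkDerivation_monomial, hw, Finsupp.sum, Finsupp.sum, Finset.sum_smul, Finset.smul_sum]
    refine Finset.sum_congr rfl fun γ hγ => ?_
    have h1 : Finsupp.single γ 1 ≤ d := by
      rw [Finsupp.single_le_iff]
      exact Nat.one_le_iff_ne_zero.2 (Finsupp.mem_support_iff.1 hγ)
    rw [smul_eq_mul, mul_smul_comm, X, monomial_mul, tsub_add_cancel_of_le h1, smul_monomial,
      smul_monomial, smul_monomial]
    congr 1
    simp only [smul_eq_mul]; ring
  rw [f.as_sum, map_sum, Finset.smul_sum]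
  refine Finset.sum_congr rfl fun d hd => ?_
  rw [hmon, hf (mem_support_iff.1 hd)]

theorem D_comm (hU : Upper R (N : Set M)) {δ : M} (hδ : δ ∈ R.Φ) (V : Set ↥N)
    (hV0 : ∀ γ ∈ V, γ.1 ≠ δ ∧ γ.1 ≠ -δ)
    (hV1 : ∀ γ ∈ V, γ.1 + δ ∈ R.Φ → ∃ η ∈ V, η.1 = γ.1 + δ)
    (hV2 : ∀ γ ∈ V, γ.1 - δ ∈ R.Φ → ∃ η ∈ V, η.1 = γ.1 - δ)
    {f : MvPolynomial ↥N ℂ} (hf : f ∈ supported ℂ V) :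
    S.D N (S.e δ) (S.D N (S.e (-δ)) f) =
      S.D N (S.e (-δ)) (S.D N (S.e δ) f) + S.Hd δ f := by
  have hδ' := R.neg_mem _ hδ
  have h1 : ⁅S.D N (S.e δ), S.D N (S.e (-δ))⁆ f = S.Hd δ f := by
    refine Derivation.eqOn_adjoin (s := X '' V) ?_ hf
    rintro _ ⟨γ, hγ, rfl⟩
    have hn1 : ⁅S.e δ, S.e γ.1⁆ ∈ S.n N := by
      by_cases h : δ + γ.1 ∈ R.Φ
      · obtain ⟨c, _, hc⟩ := S.br_ne δ hδ _ (hU.sub γ.2) h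
        obtain ⟨η, _, he⟩ := hV1 γ hγ (by rw [add_comm]; exact h)
        rw [hc, add_comm, ← he]
        exact Submodule.smul_mem _ _ (S.e_mem_n N η.2)
      · rw [S.br_zero δ hδ _ (hU.sub γ.2) _ h]
        · exact Submodule.zero_mem _
        · intro h'; exact (hV0 γ hγ).2 (by rw [add_comm] at h'; exact eq_neg_of_add_eq_zero_left h')
    have hn2 : ⁅S.e (-δ), S.e γ.1⁆ ∈ S.n N := by
      by_cases h : -δ + γ.1 ∈ R.Φ
      · obtain ⟨c, _, hc⟩ := S.br_ne _ hδ' _ (hU.sub γ.2) h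
        obtain ⟨η, _, he⟩ := hV2 γ hγ (by rw [sub_eq_add_neg, add_comm]; exact h)
        rw [hc, add_comm, ← sub_eq_add_neg, ← he]
        exact Submodule.smul_mem _ _ (S.e_mem_n N η.2)
      · rw [S.br_zero _ hδ' _ (hU.sub γ.2) _ h]
        · exact Submodule.zero_mem _
        · intro h'; exact (hV0 γ hγ).1 (by rw [neg_add_eq_sub, sub_eq_zero] at h'; exact h')
    have hγn := S.e_mem_n N γ.2
    rw [Derivation.commutator_apply, ← S.XX_e hU γ, S.D_XX hU _ hγn, S.D_XX hU _ hγn, map_neg, map_neg,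
      S.D_XX hU _ hn1, S.D_XX hU _ hn2, neg_neg, neg_neg, ← XX_sub]
    have : ⁅S.e δ, ⁅S.e (-δ), S.e γ.1⁆⁆ - ⁅S.e (-δ), ⁅S.e δ, S.e γ.1⁆⁆ = S.B δ γ.1 • S.e γ.1 := by
      rw [← S.t_br _ _ (hU.sub γ.2), ← S.br_t _ hδ, lie_lie]
    rw [this, XX_smul, XX_e S hU, Hd, mkDerivation_X]
  rw [← h1, Derivation.commutator_apply]
  ring

theorem D_supp (hU : Upper R (N : Set M)) {δ : M} (hδ : δ ∈ R.Φ) (V : Set ↥N)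
    (hV : ∀ γ ∈ V, γ.1 + δ ∈ R.Φ → ∃ η ∈ V, η.1 = γ.1 + δ)
    {f : MvPolynomial ↥N ℂ} (hf : f ∈ supported ℂ V) : S.D N (S.e δ) f ∈ supported ℂ V := by
  rw [supported] at hf ⊢
  induction hf using Algebra.adjoin_induction with
  | mem x h =>
    obtain ⟨γ, hγ, rfl⟩ := h
    by_cases hN : γ.1 + δ ∈ N
    · obtain ⟨η, hη, he⟩ := hV γ hγ (hU.sub hN)
      obtain ⟨c, hc⟩ := S.D_e_X hU hδ γ η he.symm
      rw [hc]
      exact mul_mem (Subalgebra.algebraMap_mem _ c) (Algebra.subset_adjoin ⟨η, hη, rfl⟩)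
    · rw [S.D_e_X_zero hU hδ γ hN]; exact zero_mem _
  | algebraMap r => rw [Derivation.map_algebraMap]; exact zero_mem _
  | add a b _ _ ha hb => rw [map_add]; exact add_mem ha hb
  | mul a b ha' hb' ha hb =>
    rw [Derivation.leibniz, smul_eq_mul, smul_eq_mul]
    exact add_mem (mul_mem ha' hb) (mul_mem hb' ha)

theorem weight_ht (hU : Upper R (N : Set M)) (d : ↥N →₀ ℕ) : 0 ≤ R.ht (Finsupp.weight wt d).1 := by
  have := map_finsuppSum (R.ht.comp (AddMonoidHom.fst M ℤ)) d (fun γ n => n • wt γ)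
  rw [Finsupp.weight_apply]
  have h2 : R.ht (d.sum fun γ n => n • wt γ).1 = d.sum fun γ n => (n : ℤ) * R.ht γ.1 := by
    simpa [wt] using this
  rw [h2]
  exact Finset.sum_nonneg fun γ _ => mul_nonneg (by positivity) (hU.pos _ γ.2).le

/-- the `sl₂` argument -/
theorem sl2_nonneg (hU : Upper R (N : Set M)) {δ : M} (hδ : δ ∈ R.Φ) (hp : 0 < R.ht δ) (V : Set ↥N)
    (hV0 : ∀ γ ∈ V, γ.1 ≠ δ ∧ γ.1 ≠ -δ)
    (hV1 : ∀ γ ∈ V, γ.1 + δ ∈ R.Φ → ∃ η ∈ V, η.1 = γ.1 + δ)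
    (hV2 : ∀ γ ∈ V, γ.1 - δ ∈ R.Φ → ∃ η ∈ V, η.1 = γ.1 - δ)
    {f : MvPolynomial ↥N ℂ} {ν : M × ℤ} (hf : IsWeightedHomogeneous wt f ν)
    (hA : f ∈ S.A' N) (h0 : psi V f ≠ 0) (p : ℤ) (hpp : 2 * S.B δ ν.1 = p * S.B δ δ) : 0 ≤ p := by
  by_contra hneg
  push Not at hneg
  have hδ' := R.neg_mem _ hδ
  set v : ℕ → MvPolynomial ↥N ℂ := fun n => (S.D N (S.e (-δ)))^[n] (psi V f) with hv
  have hvs : ∀ n, v (n + 1) = S.D N (S.e (-δ)) (v n) := fun n => Function.iterate_succ_apply' _ _ _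
  have hsupp : ∀ n, v n ∈ supported ℂ V := by
    intro n
    induction n with
    | zero => exact psi_supp V f
    | succ n ih =>
      rw [hvs]
      refine S.D_supp hU hδ' V ?_ ih
      intro γ hγ h
      rw [← sub_eq_add_neg] at h ⊢
      exact hV2 γ hγ h
  have hhom : ∀ n, IsWeightedHomogeneous wt (v n) (ν - ((n : ℤ) • δ, 0)) := by
    intro n
    induction n with
    | zero =>
      have he : ν - (((0 : ℕ) : ℤ) • δ, 0) = ν := by ext <;> simp
      rw [he]; exact psi_homog V hf
    | succ n ih =>
      rw [hvs]
      have := S.D_homog hU hδ' ih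
      have he : ν - ((n:ℤ) • δ, 0) + (-δ, 0) = ν - (((n + 1 : ℕ) : ℤ) • δ, 0) := by
        ext
        · simp [add_smul]; abel
        · simp
      rwa [he] at this
  have hE0 : S.D N (S.e δ) (v 0) = 0 := by
    have := S.D_psi hU hδ V (by
      intro γ η h
      constructor
      · intro hγ
        obtain ⟨η', h1, h2⟩ := hV1 γ hγ (by rw [h]; exact hU.sub η.2)
        rwa [Subtype.ext (h.symm.trans h2.symm)]
      · intro hη
        have h3 : η.1 - δ = γ.1 := by rw [← h]; abel
        obtain ⟨η', h1, h2⟩ := hV2 η hη (by rw [h3]; exact hU.sub γ.2)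
        rwa [Subtype.ext (h3.symm.trans h2.symm)]) f
    rw [show v 0 = psi V f from rfl, this, (S.mem_A').1 hA δ hδ hp, map_zero]
  have hE : ∀ n : ℕ, S.D N (S.e δ) (v (n + 1)) =
      (((n + 1 : ℕ) : ℂ) * ((p : ℂ) - n) / 2 * S.B δ δ) • v n := by
    intro n
    induction n with
    | zero =>
      rw [hvs, S.D_comm hU hδ V hV0 hV1 hV2 (hsupp 0), hE0, map_zero, zero_add, S.Hd_homog δ (hhom 0)]
      congr 1
      simp
      linear_combination hpp / 2
    | succ n ih =>
      rw [hvs, S.D_comm hU hδ V hV0 hV1 hV2 (hsupp _), ih, Derivation.map_smul, ← hvs,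
        S.Hd_homog δ (hhom _), ← add_smul]
      congr 1
      simp
      linear_combination hpp / 2
  have hne : ∀ n, v n ≠ 0 := by
    intro n
    induction n with
    | zero => exact h0
    | succ n ih =>
      intro h
      have := hE n
      rw [h, map_zero] at this
      rcases smul_eq_zero.1 this.symm with h | h
      · have h3 : (p : ℂ) - n ≠ 0 := by
          intro h
          have : (p : ℂ) - n = ((p - n : ℤ) : ℂ) := by push_cast; rfl
          rw [this] at h
          have := Int.cast_eq_zero.1 h
          omega
        have h4 : ((n + 1 : ℕ) : ℂ) ≠ 0 := by exact_mod_cast Nat.succ_ne_zero n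
        exact (mul_ne_zero (div_ne_zero (mul_ne_zero h4 h3) two_ne_zero) (S.B_ne δ hδ)) h
      · exact ih h
  set n := (R.ht ν.1).toNat + 1 with hn
  obtain ⟨d, hd⟩ := MvPolynomial.ne_zero_iff.1 (hne n)
  have h1 := weight_ht hU d
  rw [hhom n hd] at h1
  simp only [Prod.fst_sub, map_sub, map_zsmul, smul_eq_mul] at h1
  have h3 : (n : ℤ) ≤ n * R.ht δ := by nlinarith [Int.natCast_nonneg n]
  omega

end Setup
end CPF

namespace CPF
namespace Setup
open MvPolynomial
variable {L : Type*} [LieRing L] [LieAlgebra ℂ L] {M : Type*} [AddCommGroup M] {R : RS M}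
  (S : Setup L R) {N : Finset M}

theorem weight_map (φ : M →+ ℤ) (d : ↥N →₀ ℕ) :
    φ (Finsupp.weight wt d).1 = d.sum fun γ n => (n : ℤ) * φ γ.1 := by
  have := map_finsuppSum (φ.comp (AddMonoidHom.fst M ℤ)) d (fun γ n => n • wt γ)
  rw [Finsupp.weight_apply]
  simpa [wt] using this

theorem weight_snd (d : ↥N →₀ ℕ) :
    (Finsupp.weight (wt (N := N)) d).2 = d.sum fun _ n => (n : ℤ) := by
  have := map_finsuppSum (AddMonoidHom.snd M ℤ) d (fun γ n => n • wt γ)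
  rw [Finsupp.weight_apply]
  simpa [wt] using this

theorem weight_bb_map (G : Greedy R (N : Set M)) (φ : M →+ ℤ) (m : Fin G.k →₀ ℕ) :
    φ (Finsupp.weight wt (m.mapDomain (bb G))).1 = ∑ i, (m i : ℤ) * φ (G.β i) := by
  rw [weight_map, Finsupp.sum_mapDomain_index (by simp) (by intros; push_cast; ring),
    Finsupp.sum_fintype _ _ (by simp)]
  rfl

theorem weight_bb (G : Greedy R (N : Set M)) (hU : Upper R (N : Set M)) (m : Fin G.k →₀ ℕ)
    (i : Fin G.k) : G.P i (Finsupp.weight wt (m.mapDomain (bb G))).1 = 2 * m i := by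
  rw [weight_bb_map, Finset.sum_eq_single i]
  · rw [G.P_self hU i.2]; ring
  · intro l _ h
    rw [G.P_ne hU i.2 l.2 (fun h' => h (Fin.ext h').symm)]; ring
  · simp

theorem weight_bb_inj (G : Greedy R (N : Set M)) (hU : Upper R (N : Set M)) {m m' : Fin G.k →₀ ℕ}
    (h : Finsupp.weight (wt (N := N)) (m.mapDomain (bb G)) = Finsupp.weight wt (m'.mapDomain (bb G))) :
    m = m' := by
  ext i
  have h1 := weight_bb G hU m i
  rw [h, weight_bb G hU m' i] at h1
  omega

/-- weight vectors: invariants restricting to a monomial -/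
def WV (G : Greedy R (N : Set M)) (f : MvPolynomial ↥N ℂ) (m : Fin G.k →₀ ℕ) : Prop :=
  f ∈ S.A' N ∧ ∃ c : ℂ, c ≠ 0 ∧ rho G f = monomial m c

theorem WV.ne {G : Greedy R (N : Set M)} {f : MvPolynomial ↥N ℂ} {m : Fin G.k →₀ ℕ}
    (h : S.WV G f m) : f ≠ 0 := by
  rintro rfl
  obtain ⟨_, c, hc, h⟩ := h
  rw [map_zero] at h
  exact hc (monomial_eq_zero.1 h.symm)

theorem WV_homog (G : Greedy R (N : Set M)) (hU : Upper R (N : Set M)) {f : MvPolynomial ↥N ℂ}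
    {m : Fin G.k →₀ ℕ} (h : S.WV G f m) :
    IsWeightedHomogeneous wt f (Finsupp.weight (wt (N := N)) (m.mapDomain (bb G))) := by
  obtain ⟨hf, c, hc, h⟩ := h
  set ν := Finsupp.weight (wt (N := N)) (m.mapDomain (bb G)) with hν
  have h1 : f - weightedHomogeneousComponent wt ν f = 0 := by
    refine S.rho_inj G hU (sub_mem hf (S.comp_mem hU hf ν)) ?_
    rw [map_sub, sub_eq_zero]
    ext m'
    rw [rho_coeff G hU (weightedHomogeneousComponent wt ν f), coeff_weightedHomogeneousComponent]
    by_cases hm : m' = m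
    · subst hm; rw [if_pos hν.symm, rho_coeff G hU]
    · rw [if_neg (fun h' => hm (weight_bb_inj G hU h')), h, coeff_monomial, if_neg (Ne.symm hm)]
  rw [sub_eq_zero] at h1
  rw [h1]
  exact weightedHomogeneousComponent_isWeightedHomogeneous (w := wt) ν f

theorem WV_of_homog (G : Greedy R (N : Set M)) (hU : Upper R (N : Set M)) {f : MvPolynomial ↥N ℂ}
    {ν : M × ℤ} (hf : f ∈ S.A' N) (h : IsWeightedHomogeneous wt f ν) (h0 : f ≠ 0) :
    ∃ m, S.WV G f m := by
  have h1 : rho G f ≠ 0 := fun h' => h0 (S.rho_inj G hU hf h')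
  obtain ⟨m, hm⟩ := ne_zero_iff.1 h1
  refine ⟨m, hf, coeff m (rho G f), hm, ?_⟩
  ext m'
  rw [coeff_monomial]
  by_cases hm' : m = m'
  · rw [if_pos hm', hm']
  · rw [if_neg hm']
    by_contra h2
    rw [rho_coeff G hU] at h2 hm
    exact hm' (weight_bb_inj G hU ((h hm).trans (h h2).symm))

theorem WV_mul {G : Greedy R (N : Set M)} {f g : MvPolynomial ↥N ℂ} {m m' : Fin G.k →₀ ℕ}
    (h : S.WV G f m) (h' : S.WV G g m') : S.WV G (f * g) (m + m') := by
  obtain ⟨h1, c, hc, h2⟩ := h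
  obtain ⟨h1', c', hc', h2'⟩ := h'
  exact ⟨mul_mem h1 h1', c * c', mul_ne_zero hc hc', by rw [map_mul, h2, h2', monomial_mul]⟩

theorem WV_one (G : Greedy R (N : Set M)) : S.WV G 1 0 :=
  ⟨one_mem _, 1, one_ne_zero, by rw [map_one]; rfl⟩

theorem WV_pow {G : Greedy R (N : Set M)} {f : MvPolynomial ↥N ℂ} {m : Fin G.k →₀ ℕ}
    (h : S.WV G f m) (n : ℕ) : S.WV G (f ^ n) (n • m) := by
  induction n with
  | zero => rw [pow_zero, zero_smul]; exact S.WV_one G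
  | succ n ih => rw [pow_succ, succ_nsmul]; exact S.WV_mul ih h

theorem WV_prod {G : Greedy R (N : Set M)} {ι : Type*} (s : Finset ι) {f : ι → MvPolynomial ↥N ℂ}
    {m : ι → Fin G.k →₀ ℕ} (h : ∀ i ∈ s, S.WV G (f i) (m i)) :
    S.WV G (∏ i ∈ s, f i) (∑ i ∈ s, m i) := by
  induction s using Finset.induction_on with
  | empty => simpa using S.WV_one G
  | insert a s ha ih =>
    rw [Finset.prod_insert ha, Finset.sum_insert ha]
    exact S.WV_mul (h a (by simp)) (ih fun i hi => h i (by simp [hi]))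

theorem WV_unique (G : Greedy R (N : Set M)) (hU : Upper R (N : Set M)) {f g : MvPolynomial ↥N ℂ}
    {m : Fin G.k →₀ ℕ} (h : S.WV G f m) (h' : S.WV G g m) : ∃ c : ℂ, c ≠ 0 ∧ f = C c * g := by
  obtain ⟨h1, c, hc, h2⟩ := h
  obtain ⟨h1', c', hc', h2'⟩ := h'
  refine ⟨c / c', div_ne_zero hc hc', ?_⟩
  rw [← sub_eq_zero]
  refine S.rho_inj G hU (sub_mem h1 (mul_mem (Subalgebra.algebraMap_mem _ _) h1')) ?_
  rw [map_sub, map_mul, h2, h2', algHom_C, algebraMap_eq, C_mul_monomial, div_mul_cancel₀ _ hc', sub_self]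

theorem WV_zero (G : Greedy R (N : Set M)) (hU : Upper R (N : Set M)) {f : MvPolynomial ↥N ℂ}
    (h : S.WV G f 0) : ∃ c : ℂ, c ≠ 0 ∧ f = C c := by
  obtain ⟨c, hc, h⟩ := S.WV_unique G hU h (S.WV_one G)
  exact ⟨c, hc, by rw [h, mul_one]⟩

theorem WV_factor (G : Greedy R (N : Set M)) (hU : Upper R (N : Set M)) {f g : MvPolynomial ↥N ℂ}
    {m : Fin G.k →₀ ℕ} (h : S.WV G (f * g) m) :
    ∃ m1 m2, S.WV G f m1 ∧ S.WV G g m2 ∧ m = m1 + m2 := by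
  have h0 := WV.ne S h
  obtain ⟨h1, c, hc, h2⟩ := h
  have hf := S.A'_factor hU h1 h0
  have hg := S.A'_factor hU (f := g) (g := f) (by rwa [mul_comm]) (by rwa [mul_comm])
  rw [map_mul] at h2
  have d1 : rho G f ∣ monomial m c := ⟨_, h2.symm⟩
  have d2 : rho G g ∣ monomial m c := ⟨rho G f, by rw [← h2, mul_comm]⟩
  obtain ⟨m1, b1, _, hb1, e1⟩ := (dvd_monomial_iff_exists hc).1 d1
  obtain ⟨m2, b2, _, hb2, e2⟩ := (dvd_monomial_iff_exists hc).1 d2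
  have hb1' : b1 ≠ 0 := by rintro rfl; exact hc (zero_dvd_iff.1 hb1)
  have hb2' : b2 ≠ 0 := by rintro rfl; exact hc (zero_dvd_iff.1 hb2)
  refine ⟨m1, m2, ⟨hf, b1, hb1', e1⟩, ⟨hg, b2, hb2', e2⟩, ?_⟩
  rw [e1, e2, monomial_mul] at h2
  exact (monomial_left_inj hc).1 (by
    have := congrArg (coeff (m1 + m2)) h2
    rw [coeff_monomial, coeff_monomial, if_pos rfl] at this
    by_cases hm : m = m1 + m2
    · rw [hm]
    · rw [if_neg hm] at this; exact absurd this (mul_ne_zero hb1' hb2'))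

theorem WV_mono (G : Greedy R (N : Set M)) (hU : Upper R (N : Set M))
    (hab : ∀ γ η, G.Q γ → G.Q η → γ + η ∉ R.Φ) {f : MvPolynomial ↥N ℂ}
    {m : Fin G.k →₀ ℕ} (h : S.WV G f m) {i l : Fin G.k} (hil : i < l) : m l ≤ m i := by
  obtain ⟨δ, hδ, hp, hi, hl, hr⟩ := G.exists_delta hU hab (i := i) (l := l) hil l.2
  have hom := S.WV_homog G hU h
  obtain ⟨hf, c, hc, hm⟩ := h
  have hδ0 : δ ≠ 0 := by rintro rfl; simp at hp
  have hne : (i : ℕ) ≠ l := fun h => hil.ne (Fin.ext h)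
  let V : Set ↥N := {γ | G.P i γ.1 + G.P l γ.1 = 2 ∨ ∃ r < G.k, r ≠ i ∧ r ≠ l ∧ γ.1 = G.β r}
  have key := S.sl2_nonneg hU hδ hp V ?_ ?_ ?_ hom hf ?_
    (R.p δ (Finsupp.weight (wt (N := N)) (m.mapDomain (bb G))).1) ?_
  · have e1 : R.p δ (G.β i) > 0 := R.pos_symm δ hδ _ (G.mem_Φ hU i.2) (by
      change 0 < G.P i δ; omega)
    have e3 : R.p δ (G.β l) = - R.p δ (G.β i) := by
      have b1 := S.B_p _ hδ _ (G.mem_Φ hU i.2)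
      have b2 := S.B_p _ hδ _ (G.mem_Φ hU l.2)
      have b3 := S.B_p _ (G.mem_Φ hU i.2) _ hδ
      have b4 := S.B_p _ (G.mem_Φ hU l.2) _ hδ
      have hi' : R.p (G.β i) δ = 1 := hi
      have hl' : R.p (G.β l) δ = -1 := hl
      rw [hi'] at b1
      rw [hl', ← S.B_eq G hU hab i.2 l.2] at b2
      rw [← S.B_symm _ hδ _ (G.mem_Φ hU i.2), b1] at b3
      rw [← S.B_symm _ hδ _ (G.mem_Φ hU l.2), b2] at b4
      have hB := S.B_ne _ hδ
      have : ((R.p δ (G.β l) + R.p δ (G.β i) : ℤ) : ℂ) * S.B δ δ = 0 := by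
        push_cast at b3 b4 ⊢; rw [add_mul, ← b3, ← b4]; ring
      have := (mul_eq_zero.1 this).resolve_right hB
      have := Int.cast_eq_zero.1 this
      omega
    rw [weight_bb_map, ← Finset.add_sum_erase _ _ (Finset.mem_univ i),
      ← Finset.add_sum_erase _ _ (Finset.mem_erase.2 ⟨hil.ne', Finset.mem_univ l⟩),
      Finset.sum_eq_zero, e3] at key
    · have : 0 ≤ ((m i : ℤ) - m l) * R.p δ (G.β i) := by linarith
      have := nonneg_of_mul_nonneg_left this e1
      omega
    · intro r hr'
      simp only [Finset.mem_erase, Finset.mem_univ, and_true] at hr'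
      have : G.P r δ = 0 := hr r r.2 (fun h => hr'.2 (Fin.ext h)) (fun h => hr'.1 (Fin.ext h))
      rw [R.zero_symm hδ (G.mem_Φ hU r.2) this, mul_zero]
  · rintro γ hγ
    constructor
    · rintro rfl
      rcases hγ with hγ | ⟨r, hrk, h1, h2, h3⟩
      · omega
      · have := hr r hrk h1 h2
        rw [h3, G.P_self hU hrk] at this; omega
    · intro h'
      have := hU.pos _ γ.2
      rw [h', map_neg] at this; omega
  · rintro γ (hγ | ⟨r, hrk, h1, h2, h3⟩) hs
    · have hsum : G.P i (γ.1 + δ) + G.P l (γ.1 + δ) = 2 := by rw [map_add, map_add]; omega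
      have hq := G.Q_of_pair hU hab hs hil l.2 hsum
      exact ⟨⟨_, by simpa using G.Q_N hU hq⟩, Or.inl hsum, rfl⟩
    · exfalso
      rw [h3] at hs
      have := G.L2 hU hab hs hrk (by rw [map_add, G.P_self hU hrk, hr r hrk h1 h2]; norm_num)
      exact hδ0 (by simpa using this)
  · rintro γ (hγ | ⟨r, hrk, h1, h2, h3⟩) hs
    · have hsum : G.P i (γ.1 - δ) + G.P l (γ.1 - δ) = 2 := by rw [map_sub, map_sub]; omega
      have hq := G.Q_of_pair hU hab hs hil l.2 hsum
      exact ⟨⟨_, by simpa using G.Q_N hU hq⟩, Or.inl hsum, rfl⟩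
    · exfalso
      rw [h3] at hs
      have := G.L2 hU hab hs hrk (by rw [map_sub, G.P_self hU hrk, hr r hrk h1 h2]; norm_num)
      exact hδ0 (by simpa using this)
  · intro h0
    have h1 := congrArg (coeff (m.mapDomain (bb G))) h0
    rw [psi_coeff, if_pos, ← rho_coeff G hU, hm, coeff_monomial, if_pos rfl, coeff_zero] at h1
    · exact hc h1
    · intro γ hγ
      have := Finsupp.mapDomain_support hγ
      rw [Finset.mem_image] at this
      obtain ⟨r, _, rfl⟩ := this
      by_cases hri : r = i
      · left; subst hri
        have e1 := G.P_self hU r.2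
        have e2 := G.P_ne hU l.2 r.2 hne.symm
        simp only [bb]; omega
      by_cases hrl : r = l
      · left; subst hrl
        have e1 := G.P_self hU r.2
        have e2 := G.P_ne hU i.2 r.2 hne
        simp only [bb]; omega
      right
      exact ⟨r, r.2, fun h => hri (Fin.ext h), fun h => hrl (Fin.ext h), rfl⟩
  · -- pairing
    have e : ∀ φ : M →+ ℂ, φ (Finsupp.weight wt (m.mapDomain (bb G))).1 = ∑ i, (m i : ℂ) * φ (G.β i) := by
      intro φ
      have := map_finsuppSum (φ.comp (AddMonoidHom.fst M ℤ)) (m.mapDomain (bb G)) (fun γ n => n • wt γ)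
      rw [Finsupp.weight_apply]
      have h2 : φ ((m.mapDomain (bb G)).sum fun γ n => n • wt γ).1 =
          (m.mapDomain (bb G)).sum fun γ n => (n : ℂ) * φ γ.1 := by simpa [wt] using this
      rw [h2, Finsupp.sum_mapDomain_index (by simp) (by intros; push_cast; ring),
        Finsupp.sum_fintype _ _ (by simp)]
      rfl
    rw [e, weight_bb_map]
    push_cast
    rw [Finset.mul_sum, Finset.sum_mul]
    refine Finset.sum_congr rfl fun r _ => ?_
    have b := S.B_p _ (G.mem_Φ hU r.2) _ hδ
    rw [S.B_symm _ hδ _ (G.mem_Φ hU r.2)]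
    linear_combination (m r : ℂ) * b

end Setup
end CPF

namespace CPF
namespace Setup
open MvPolynomial
variable {L : Type*} [LieRing L] [LieAlgebra ℂ L] {M : Type*} [AddCommGroup M] {R : RS M}
  (S : Setup L R) {N : Finset M}

theorem WV_exp {G : Greedy R (N : Set M)} {f : MvPolynomial ↥N ℂ} {m m' : Fin G.k →₀ ℕ}
    (h : S.WV G f m) (h' : S.WV G f m') : m = m' := by
  obtain ⟨_, c, hc, h2⟩ := h
  obtain ⟨_, c', hc', h2'⟩ := h'
  rw [h2] at h2'
  have := congrArg (coeff m) h2'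
  rw [coeff_monomial, coeff_monomial, if_pos rfl] at this
  by_contra hne
  rw [if_neg (Ne.symm hne)] at this
  exact hc this

/-- indicator of the initial segment up to `j` -/
def seg {k : ℕ} (j : Fin k) : Fin k →₀ ℕ := Finsupp.equivFunOnFinite.symm fun r => if r ≤ j then 1 else 0

theorem seg_apply {k : ℕ} (j r : Fin k) : seg j r = if r ≤ j then 1 else 0 := rfl

/-- an element of `MvPolynomial` as a sum of weight components -/
theorem exists_comp (f : MvPolynomial ↥N ℂ) : ∃ s : Finset (M × ℤ),
    f = ∑ ν ∈ s, weightedHomogeneousComponent wt ν f := by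
  refine ⟨(weightedHomogeneousComponent_finsupp (w := wt (N := N)) f).toFinset, ?_⟩
  conv_lhs => rw [← sum_weightedHomogeneousComponent (wt (N := N)) f]
  exact finsum_eq_sum _ _

theorem exists_mono {c : ↥N → ℂ} {f : MvPolynomial ↥N ℂ} (h : eval c f ≠ 0) :
    ∃ d ∈ f.support, ∀ γ ∈ d.support, c γ ≠ 0 := by
  rw [eval_eq] at h
  obtain ⟨d, hd, h⟩ := Finset.exists_ne_zero_of_sum_ne_zero h
  refine ⟨d, hd, fun γ hγ h0 => right_ne_zero_of_mul h ?_⟩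
  refine Finset.prod_eq_zero hγ ?_
  rw [h0, zero_pow (Finsupp.mem_support_iff.1 hγ)]

/-- the condition on the special point attached to `j` -/
def Good (G : Greedy R (N : Set M)) (j : ℕ) (c : ↥N → ℂ) : Prop :=
  ∀ γ, c γ ≠ 0 → sg G j γ.1 = 2 ∧ (∀ r ≤ j, G.P r γ.1 = G.P (j - r) γ.1) ∧
      ∀ r, j < r → r < G.k → G.P r γ.1 = 0

theorem exists_fj [FiniteDimensional ℂ L] (G : Greedy R (N : Set M)) (hU : Upper R (N : Set M))
    (hab : ∀ γ η, G.Q γ → G.Q η → γ + η ∉ R.Φ) (j : Fin G.k) :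
    ∃ c : ↥N → ℂ, Good G j c ∧ ∃ (f : MvPolynomial ↥N ℂ) (n : ℕ), 1 ≤ n ∧ S.WV G f (n • seg j) ∧
      eval c f ≠ 0 := by
  obtain ⟨c, hc, F, hF, hF0, hFc⟩ := S.exists_F G hU hab j.2
  refine ⟨c, hc, ?_⟩
  obtain ⟨s, hs⟩ := exists_comp F
  rw [hs, map_sum] at hFc
  obtain ⟨ν, _, hν⟩ := Finset.exists_ne_zero_of_sum_ne_zero hFc
  set f := weightedHomogeneousComponent wt ν F with hf
  have hfA : f ∈ S.A' N := S.comp_mem hU hF ν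
  have hf0 : f ≠ 0 := by intro h; rw [h, map_zero] at hν; exact hν rfl
  obtain ⟨m, hm⟩ := S.WV_of_homog G hU hfA
    (weightedHomogeneousComponent_isWeightedHomogeneous (w := wt) ν F) hf0
  have hm0 : m ≠ 0 := by
    rintro rfl
    obtain ⟨a, ha, h⟩ := S.WV_zero G hU hm
    have h1 : coeff 0 f = a := by rw [h, coeff_zero_C]
    rw [hf, coeff_weightedHomogeneousComponent] at h1
    have h2 : coeff 0 F = 0 := by
      rw [← constantCoeff_eq, ← eval_zero]; exact hF0
    rw [h2, ite_self] at h1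
    exact ha h1.symm
  obtain ⟨d, hd, hdc⟩ := exists_mono hν
  have hw := S.WV_homog G hU hm (mem_support_iff.1 hd)
  have hP : ∀ r : Fin G.k, (2 * m r : ℤ) = d.sum fun γ n => (n : ℤ) * G.P r γ.1 := by
    intro r
    rw [← weight_bb G hU, ← hw, weight_map]
  have hsym : ∀ r : Fin G.k, r ≤ j → m r = m ⟨j - r, by omega⟩ := by
    intro r hr
    have h1 := hP r
    have h2 := hP ⟨j - r, by omega⟩
    have : (d.sum fun γ n => (n : ℤ) * G.P r γ.1) = d.sum fun γ n => (n : ℤ) * G.P (j - r : ℕ) γ.1 :=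
      Finset.sum_congr rfl fun γ hγ => by
        simp only
        rw [(hc γ (hdc γ hγ)).2.1 r (by exact_mod_cast hr)]
    simp only at h2
    omega
  have hzero : ∀ r : Fin G.k, j < r → m r = 0 := by
    intro r hr
    have h1 := hP r
    have : (d.sum fun γ n => (n : ℤ) * G.P r γ.1) = 0 :=
      Finset.sum_eq_zero fun γ hγ => by
        simp only
        rw [(hc γ (hdc γ hγ)).2.2 r (by exact_mod_cast hr) r.2, mul_zero]
    omega
  have hanti : ∀ i l : Fin G.k, i ≤ l → m l ≤ m i := by
    intro i l h
    rcases h.lt_or_eq with h | h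
    · exact S.WV_mono G hU hab hm h
    · rw [h]
  have hcon : ∀ r : Fin G.k, r ≤ j → m r = m j := by
    intro r hr
    have h1 := hanti r j hr
    have h2 := hsym j le_rfl
    have h3 := hanti ⟨j - j, by omega⟩ r (by rw [Fin.le_def]; simp)
    omega
  have heq : m = m j • seg j := by
    ext r
    rw [Finsupp.smul_apply, seg_apply]
    by_cases hr : r ≤ j
    · rw [if_pos hr, hcon r hr]; simp
    · rw [if_neg hr, hzero r (not_le.1 hr)]; simp
  refine ⟨f, m j, ?_, heq ▸ hm, hν⟩
  by_contra h
  have : m j = 0 := by omega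
  rw [this, zero_smul] at heq
  exact hm0 heq

theorem exists_p [FiniteDimensional ℂ L] (G : Greedy R (N : Set M)) (hU : Upper R (N : Set M))
    (hab : ∀ γ η, G.Q γ → G.Q η → γ + η ∉ R.Φ) (j : Fin G.k) :
    ∃ (p : MvPolynomial ↥N ℂ) (n : ℕ) (c : ↥N → ℂ), 1 ≤ n ∧ S.WV G p (n • seg j) ∧
      Irreducible p ∧ Good G j c ∧ eval c p ≠ 0 := by
  obtain ⟨c, hc, f, n', hn', hf, hfc⟩ := S.exists_fj G hU hab j
  have hex : ∃ n, 1 ≤ n ∧ ∃ p, S.WV G p (n • seg j) := ⟨n', hn', f, hf⟩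
  let n := Nat.find hex
  obtain ⟨hn, p, hp⟩ : 1 ≤ n ∧ ∃ p, S.WV G p (n • seg j) := Nat.find_spec hex
  have hmin : ∀ q, 1 ≤ q → q < n → ∀ g, ¬ S.WV G g (q • seg j) := fun q hq hqn g hg =>
    Nat.find_min hex hqn ⟨hq, g, hg⟩
  refine ⟨p, n, c, hn, hp, ⟨?_, ?_⟩, hc, ?_⟩
  · intro hu
    obtain ⟨q, hq⟩ := hu.exists_right_inv
    obtain ⟨m1, m2, h1, h2, h3⟩ := S.WV_factor G hU (f := p) (g := q) (m := 0) (hq ▸ S.WV_one G)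
    rw [S.WV_exp h1 hp] at h3
    have := DFunLike.congr_fun h3 j
    simp [seg_apply] at this
    omega
  · intro a b hab'
    obtain ⟨m1, m2, h1, h2, h3⟩ := S.WV_factor G hU (f := a) (g := b) (hab' ▸ hp)
    have h3' : ∀ r, n * (if r ≤ j then 1 else 0) = m1 r + m2 r := fun r => by
      have := DFunLike.congr_fun h3 r
      simpa [seg_apply] using this
    have key : ∀ {g g' : MvPolynomial ↥N ℂ} {m m' : Fin G.k →₀ ℕ}, S.WV G g m → S.WV G g' m' →
        (∀ r, n * (if r ≤ j then 1 else 0) = m r + m' r) → m = m j • seg j := by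
      intro g g' m m' h h' h3
      ext r
      rw [Finsupp.smul_apply, seg_apply]
      have e1 := h3 r
      have e2 := h3 j
      by_cases hr : r ≤ j
      · rw [if_pos hr] at e1 ⊢
        rw [if_pos le_rfl] at e2
        rcases hr.lt_or_eq with hr | hr
        · have := S.WV_mono G hU hab h hr
          have := S.WV_mono G hU hab h' hr
          simp; omega
        · simp [hr]
      · rw [if_neg hr] at e1 ⊢
        simp; omega
    have k1 := key h1 h2 h3'
    have k2 := key h2 h1 (fun r => by rw [h3' r, add_comm])
    have e2 := h3' j
    rw [if_pos le_rfl] at e2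
    by_cases z1 : m1 j = 0
    · left
      rw [z1, zero_smul] at k1
      rw [k1] at h1
      obtain ⟨e, he, h⟩ := S.WV_zero G hU h1
      rw [h]; exact (isUnit_iff_ne_zero.2 he).map C
    by_cases z2 : m2 j = 0
    · right
      rw [z2, zero_smul] at k2
      rw [k2] at h2
      obtain ⟨e, he, h⟩ := S.WV_zero G hU h2
      rw [h]; exact (isUnit_iff_ne_zero.2 he).map C
    exfalso
    rw [k1] at h1
    exact hmin (m1 j) (by omega) (by omega) a h1
  · intro h0
    have h1 := S.WV_pow hp n'
    have h2 := S.WV_pow hf n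
    rw [smul_comm] at h2
    obtain ⟨e, he, h⟩ := S.WV_unique G hU h2 h1
    have := congrArg (eval c) h
    rw [map_pow, map_mul, map_pow, h0, zero_pow (by omega), mul_zero] at this
    exact hfc (pow_eq_zero_iff (by omega) |>.1 this)

theorem anti_decomp {k : ℕ} (s : ℕ) : ∀ m : Fin k →₀ ℕ, (∀ i l : Fin k, i < l → m l ≤ m i) →
    (∑ i, m i) = s → ∃ a : Fin k → ℕ, m = ∑ j, a j • seg j := by
  induction s using Nat.strong_induction_on with
  | _ s ih =>
    intro m hm hs
    by_cases h0 : m = 0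
    · exact ⟨0, by simp [h0]⟩
    have hne : (Finset.univ.filter fun i => m i ≠ 0).Nonempty := by
      obtain ⟨i, hi⟩ := DFunLike.ne_iff.1 h0
      exact ⟨i, by simpa using hi⟩
    obtain ⟨j, hj, hmax⟩ := Finset.exists_max_image _ (fun i : Fin k => i) hne
    simp only [Finset.mem_filter, Finset.mem_univ, true_and] at hj hmax
    have hle : ∀ i : Fin k, i ≤ j → 1 ≤ m i := by
      intro i hi
      rcases hi.lt_or_eq with h | h
      · have := hm i j h; omega
      · rw [h]; omega
    have hgt : ∀ i : Fin k, ¬ i ≤ j → m i = 0 := by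
      intro i hi
      by_contra h; exact hi (hmax i h)
    have hval : ∀ i, (m - seg j) i + seg j i = m i := by
      intro i
      rw [Finsupp.tsub_apply, seg_apply]
      by_cases h : i ≤ j
      · rw [if_pos h]; have := hle i h; omega
      · rw [if_neg h]; omega
    have hlt : ∑ i, (m - seg j) i < s := by
      rw [← hs]
      refine Finset.sum_lt_sum (fun i _ => by have := hval i; omega) ⟨j, Finset.mem_univ _, ?_⟩
      have := hval j
      rw [seg_apply, if_pos le_rfl] at this
      omega
    obtain ⟨a, ha⟩ := ih _ hlt (m - seg j) (by
      intro i l hil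
      have h1 := hval i
      have h2 := hval l
      rw [seg_apply] at h1 h2
      have h3 := hm i l hil
      by_cases hl : l ≤ j
      · rw [if_pos hl] at h2; rw [if_pos (hil.le.trans hl)] at h1; omega
      · have h4 := hgt l hl; rw [if_neg hl] at h2; omega) rfl
    refine ⟨fun i => a i + if i = j then 1 else 0, ?_⟩
    have h1 : m = (m - seg j) + seg j := by ext i; rw [Finsupp.add_apply]; exact (hval i).symm
    rw [h1, ha]
    simp only [add_smul, Finset.sum_add_distrib, ite_smul, one_smul, zero_smul]
    simp

theorem gen (G : Greedy R (N : Set M)) (hU : Upper R (N : Set M))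
    (hab : ∀ γ η, G.Q γ → G.Q η → γ + η ∉ R.Φ) (p : Fin G.k → MvPolynomial ↥N ℂ) (n : Fin G.k → ℕ)
    (hn : ∀ j, 1 ≤ n j) (hp : ∀ j, S.WV G (p j) (n j • seg j)) (hirr : ∀ j, Irreducible (p j)) (s : ℕ) :
    ∀ (f : MvPolynomial ↥N ℂ) (m : Fin G.k →₀ ℕ), S.WV G f m → (∑ i, m i) = s →
      f ∈ Algebra.adjoin ℂ (Set.range p) := by
  induction s using Nat.strong_induction_on with
  | _ s ih =>
    intro f m hf hs
    obtain ⟨a, ha⟩ := anti_decomp _ m (fun i l h => S.WV_mono G hU hab hf h) hs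
    by_cases ha0 : ∀ j, a j = 0
    · have : m = 0 := by rw [ha]; simp [ha0]
      rw [this] at hf
      obtain ⟨c, _, h⟩ := S.WV_zero G hU hf
      rw [h]; exact Subalgebra.algebraMap_mem _ _
    push Not at ha0
    obtain ⟨j, hj⟩ := ha0
    have h1 := S.WV_pow hf (∏ l, n l)
    have h2 := S.WV_prod Finset.univ (fun l _ => S.WV_pow (hp l) (a l * ∏ i ∈ Finset.univ.erase l, n i))
    have heq : (∏ l, n l) • m = ∑ l, (a l * ∏ i ∈ Finset.univ.erase l, n i) • n l • seg l := by
      conv_lhs => rw [ha]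
      rw [Finset.smul_sum]
      refine Finset.sum_congr rfl fun l _ => ?_
      rw [smul_smul, smul_smul, ← Finset.mul_prod_erase _ _ (Finset.mem_univ l)]
      congr 1; ring
    rw [← heq] at h2
    obtain ⟨c, hc, h⟩ := S.WV_unique G hU h1 h2
    have hdvd : p j ∣ f ^ (∏ l, n l) := by
      rw [h]
      refine Dvd.dvd.mul_left (Dvd.dvd.trans ?_ (Finset.dvd_prod_of_mem _ (Finset.mem_univ j))) _
      refine dvd_pow_self _ (mul_ne_zero hj (Finset.prod_ne_zero_iff.2 fun l _ => ?_))
      have := hn l; omega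
    obtain ⟨g, hg⟩ := (hirr j).prime.dvd_of_dvd_pow hdvd
    obtain ⟨m1, m2, w1, w2, w3⟩ := S.WV_factor G hU (hg ▸ hf)
    rw [hg]
    refine mul_mem (Algebra.subset_adjoin ⟨j, rfl⟩) (ih (∑ i, m2 i) ?_ g m2 w2 rfl)
    rw [← hs, w3, S.WV_exp w1 (hp j)]
    refine Finset.sum_lt_sum (fun i _ => by simp) ⟨j, Finset.mem_univ _, ?_⟩
    have := hn j
    simp [seg_apply]; omega

theorem A'_eq_adjoin (G : Greedy R (N : Set M)) (hU : Upper R (N : Set M))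
    (hab : ∀ γ η, G.Q γ → G.Q η → γ + η ∉ R.Φ) (p : Fin G.k → MvPolynomial ↥N ℂ) (n : Fin G.k → ℕ)
    (hn : ∀ j, 1 ≤ n j) (hp : ∀ j, S.WV G (p j) (n j • seg j)) (hirr : ∀ j, Irreducible (p j)) :
    S.A' N = Algebra.adjoin ℂ (Set.range p) := by
  apply le_antisymm
  · intro f hf
    obtain ⟨s, hs⟩ := exists_comp f
    rw [hs]
    refine sum_mem fun ν _ => ?_
    by_cases h0 : weightedHomogeneousComponent wt ν f = 0
    · rw [h0]; exact zero_mem _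
    obtain ⟨m, hm⟩ := S.WV_of_homog G hU (S.comp_mem hU hf ν)
      (weightedHomogeneousComponent_isWeightedHomogeneous (w := wt) ν f) h0
    exact S.gen G hU hab p n hn hp hirr _ _ m hm rfl
  · rw [Algebra.adjoin_le_iff]
    rintro _ ⟨j, rfl⟩
    exact (hp j).1

end Setup
end CPF

namespace CPF
namespace Setup
open MvPolynomial
variable {L : Type*} [LieRing L] [LieAlgebra ℂ L] {M : Type*} [AddCommGroup M] {R : RS M}
  (S : Setup L R) {N : Finset M}

/-- the grading used for the leading monomials -/
def ph (G : Greedy R (N : Set M)) : M →+ ℤ := ∑ r ∈ Finset.range G.k, r • G.P r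

theorem ph_apply (G : Greedy R (N : Set M)) (γ : M) :
    ph G γ = ∑ r ∈ Finset.range G.k, (r : ℤ) * G.P r γ := by
  simp [ph]

theorem ph_good (G : Greedy R (N : Set M)) {j : ℕ} (hj : j < G.k) {c : ↥N → ℂ} (hc : Good G j c)
    (γ : ↥N) (h : c γ ≠ 0) : ph G γ.1 = j := by
  obtain ⟨h1, h2, h3⟩ := hc γ h
  have e1 : ph G γ.1 = ∑ r ∈ Finset.range (j + 1), (r : ℤ) * G.P r γ.1 := by
    rw [ph_apply]
    symm
    refine Finset.sum_subset (by intro r; simp; omega) fun r hr hr' => ?_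
    simp only [Finset.mem_range] at hr hr'
    rw [h3 r (by omega) hr, mul_zero]
  have e2 : ph G γ.1 = ∑ r ∈ Finset.range (j + 1), ((j : ℤ) - r) * G.P r γ.1 := by
    rw [e1, ← Finset.sum_range_reflect]
    refine Finset.sum_congr rfl fun r hr => ?_
    have hr' : r ≤ j := by simpa [Nat.lt_succ_iff] using hr
    have : j + 1 - 1 - r = j - r := by omega
    rw [this, ← h2 r hr', Nat.cast_sub hr']
  have e3 : ph G γ.1 + ph G γ.1 = j * sg G j γ.1 := by
    rw [sg_apply, Finset.mul_sum]
    nth_rewrite 1 [e1]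
    rw [e2, ← Finset.sum_add_distrib]
    refine Finset.sum_congr rfl fun r _ => by ring
  rw [h1] at e3
  omega

theorem ph_beta (G : Greedy R (N : Set M)) (hU : Upper R (N : Set M)) (i : Fin G.k) :
    ph G (G.β i) = 2 * i := by
  rw [ph_apply, Finset.sum_eq_single (i : ℕ)]
  · rw [show G.P i (G.β i) = 2 from G.P_self hU i.2]; ring
  · intro r hr h
    rw [G.P_ne hU (by simpa using hr) i.2 h, mul_zero]
  · intro h; exact absurd (Finset.mem_range.2 i.2) h

theorem seg_sum {k : ℕ} (j : Fin k) (g : ℕ → ℤ) (n : ℕ) :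
    ∑ i, (((n • seg j) i : ℕ) : ℤ) * g i = n * ∑ r ∈ Finset.range (j + 1), g r := by
  have h1 : ∑ i : Fin k, (((n • seg j) i : ℕ) : ℤ) * g i =
      ∑ r ∈ Finset.range k, if r ≤ j then (n : ℤ) * g r else 0 := by
    rw [← Fin.sum_univ_eq_sum_range (fun r => if r ≤ j then (n : ℤ) * g r else 0)]
    refine Finset.sum_congr rfl fun i _ => ?_
    rw [Finsupp.smul_apply, seg_apply]
    by_cases h : i ≤ j
    · rw [if_pos h, if_pos (by exact_mod_cast h)]; simp
    · rw [if_neg h, if_neg (by exact_mod_cast h)]; simp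
  rw [h1, ← Finset.sum_filter, Finset.mul_sum]
  refine Finset.sum_congr ?_ fun _ _ => rfl
  ext r; simp; have := j.2; omega

theorem free_A' [FiniteDimensional ℂ L] (G : Greedy R (N : Set M)) (hU : Upper R (N : Set M))
    (hab : ∀ γ η, G.Q γ → G.Q η → γ + η ∉ R.Φ) :
    Module.Free (S.A' N) (MvPolynomial ↥N ℂ) := by
  choose p n c hn hp hirr hc hpc using S.exists_p G hU hab
  letI : LinearOrder ↥N := linearOrderOfSTO (WellOrderingRel (α := ↥N))
  obtain ⟨Bd, hBd⟩ : ∃ Bd : ℕ, ∀ γ : ↥N, (ph G γ.1).natAbs ^ 2 ≤ Bd :=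
    ⟨∑ γ : ↥N, (ph G γ.1).natAbs ^ 2, fun γ =>
      Finset.single_le_sum (f := fun γ : ↥N => (ph G γ.1).natAbs ^ 2) (fun _ _ => Nat.zero_le _)
        (Finset.mem_univ γ)⟩
  let w : (↥N →₀ ℕ) →+ ℕ := Finsupp.weight fun γ : ↥N => Bd - (ph G γ.1).natAbs ^ 2
  -- the two linear identities
  have hcount : ∀ j, ∀ d ∈ (p j).support, (d.sum fun _ n => (n : ℤ)) = n j * (j + 1) := by
    intro j d hd
    have h1 := S.WV_homog G hU (hp j) (mem_support_iff.1 hd)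
    rw [← weight_snd, h1, weight_snd,
      Finsupp.sum_mapDomain_index (by simp) (by intros; push_cast; ring),
      Finsupp.sum_fintype _ _ (by simp)]
    have := seg_sum j (fun _ => 1) (n j)
    simpa using this
  have hphi : ∀ j, ∀ d ∈ (p j).support, (d.sum fun γ n => (n : ℤ) * ph G γ.1) = j * (n j * (j + 1)) := by
    intro j d hd
    have h1 := S.WV_homog G hU (hp j) (mem_support_iff.1 hd)
    rw [← weight_map, h1, weight_bb_map]
    simp only [ph_beta G hU]
    rw [seg_sum j (fun r => 2 * (r : ℤ)) (n j)]
    have h2 : ∀ q : ℕ, ∑ r ∈ Finset.range (q + 1), 2 * (r : ℤ) = q * (q + 1) := by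
      intro q
      induction q with
      | zero => simp
      | succ q ih => rw [Finset.sum_range_succ, ih]; push_cast; ring
    rw [h2]; ring
  have hw : ∀ j, ∀ d ∈ (p j).support, ((w d : ℕ) : ℤ) = (Bd - (j : ℤ) ^ 2) * (n j * (j + 1)) -
      d.sum fun γ n => (n : ℤ) * (ph G γ.1 - j) ^ 2 := by
    intro j d hd
    have e1 : ((w d : ℕ) : ℤ) = d.sum fun γ n => (n : ℤ) * (Bd - (ph G γ.1) ^ 2) := by
      simp only [w, Finsupp.weight_apply, Finsupp.sum]
      rw [Nat.cast_sum]
      refine Finset.sum_congr rfl fun γ _ => ?_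
      rw [smul_eq_mul, Nat.cast_mul, Nat.cast_sub (hBd γ), Nat.cast_pow, Int.natCast_natAbs, sq_abs]
    have c1 := hcount j d hd
    have c2 := hphi j d hd
    rw [e1, ← c1]
    have : (d.sum fun γ n => (n : ℤ) * (Bd - (ph G γ.1) ^ 2)) +
        (d.sum fun γ n => (n : ℤ) * (ph G γ.1 - j) ^ 2) =
        (Bd + (j : ℤ) ^ 2) * (d.sum fun _ n => (n : ℤ)) -
          2 * j * (d.sum fun γ n => (n : ℤ) * ph G γ.1) := by
      simp only [Finsupp.sum, Finset.mul_sum]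
      rw [← Finset.sum_add_distrib, ← Finset.sum_sub_distrib]
      exact Finset.sum_congr rfl fun γ _ => by ring
    rw [c2, ← c1] at this
    linear_combination this
  have hp0 : ∀ j, p j ≠ 0 := fun j => WV.ne S (hp j)
  have hdeg : ∀ j, (wOrder w).degree (p j) ∈ (p j).support := fun j =>
    (wOrder w).degree_mem_support (hp0 j)
  have hlead : ∀ j, ∀ γ ∈ ((wOrder w).degree (p j)).support, ph G γ.1 = (j : ℤ) := by
    intro j
    obtain ⟨d, hd, hdc⟩ := exists_mono (hpc j)
    have h1 := wOrder_le w ((wOrder w).le_degree hd)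
    have h2 := hw j d hd
    have h3 := hw j _ (hdeg j)
    have h4 : (d.sum fun γ n => (n : ℤ) * (ph G γ.1 - j) ^ 2) = 0 :=
      Finset.sum_eq_zero fun γ hγ => by
        simp only
        rw [ph_good G j.2 (hc j) γ (hdc γ hγ)]; ring
    have h5 : (((wOrder w).degree (p j)).sum fun γ n => (n : ℤ) * (ph G γ.1 - j) ^ 2) ≤ 0 := by
      have : ((w d : ℕ) : ℤ) ≤ (w ((wOrder w).degree (p j)) : ℕ) := by exact_mod_cast h1
      linarith
    intro γ hγ
    have h6 := (Finset.sum_eq_zero_iff_of_nonneg (fun γ _ => by positivity)).1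
      (le_antisymm h5 (Finset.sum_nonneg fun γ _ => by positivity)) γ hγ
    simp only [mul_eq_zero, Nat.cast_eq_zero] at h6
    have := pow_eq_zero_iff (two_ne_zero) |>.1 (h6.resolve_left (Finsupp.mem_support_iff.1 hγ))
    omega
  refine free_of_leading (wOrder w) p ?_ ?_ _ (S.A'_eq_adjoin G hU hab p n hn hp hirr)
  · intro j h0
    have := hcount j _ (hdeg j)
    rw [h0] at this
    have h1 := hn j
    simp at this
    omega
  · intro i j hij
    rw [Finset.disjoint_left]
    intro γ h1 h2
    have := (hlead i γ h1).symm.trans (hlead j γ h2)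
    exact hij (Fin.ext (by exact_mod_cast this))

end Setup
end CPF

namespace CPF

/-- an additive map to `ℂ` with integer values, as a map to `ℤ` -/
def intHom {M : Type*} [AddCommGroup M] (f : M →+ ℂ) (h : ∀ x, ∃ n : ℤ, f x = n) : M →+ ℤ where
  toFun x := (h x).choose
  map_zero' := by
    have h1 := (h 0).choose_spec
    have h2 := h1.symm.trans (map_zero f)
    exact_mod_cast h2
  map_add' x y := by
    have h1 := (h (x + y)).choose_spec
    have h2 := (h x).choose_spec
    have h3 := (h y).choose_spec
    have h4 := h1.symm.trans ((map_add f x y).trans (congrArg₂ (· + ·) h2 h3))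
    exact_mod_cast h4

theorem intHom_cast {M : Type*} [AddCommGroup M] (f : M →+ ℂ) (h : ∀ x, ∃ n : ℤ, f x = n) (x : M) :
    ((intHom f h x : ℤ) : ℂ) = f x := (h x).choose_spec.symm

section Cartan
open LieAlgebra.IsKilling LieModule
variable {L : Type*} [LieRing L] [LieAlgebra ℂ L] [FiniteDimensional ℂ L] [IsKilling ℂ L]
  (H : LieSubalgebra ℂ L) [H.IsCartanSubalgebra] (h : H)

/-- the lattice of functionals which are integral on coroots and on `h` -/
def Lat : AddSubgroup (Dual ℂ H) where
  carrier := {x | (∀ α : Weight ℂ H L, α.IsNonZero → ∃ n : ℤ, x (coroot α) = n) ∧ ∃ n : ℤ, x h = n}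
  zero_mem' := ⟨fun α _ => ⟨0, by simp⟩, 0, by simp⟩
  add_mem' := by
    rintro x y ⟨h1, n, h2⟩ ⟨h3, m, h4⟩
    refine ⟨fun α ha => ?_, n + m, by simp [h2, h4]⟩
    obtain ⟨a, ha1⟩ := h1 α ha
    obtain ⟨b, hb1⟩ := h3 α ha
    exact ⟨a + b, by simp [ha1, hb1]⟩
  neg_mem' := by
    rintro x ⟨h1, n, h2⟩
    refine ⟨fun α ha => ?_, -n, by simp [h2]⟩
    obtain ⟨a, ha1⟩ := h1 α ha
    exact ⟨-a, by simp [ha1]⟩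

/-- the roots in the lattice -/
def LatR : Set (Lat H h) := {x | ∃ α : Weight ℂ H L, α.IsNonZero ∧ x.1 = α.toLinear}

/-- evaluation at a vector as an additive map -/
def LatEv (x : H) : Lat H h →+ ℂ :=
  (LinearMap.applyₗ (R := ℂ) (M := H) (M₂ := ℂ) x).toAddMonoidHom.comp (Lat H h).subtype

@[simp] theorem LatEv_apply (x : H) (m : Lat H h) : LatEv H h x m = m.1 x := rfl

/-- pairing with the coroot -/
def Latp (m : Lat H h) : Lat H h →+ ℤ :=
  if hm : ∃ α : Weight ℂ H L, α.IsNonZero ∧ m.1 = α.toLinear then intHom (LatEv H h (coroot hm.choose))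
    (fun x => x.2.1 _ hm.choose_spec.1) else 0

theorem Latp_cast {m : Lat H h} {α : Weight ℂ H L} (ha : α.IsNonZero) (hm : m.1 = α.toLinear)
    (x : Lat H h) : ((Latp H h m x : ℤ) : ℂ) = x.1 (coroot α) := by
  have hm' : ∃ α : Weight ℂ H L, α.IsNonZero ∧ m.1 = α.toLinear := ⟨α, ha, hm⟩
  have h1 : hm'.choose = α := by
    have := hm.symm.trans hm'.choose_spec.2
    ext y
    exact (LinearMap.congr_fun this y).symm
  rw [Latp, dif_pos hm']
  refine (intHom_cast _ _ x).trans ?_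
  rw [LatEv_apply, h1]

/-- height -/
def Latht : Lat H h →+ ℤ := intHom (LatEv H h h) (fun x => x.2.2)

theorem Latht_cast (x : Lat H h) : ((Latht H h x : ℤ) : ℂ) = x.1 h := intHom_cast _ _ _

variable {H}

theorem mem_Lat (α : Weight ℂ H L) {n : ℤ} (hn : α h = n) : (α.toLinear : Dual ℂ H) ∈ Lat H h := by
  exact ⟨fun β _ => ⟨_, apply_coroot_eq_cast β α⟩, n, hn⟩

/-- the lattice element of a sum of functions that is a weight -/
theorem weight_of_ne_bot {f : H → ℂ} (hf : rootSpace H f ≠ ⊥) :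
    ∃ α : Weight ℂ H L, (α : H → ℂ) = f := ⟨⟨f, hf⟩, rfl⟩

theorem latR_of {x : Lat H h} (hx : x ≠ 0) (α : Weight ℂ H L) (ha : (α : H → ℂ) = x.1) :
    x ∈ LatR H h := by
  refine ⟨α, ?_, ?_⟩
  · intro h0
    apply hx
    apply Subtype.ext
    ext y
    have h1 := congrFun ha y
    have h2 := congrFun h0 y
    simp only [Pi.zero_apply] at h2
    rw [← h1, h2]; rfl
  · ext y
    exact (congrFun ha y).symm

theorem coe_eq_of {x : Lat H h} {α : Weight ℂ H L} (hx : x.1 = α.toLinear) : (x.1 : H → ℂ) = α := by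
  rw [hx]; rfl

theorem Latp_pos_symm {a b : Lat H h} (ha : a ∈ LatR H h) (hb : b ∈ LatR H h)
    (hp : 0 < Latp H h b a) : 0 < Latp H h a b := by
  obtain ⟨α, ha1, ha2⟩ := ha
  obtain ⟨β, hb1, hb2⟩ := hb
  have h1 := Latp_cast H h hb1 hb2 a
  have h2 := Latp_cast H h ha1 ha2 b
  let i : H.root := ⟨α, by simpa using ha1⟩
  let j : H.root := ⟨β, by simpa using hb1⟩
  have e1 : (rootSystem H).pairingIn ℤ i j = Latp H h b a := by
    have := (rootSystem H).algebraMap_pairingIn ℤ i j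
    rw [rootSystem_pairing_apply] at this
    rw [ha2] at h1
    rw [eq_intCast] at this
    exact_mod_cast this.trans h1.symm
  have e2 : (rootSystem H).pairingIn ℤ j i = Latp H h a b := by
    have := (rootSystem H).algebraMap_pairingIn ℤ j i
    rw [rootSystem_pairing_apply] at this
    rw [hb2] at h2
    rw [eq_intCast] at this
    exact_mod_cast this.trans h2.symm
  rw [← e2]
  rw [← e1] at hp
  exact ((rootSystem H).zero_lt_pairingIn_iff' ℤ).mp hp

theorem Latp_sub_mem {a b : Lat H h} (ha : a ∈ LatR H h) (hb : b ∈ LatR H h)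
    (hp : 0 < Latp H h b a) (hne : a ≠ b) : a - b ∈ LatR H h := by
  obtain ⟨α, ha1, ha2⟩ := ha
  obtain ⟨β, hb1, hb2⟩ := hb
  have h1 := Latp_cast H h hb1 hb2 a
  rw [ha2] at h1
  have h2 := apply_coroot_eq_cast β α
  have h3 : Latp H h b a = ((chainBotCoeff β α : ℕ) : ℤ) - (chainTopCoeff β α : ℕ) := by
    exact_mod_cast h1.trans h2
  have h4 : rootSpace H ((-1 : ℤ) • (β : H → ℂ) + α) ≠ ⊥ := by
    rw [rootSpace_zsmul_add_ne_bot_iff β α hb1]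
    lia
  obtain ⟨γ, hγ⟩ := weight_of_ne_bot h4
  refine latR_of h (sub_ne_zero.mpr hne) γ ?_
  rw [hγ]
  ext y
  have e1 := congrFun (coe_eq_of h ha2) y
  have e2 := congrFun (coe_eq_of h hb2) y
  simp [← e1, ← e2]
  ring

variable (H)

/-- the abstract root system of a Cartan subalgebra with a regular integral element -/
def LatRS [LieAlgebra.IsSimple ℂ L] (hh : ∀ α : Weight ℂ H L, α.IsNonZero → ∃ n : ℤ, n ≠ 0 ∧ α h = n) :
    RS (Lat H h) where
  Φ := LatR H h
  p := Latp H h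
  ht := Latht H h
  neg_mem := by
    rintro a ⟨α, ha1, ha2⟩
    exact ⟨-α, by simpa using ha1, by ext y; simp [ha2]⟩
  p_self := by
    rintro a ⟨α, ha1, ha2⟩
    have h1 := Latp_cast H h ha1 ha2 a
    have h2 := root_apply_coroot ha1
    rw [ha2] at h1
    exact_mod_cast h1.trans h2
  p_neg := by
    rintro b ⟨β, hb1, hb2⟩ x
    have h1 := Latp_cast H h hb1 hb2 x
    have h2 := Latp_cast H h (m := -b) (α := -β) (by simpa using hb1) (by ext y; simp [hb2]) x
    rw [coroot_neg, map_neg, ← h1] at h2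
    exact_mod_cast h2
  refl_mem := by
    rintro a ⟨α, ha1, ha2⟩ b ⟨β, hb1, hb2⟩
    have h1 := Latp_cast H h hb1 hb2 a
    refine ⟨reflectRoot β α, reflectRoot_isNonZero _ _ ha1, ?_⟩
    ext y
    rw [ha2] at h1
    change a.1 y - ((Latp H h b a • b : Lat H h) : Dual ℂ H) y = α y - α (coroot β) * β y
    rw [AddSubgroupClass.coe_zsmul, LinearMap.smul_apply, zsmul_eq_mul, h1, ha2, hb2]
    rfl
  pos_symm a ha b hb hp := Latp_pos_symm h ha hb hp
  sub_mem a ha b hb hp hne := Latp_sub_mem h ha hb hp hne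
  ht_ne := by
    rintro a ⟨α, ha1, ha2⟩ h0
    obtain ⟨n, hn, hn'⟩ := hh α ha1
    have := Latht_cast H h a
    rw [h0, ha2] at this
    apply hn
    have h3 : (α.toLinear : Dual ℂ H) h = α h := rfl
    rw [h3, hn'] at this
    exact_mod_cast this.symm
  irr := by
    intro X hX ⟨a0, ha0⟩ horth
    let s : Set H.root := {i | ∃ a ∈ X, a.1 = (i.1).toLinear}
    have hs : s.Nonempty := by
      obtain ⟨α, ha1, ha2⟩ := hX ha0
      exact ⟨⟨α, by simpa using ha1⟩, a0, ha0, ha2⟩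
    have key : ∀ i ∈ s, ∀ j : H.root, j ∉ s → (rootSystem H).IsOrthogonal j i := by
      intro i ⟨a, haX, ha⟩ j hj
      have hj1 : (j.1 : Weight ℂ H L).IsNonZero := H.isNonZero_coe_root j
      have hi1 : (i.1 : Weight ℂ H L).IsNonZero := H.isNonZero_coe_root i
      obtain ⟨n, hn⟩ := hh j.1 hj1
      let b : Lat H h := ⟨j.1.toLinear, mem_Lat h j.1 hn.2⟩
      have hb : b ∉ X := fun hb => hj ⟨b, hb, rfl⟩
      have h0 := horth a haX b ⟨j.1, hj1, rfl⟩ hb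
      have h1 := Latp_cast H h hi1 ha b
      rw [h0] at h1
      have h2 : (rootSystem H).pairing j i = 0 := by
        rw [rootSystem_pairing_apply]
        have : ((j.1 : Weight ℂ H L).toLinear : Dual ℂ H) (coroot i.1) = 0 := by rw [← h1]; simp [b]
        exact this
      exact ⟨h2, ((rootSystem H).pairing_eq_zero_iff).mp h2⟩
    have htop := (rootSystem H).span_root_image_eq_top_of_forall_orthogonal s hs
      (fun j hj i hi => key i hi j (fun hjs => hj (Submodule.subset_span ⟨j, hjs, rfl⟩)))
    apply Set.Subset.antisymm hX
    rintro b ⟨β, hb1, hb2⟩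
    let j : H.root := ⟨β, by simpa using hb1⟩
    by_contra hb
    have hj : j ∉ s := by
      rintro ⟨a, ha, hab⟩
      apply hb
      have : a = b := Subtype.ext (hab.trans hb2.symm)
      rwa [← this]
    have h3 : Submodule.span ℂ ((rootSystem H).root '' s) ≤
        LinearMap.ker (LinearMap.applyₗ (R := ℂ) (M := H) (M₂ := ℂ) (coroot β)) := by
      rw [Submodule.span_le]
      rintro _ ⟨i, hi, rfl⟩
      have := (key i hi j hj).2
      rw [rootSystem_pairing_apply] at this
      exact this
    rw [htop] at h3
    have h4 : (β.toLinear : Dual ℂ H) ∈ LinearMap.ker (LinearMap.applyₗ (R := ℂ) (M := H) (M₂ := ℂ) (coroot β)) :=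
      h3 trivial
    have h5 : β (coroot β) = 0 := h4
    rw [root_apply_coroot hb1] at h5
    norm_num at h5

end Cartan
end CPF

namespace CPF

section Cartan
open LieAlgebra.IsKilling LieModule
variable {L : Type*} [LieRing L] [LieAlgebra ℂ L] [FiniteDimensional ℂ L] [IsKilling ℂ L]
  {H : LieSubalgebra ℂ L} [H.IsCartanSubalgebra] (h : H)

theorem exists_dual_pair (α : Weight ℂ H L) :
    ∃ x ∈ rootSpace H α, ∃ y ∈ rootSpace H (-α : H → ℂ), killingForm ℂ L x y = 1 := by
  obtain ⟨x, hx, hx0⟩ := α.exists_ne_zero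
  by_contra! hcon
  apply hx0
  have := mem_ker_killingForm_of_mem_rootSpace_of_forall_rootSpace_neg ℂ L H hx (fun y hy => by
    by_contra hne
    refine hcon x hx ((killingForm ℂ L x y)⁻¹ • y) (Submodule.smul_mem _ _ hy) ?_
    rw [map_smul, smul_eq_mul, inv_mul_cancel₀ hne])
  rw [ker_killingForm_eq_bot] at this
  exact this

theorem killingForm_symm (x y : L) : killingForm ℂ L x y = killingForm ℂ L y x :=
  LieModule.traceForm_comm ℂ L L x y

/-- nonvanishing of brackets of root spaces -/
theorem bracket_ne_zero {α β γ : Weight ℂ H L} (ha : α.IsNonZero) (hb : β.IsNonZero)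
    (hγ : (γ : H → ℂ) = α + β) {x y : L} (hx : x ∈ rootSpace H α) (hy : y ∈ rootSpace H β)
    (hx0 : x ≠ 0) (hy0 : y ≠ 0) : ⁅x, y⁆ ≠ 0 := by
  obtain ⟨z, hz, z_ne0⟩ := (chainTop α β).exists_ne_zero
  obtain ⟨h, e, f, isSl2, he, hf⟩ := exists_isSl2Triple_of_weight_isNonZero ha
  obtain rfl := isSl2.h_eq_coroot ha he hf
  have prim : isSl2.HasPrimitiveVectorWith z (chainLength α β : ℂ) :=
    have := lie_mem_genWeightSpace_of_mem_genWeightSpace he hz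
    ⟨z_ne0, (chainLength_smul _ _ hz).symm, by rwa [genWeightSpace_add_chainTop _ _ ha] at this⟩
  have h1 : rootSpace H ((1 : ℤ) • (α : H → ℂ) + β) ≠ ⊥ := by
    rw [one_smul, ← hγ]; exact γ.2
  rw [rootSpace_zsmul_add_ne_bot_iff α β ha] at h1
  obtain ⟨n, hn⟩ : ∃ n, chainTopCoeff α β = n + 1 := ⟨chainTopCoeff α β - 1, by omega⟩
  have hle := chainTopCoeff_le_chainLength α β
  have hmem := toEnd_pow_apply_mem hf hz (n + 1)
  have hne := prim.pow_toEnd_f_ne_zero_of_eq_nat rfl (i := n + 1) (by omega)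
  have hne' := prim.pow_toEnd_f_ne_zero_of_eq_nat rfl (i := n) (by omega)
  have hbr := prim.lie_e_pow_succ_toEnd_f n
  have hwt : (n + 1) • (-α : H → ℂ) + (chainTop α β : H → ℂ) = β := by
    rw [coe_chainTop, hn]
    ext t
    simp
  rw [hwt] at hmem
  have d1 := finrank_rootSpace_eq_one α ha
  have d2 := finrank_rootSpace_eq_one β hb
  set w : L := ((toEnd ℂ L L) f ^ (n + 1)) z with hw
  obtain ⟨a, hae⟩ := (finrank_eq_one_iff_of_nonzero' (⟨x, hx⟩ : rootSpace H α)
    (by simpa using hx0)).mp d1 ⟨e, he⟩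
  obtain ⟨b, hbe⟩ := (finrank_eq_one_iff_of_nonzero' (⟨y, hy⟩ : rootSpace H β)
    (by simpa using hy0)).mp d2 ⟨w, hmem⟩
  have hae' : a • x = e := congrArg Subtype.val hae
  have hbe' : b • y = w := congrArg Subtype.val hbe
  intro h0
  rw [← hae', ← hbe', smul_lie, lie_smul, h0, smul_zero, smul_zero] at hbr
  have := smul_ne_zero (r := ((n : ℂ) + 1) * ((chainLength α β : ℂ) - n)) (by
    refine mul_ne_zero (by exact_mod_cast Nat.succ_ne_zero n) ?_
    rw [sub_ne_zero]
    exact_mod_cast (by omega : chainLength α β ≠ n)) hne'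
  exact this hbr.symm

/-- a normalised choice of root vectors -/
theorem exists_rootVectors
    (hh : ∀ α : Weight ℂ H L, α.IsNonZero → ∃ n : ℤ, n ≠ 0 ∧ α h = n) :
    ∃ e : Lat H h → L, ∀ m ∈ LatR H h, e m ∈ rootSpace H (m.1 : H → ℂ) ∧
      killingForm ℂ L (e m) (e (-m)) = 1 := by
  have hX : ∀ m : Lat H h, ∃ x y : L, m ∈ LatR H h →
      x ∈ rootSpace H (m.1 : H → ℂ) ∧ y ∈ rootSpace H (-m.1 : H → ℂ) ∧
        killingForm ℂ L x y = 1 := by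
    intro m
    by_cases hm : m ∈ LatR H h
    · obtain ⟨α, ha1, ha2⟩ := hm
      obtain ⟨x, hx, y, hy, hxy⟩ := exists_dual_pair α
      rw [coe_eq_of h ha2]
      exact ⟨x, y, fun _ => ⟨hx, hy, hxy⟩⟩
    · exact ⟨0, 0, fun h => absurd h hm⟩
  choose X Y hXY using hX
  have hneg : ∀ m ∈ LatR H h, -m ∈ LatR H h := by
    rintro a ⟨α, ha1, ha2⟩
    exact ⟨-α, by simpa using ha1, by ext y; simp [ha2]⟩
  refine ⟨fun m => if 0 < Latht H h m then X m else Y (-m), fun m hm => ?_⟩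
  have hmn := hneg m hm
  have hne : Latht H h m ≠ 0 := by
    obtain ⟨α, ha1, ha2⟩ := hm
    intro h0
    obtain ⟨n, hn, hn'⟩ := hh α ha1
    have := Latht_cast H h m
    rw [h0, ha2] at this
    have h3 : (α.toLinear : Dual ℂ H) h = α h := rfl
    rw [h3, hn'] at this
    exact hn (by exact_mod_cast this.symm)
  obtain ⟨h1, h2, h3⟩ := hXY m hm
  obtain ⟨h4, h5, h6⟩ := hXY (-m) hmn
  by_cases hp : 0 < Latht H h m
  · have hp' : ¬ 0 < Latht H h (-m) := by rw [map_neg]; omega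
    simp only [hp, hp', if_true, if_false, neg_neg]
    exact ⟨h1, h3⟩
  · have hp' : 0 < Latht H h (-m) := by rw [map_neg]; omega
    simp only [hp, hp', if_true, if_false]
    refine ⟨?_, ?_⟩
    · have : (-((-m : Lat H h) : Dual ℂ H) : H → ℂ) = (m.1 : H → ℂ) := by ext t; simp
      rwa [this] at h5
    · rw [killingForm_symm]; exact h6

theorem ad_h_of_mem {m : Lat H h} {x : L} (hx : x ∈ rootSpace H (m.1 : H → ℂ)) :
    ⁅(h : L), x⁆ = (Latht H h m : ℂ) • x := by
  have := lie_eq_smul_of_mem_rootSpace hx h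
  rw [Latht_cast]
  exact this

/-- nilpotency from a grading element -/
theorem nilp_aux (hh : ∀ α : Weight ℂ H L, α.IsNonZero → ∃ n : ℤ, n ≠ 0 ∧ α h = n)
    (P : Set L) (hP : ∀ x ∈ P, ∃ n : ℤ, 0 < n ∧ ⁅(h : L), x⁆ = (n : ℂ) • x)
    (x : L) (hx : x ∈ Submodule.span ℂ P) : (ad ℂ L x) ^ (finrank ℂ L + 1) = 0 := by
  let W : ℤ → Submodule ℂ L := fun k => Submodule.span ℂ {y | ∃ n : ℤ, k ≤ n ∧ ⁅(h : L), y⁆ = (n : ℂ) • y}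
  have hraise : ∀ x ∈ Submodule.span ℂ P, ∀ k, ∀ y ∈ W k, ⁅x, y⁆ ∈ W (k + 1) := by
    intro x hx k y hy
    induction hx using Submodule.span_induction with
    | mem x hx =>
      obtain ⟨n, hn, hnx⟩ := hP x hx
      induction hy using Submodule.span_induction with
      | mem y hy =>
        obtain ⟨m, hm, hmy⟩ := hy
        refine Submodule.subset_span ⟨n + m, by omega, ?_⟩
        rw [leibniz_lie, hnx, hmy, smul_lie, lie_smul, ← add_smul]
        push_cast; rfl
      | zero => simp
      | add a b _ _ ha hb => rw [lie_add]; exact add_mem ha hb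
      | smul c a _ ha => rw [lie_smul]; exact Submodule.smul_mem _ _ ha
    | zero => simp
    | add a b _ _ ha hb => rw [add_lie]; exact add_mem ha hb
    | smul c a _ ha => rw [smul_lie]; exact Submodule.smul_mem _ _ ha
  -- each weight vector is an eigenvector
  have hfin : (Set.range fun α : Weight ℂ H L => α).Finite := Set.toFinite _
  obtain ⟨Bd, hBd⟩ : ∃ Bd : ℕ, ∀ α : Weight ℂ H L, ∃ n : ℤ, -(Bd : ℤ) ≤ n ∧ n ≤ Bd ∧ α h = n := by
    have : ∀ α : Weight ℂ H L, ∃ n : ℤ, α h = n := by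
      intro α
      by_cases ha : α.IsNonZero
      · obtain ⟨n, -, hn⟩ := hh α ha; exact ⟨n, hn⟩
      · have : (α : H → ℂ) = 0 := by simpa [Weight.IsNonZero] using ha
        exact ⟨0, by rw [this]; simp⟩
    choose f hf using this
    refine ⟨∑ α : Weight ℂ H L, (f α).natAbs, fun α => ⟨f α, ?_, ?_, hf α⟩⟩
    all_goals
      have := Finset.single_le_sum (f := fun α : Weight ℂ H L => (f α).natAbs)
        (fun _ _ => Nat.zero_le _) (Finset.mem_univ α)
      omega
  have hall : ∀ y : L, y ∈ W (-(Bd : ℤ)) := by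
    intro y
    have hy : y ∈ ⨆ α : Weight ℂ H L, (rootSpace H α : LieSubmodule ℂ H L) := by
      rw [iSup_genWeightSpace_eq_top' ℂ H L]; trivial
    have hle : (⨆ α : Weight ℂ H L, (rootSpace H α : LieSubmodule ℂ H L)).toSubmodule ≤ W (-(Bd : ℤ)) := by
      rw [LieSubmodule.iSup_toSubmodule]
      refine iSup_le fun α x hx => ?_
      obtain ⟨n, h1, h2, h3⟩ := hBd α
      refine Submodule.subset_span ⟨n, h1, ?_⟩
      rw [← h3]
      exact lie_eq_smul_of_mem_rootSpace hx h
    exact hle hy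
  have hlast : W (Bd + 1) = ⊥ := by
    rw [Submodule.span_eq_bot]
    rintro y ⟨n, hn, hy⟩
    by_contra hy0
    -- n is an eigenvalue of ad h; expand in weight spaces
    have hev : (ad ℂ L (h : L)).HasEigenvalue (n : ℂ) :=
      Module.End.hasEigenvalue_of_hasEigenvector (x := y)
        ⟨Module.End.mem_eigenspace_iff.mpr hy, hy0⟩
    have hprod : ∀ z : L, (∏ k ∈ Finset.Icc (-(Bd : ℤ)) Bd,
        ((Polynomial.X : Polynomial ℂ) - Polynomial.C (k : ℂ))).aeval (ad ℂ L (h : L)) z = 0 := by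
      intro z
      have hz : z ∈ ⨆ α : Weight ℂ H L, (rootSpace H α : LieSubmodule ℂ H L) := by
        rw [iSup_genWeightSpace_eq_top' ℂ H L]; trivial
      have hle : (⨆ α : Weight ℂ H L, (rootSpace H α : LieSubmodule ℂ H L)).toSubmodule ≤
          LinearMap.ker ((∏ k ∈ Finset.Icc (-(Bd : ℤ)) Bd,
        ((Polynomial.X : Polynomial ℂ) - Polynomial.C (k : ℂ))).aeval (ad ℂ L (h : L))) := by
        rw [LieSubmodule.iSup_toSubmodule]
        refine iSup_le fun α x hx => ?_
        obtain ⟨n, h1, h2, h3⟩ := hBd α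
        rw [LinearMap.mem_ker]
        have hx' : x ∈ (ad ℂ L (h : L)).eigenspace (n : ℂ) := by
          rw [Module.End.mem_eigenspace_iff, ← h3]
          exact lie_eq_smul_of_mem_rootSpace hx h
        rw [Module.End.mem_eigenspace_iff] at hx'
        rw [← Finset.prod_erase_mul _ _ (Finset.mem_Icc.mpr ⟨h1, h2⟩), map_mul, Module.End.mul_apply]
        have : (Polynomial.aeval (ad ℂ L (h : L))) ((Polynomial.X : Polynomial ℂ) - Polynomial.C (n : ℂ)) x = 0 := by
          rw [map_sub, Polynomial.aeval_X, Polynomial.aeval_C, LinearMap.sub_apply, hx',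
            Module.algebraMap_end_apply, sub_self]
        rw [this, map_zero]
      exact hle hz
    have h1 := Module.End.aeval_apply_of_hasEigenvector (f := ad ℂ L (h : L)) (x := y)
      (p := ∏ k ∈ Finset.Icc (-(Bd : ℤ)) Bd, ((Polynomial.X : Polynomial ℂ) - Polynomial.C (k : ℂ)))
      (⟨Module.End.mem_eigenspace_iff.mpr hy, hy0⟩ : (ad ℂ L (h : L)).HasEigenvector (n : ℂ) y)
    rw [hprod, Polynomial.eval_prod] at h1
    rcases smul_eq_zero.mp h1.symm with h2 | h2
    · rw [Finset.prod_eq_zero_iff] at h2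
      obtain ⟨k, hk, hk2⟩ := h2
      rw [Finset.mem_Icc] at hk
      rw [Polynomial.eval_sub, Polynomial.eval_X, Polynomial.eval_C, sub_eq_zero] at hk2
      have : n = k := by exact_mod_cast hk2
      omega
    · exact hy0 h2
  have hpow : ∀ j : ℕ, ∀ y : L, ((ad ℂ L x) ^ j) y ∈ W (-(Bd : ℤ) + j) := by
    intro j
    induction j with
    | zero => intro y; simpa using hall y
    | succ j ih =>
      intro y
      rw [pow_succ', Module.End.mul_apply]
      have := hraise x hx _ _ (ih y)
      rw [ad_apply]
      convert this using 2
      push_cast; ring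
  have hnil : IsNilpotent (ad ℂ L x) := by
    refine ⟨2 * Bd + 1, LinearMap.ext fun y => ?_⟩
    have := hpow (2 * Bd + 1) y
    have e : -(Bd : ℤ) + ((2 * Bd + 1 : ℕ) : ℤ) = Bd + 1 := by push_cast; ring
    rw [e, hlast] at this
    exact this
  have h2 := Module.End.ker_pow_le_ker_pow_finrank (ad ℂ L x) hnil.choose
  rw [hnil.choose_spec] at h2
  refine LinearMap.ext fun y => ?_
  rw [pow_succ, Module.End.mul_apply]
  have : (ad ℂ L x) y ∈ LinearMap.ker (ad ℂ L x ^ finrank ℂ L) := h2 (by simp)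
  exact this

/-- the additive map to the Cartan subalgebra -/
def LatT : Lat H h →+ L :=
  (H.toSubmodule.subtype.comp (cartanEquivDual (K := ℂ) (L := L) H).symm.toLinearMap).toAddMonoidHom.comp
    (Lat H h).subtype

theorem LatT_apply (m : Lat H h) : LatT h m = (((cartanEquivDual (K := ℂ) (L := L) H).symm m.1 : H) : L) := rfl

/-- the bilinear form on the lattice -/
def LatB : Lat H h →+ Lat H h →+ ℂ where
  toFun m := LatEv H h ((cartanEquivDual (K := ℂ) (L := L) H).symm m.1)
  map_zero' := by ext x; simp
  map_add' a b := by ext x; simp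

theorem LatB_apply (m l : Lat H h) :
    LatB h m l = l.1 ((cartanEquivDual (K := ℂ) (L := L) H).symm m.1) := rfl

theorem LatB_symm (m l : Lat H h) : LatB h m l = LatB h l m := by
  rw [LatB_apply, LatB_apply]
  set a := (cartanEquivDual (K := ℂ) (L := L) H).symm m.1 with ha
  set b := (cartanEquivDual (K := ℂ) (L := L) H).symm l.1 with hb
  have h1 : m.1 = cartanEquivDual (K := ℂ) (L := L) H a := by simp [ha]
  have h2 : l.1 = cartanEquivDual (K := ℂ) (L := L) H b := by simp [hb]
  rw [h1, h2]
  exact LieModule.traceForm_comm ℂ H L b a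

theorem rootVec_ne {e : Lat H h → L} (he : ∀ m ∈ LatR H h, e m ∈ rootSpace H (m.1 : H → ℂ) ∧
      killingForm ℂ L (e m) (e (-m)) = 1) {m : Lat H h} (hm : m ∈ LatR H h) : e m ≠ 0 := by
  intro h0
  have := (he m hm).2
  rw [h0] at this
  simp at this

theorem add_coe_ne {l m : Lat H h} (h0 : l + m ≠ 0) : (l.1 : H → ℂ) + (m.1 : H → ℂ) ≠ 0 := by
  intro hc
  apply h0
  apply Subtype.ext
  ext y
  exact congrFun hc y

theorem rootVec_bracket {e : Lat H h → L} (he : ∀ m ∈ LatR H h, e m ∈ rootSpace H (m.1 : H → ℂ) ∧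
      killingForm ℂ L (e m) (e (-m)) = 1) {l m : Lat H h} (hl : l ∈ LatR H h) (hm : m ∈ LatR H h) :
    ⁅e l, e m⁆ ∈ rootSpace H (((l + m : Lat H h).1 : Dual ℂ H) : H → ℂ) := by
  have := lie_mem_genWeightSpace_of_mem_genWeightSpace (he l hl).1 (he m hm).1
  exact this

/-- the setup attached to a Cartan subalgebra with a regular integral element -/
def LatSetup [LieAlgebra.IsSimple ℂ L]
    (hh : ∀ α : Weight ℂ H L, α.IsNonZero → ∃ n : ℤ, n ≠ 0 ∧ α h = n)
    (e : Lat H h → L) (he : ∀ m ∈ LatR H h, e m ∈ rootSpace H (m.1 : H → ℂ) ∧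
      killingForm ℂ L (e m) (e (-m)) = 1) : Setup L (LatRS H h hh) where
  e := e
  t := LatT h
  B := LatB h
  kill l hl m hm := by
    split_ifs with h0
    · rw [← neg_eq_of_add_eq_zero_right h0]; exact (he l hl).2
    · exact killingForm_apply_eq_zero_of_mem_rootSpace_of_add_ne_zero ℂ L H (he l hl).1 (he m hm).1
        (add_coe_ne h h0)
  kill_t m l hl := by
    have h1 : LatT h m ∈ rootSpace H (0 : H → ℂ) := by
      rw [rootSpace_zero_eq]
      exact ((cartanEquivDual (K := ℂ) (L := L) H).symm m.1).2
    refine killingForm_apply_eq_zero_of_mem_rootSpace_of_add_ne_zero ℂ L H h1 (he l hl).1 ?_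
    rw [zero_add]
    intro h0
    obtain ⟨α, ha1, ha2⟩ := hl
    rw [coe_eq_of h ha2] at h0
    exact ha1 h0
  br_zero l hl m hm h0 hn := by
    have h1 := rootVec_bracket h he hl hm
    by_contra hne
    refine hn (latR_of h h0 ⟨(((l + m : Lat H h).1 : Dual ℂ H) : H → ℂ), fun hb => ?_⟩ rfl)
    rw [rootSpace, hb] at h1
    exact hne h1
  br_ne l hl m hm hlm := by
    have h1 := rootVec_bracket h he hl hm
    have h2 := (he _ hlm).1
    have h3 := rootVec_ne h he hlm
    obtain ⟨α, ha1, ha2⟩ := hl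
    obtain ⟨β, hb1, hb2⟩ := hm
    obtain ⟨γ, hc1, hc2⟩ := hlm
    have hγ := coe_eq_of h hc2
    have hs : (γ : H → ℂ) = α + β := by
      rw [← hγ, ← coe_eq_of h ha2, ← coe_eq_of h hb2]; rfl
    have ha3 := (he l ⟨α, ha1, ha2⟩).1
    have hb3 := (he m ⟨β, hb1, hb2⟩).1
    rw [coe_eq_of h ha2] at ha3
    rw [coe_eq_of h hb2] at hb3
    have h4 := bracket_ne_zero ha1 hb1 hs ha3 hb3 (rootVec_ne h he ⟨α, ha1, ha2⟩)
      (rootVec_ne h he ⟨β, hb1, hb2⟩)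
    rw [hγ] at h1 h2
    have d := finrank_rootSpace_eq_one γ hc1
    obtain ⟨c, hc⟩ := (finrank_eq_one_iff_of_nonzero' (⟨e (l + m), h2⟩ : rootSpace H γ)
      (by simpa using h3)).mp d ⟨_, h1⟩
    have hc' : c • e (l + m) = ⁅e l, e m⁆ := congrArg Subtype.val hc
    refine ⟨c, ?_, hc'.symm⟩
    rintro rfl
    rw [zero_smul] at hc'
    exact h4 hc'.symm
  br_t l hl := by
    have hl' := hl
    have hn : -l ∈ LatR H h := (LatRS H h hh).neg_mem l hl
    obtain ⟨α, ha1, ha2⟩ := hl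
    have h1 := (he l hl').1
    have h2 := (he _ hn).1
    rw [coe_eq_of h ha2] at h1
    have e1 : (((-l : Lat H h).1 : Dual ℂ H) : H → ℂ) = -α := by
      rw [← coe_eq_of h ha2]; rfl
    rw [e1] at h2
    rw [lie_eq_killingForm_smul_of_mem_rootSpace_of_mem_rootSpace_neg h1 h2, (he l hl').2, one_smul,
      LatT_apply, ha2]
  t_br m l hl := lie_eq_smul_of_mem_rootSpace (he l hl).1 _
  B_symm l _ m _ := LatB_symm h l m
  B_p l hl m hm := by
    obtain ⟨β, hb1, hb2⟩ := hm
    change 2 * LatB h l m = (Latp H h m l : ℂ) * LatB h m m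
    have h0 : LatB h m m = β ((cartanEquivDual (K := ℂ) (L := L) H).symm β.toLinear) := by
      rw [LatB_apply, hb2]; rfl
    have hne := root_apply_cartanEquivDual_symm_ne_zero hb1
    rw [Latp_cast H h hb1 hb2 l, LatB_symm, coroot, LatB_apply h m l, hb2, h0, map_nsmul, map_smul]
    simp only [smul_eq_mul, nsmul_eq_mul]
    field_simp
    push_cast
    ring
  B_ne l hl := by
    obtain ⟨β, hb1, hb2⟩ := hl
    have hne := root_apply_cartanEquivDual_symm_ne_zero hb1
    rw [LatB_apply, hb2]
    exact hne
  nilp x hx := by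
    refine nilp_aux h hh _ ?_ x hx
    rintro _ ⟨a, ⟨ha, hp⟩, rfl⟩
    exact ⟨Latht H h a, hp, ad_h_of_mem h (he a ha).1⟩

end Cartan
end CPF

namespace CPF

section TD
variable {L : Type*} [LieRing L] [LieAlgebra ℂ L]
  {SR : Type*} [Fintype SR] [DecidableEq SR] (td : TriangularData L SR)

theorem td_indep : iSupIndep td.rs := by
  rw [← iSupIndep_ne_bot]
  have h1 := td.isInternal.submodule_iSupIndep
  let f : {γ : SR → ℤ // td.rs γ ≠ ⊥} → {γ : SR → ℤ // γ = 0 ∨ γ ∈ td.R} := fun γ =>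
    ⟨γ.1, by
      by_contra hc
      push Not at hc
      exact γ.2 (td.rs_bot γ.1 hc.1 hc.2)⟩
  have hf : Function.Injective f := fun a b hab =>
    Subtype.ext (congrArg (fun z : {γ : SR → ℤ // γ = 0 ∨ γ ∈ td.R} => z.1) hab)
  exact h1.comp hf

theorem td_top : ⨆ γ, td.rs γ = ⊤ := by
  rw [eq_top_iff, ← td.isInternal.submodule_iSup_eq_top]
  exact iSup_le fun γ => le_iSup td.rs γ.1

theorem td_induction {p : L → Prop} (h0 : p 0) (hadd : ∀ x y, p x → p y → p (x + y))
    (hm : ∀ γ, ∀ x ∈ td.rs γ, p x) (x : L) : p x := by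
  have hx : x ∈ ⨆ γ, td.rs γ := by rw [td_top]; trivial
  exact Submodule.iSup_induction td.rs (motive := p) hx hm h0 hadd

theorem td_disj (S : Set (SR → ℤ)) : Disjoint (⨆ γ ∈ S, td.rs γ) (⨆ γ ∈ Sᶜ, td.rs γ) :=
  (td_indep td).disjoint_biSup_biSup disjoint_compl_right

theorem td_proj_of_mem {S : Set (SR → ℤ)} {x : L} (hx : x ∈ ⨆ γ ∈ S, td.rs γ) :
    td.proj S x = x := by
  have h1 := sub_mem hx (td.proj_mem S x)
  have := (Submodule.disjoint_def.mp (td_disj td S)) _ h1 (td.proj_compl S x)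
  exact (sub_eq_zero.mp this).symm

theorem td_proj_of_compl {S : Set (SR → ℤ)} {x : L} (hx : x ∈ ⨆ γ ∈ Sᶜ, td.rs γ) :
    td.proj S x = 0 := by
  have h1 := sub_mem hx (td.proj_compl S x)
  rw [sub_sub_cancel] at h1
  exact (Submodule.disjoint_def.mp (td_disj td S)) _ (td.proj_mem S x) h1

theorem td_mem_bi {S : Set (SR → ℤ)} {γ : SR → ℤ} (hγ : γ ∈ S) : td.rs γ ≤ ⨆ γ ∈ S, td.rs γ :=
  le_biSup td.rs hγ

theorem td_proj_in {S : Set (SR → ℤ)} {γ : SR → ℤ} (hγ : γ ∈ S) {x : L} (hx : x ∈ td.rs γ) :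
    td.proj S x = x := td_proj_of_mem td (td_mem_bi td hγ hx)

theorem td_proj_out {S : Set (SR → ℤ)} {γ : SR → ℤ} (hγ : γ ∉ S) {x : L} (hx : x ∈ td.rs γ) :
    td.proj S x = 0 := td_proj_of_compl td (td_mem_bi td (S := Sᶜ) hγ hx)

/-- the diagonal map attached to an additive function -/
def td_D (φ : (SR → ℤ) →+ ℂ) : L →ₗ[ℂ] L := ∑ γ ∈ insert 0 td.R, φ γ • td.proj {γ}

theorem td_D_apply (φ : (SR → ℤ) →+ ℂ) {γ : SR → ℤ} {x : L} (hx : x ∈ td.rs γ) :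
    td_D td φ x = φ γ • x := by
  rw [td_D, LinearMap.sum_apply]
  by_cases hγ : γ ∈ insert 0 td.R
  · rw [Finset.sum_eq_single_of_mem γ hγ]
    · rw [LinearMap.smul_apply, td_proj_in td (Set.mem_singleton γ) hx]
    · intro δ _ hne
      rw [LinearMap.smul_apply, td_proj_out td (S := {δ}) (fun h => hne h.symm) hx, smul_zero]
  · rw [Finset.mem_insert, not_or] at hγ
    rw [td.rs_bot γ hγ.1 hγ.2, Submodule.mem_bot] at hx
    subst hx
    simp

theorem td_sum_proj (x : L) : ∑ γ ∈ insert 0 td.R, td.proj {γ} x = x := by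
  induction x using td_induction td with
  | h0 => simp
  | hadd x y hx hy =>
    simp only [map_add, Finset.sum_add_distrib]
    rw [hx, hy]
  | hm γ x hx =>
    by_cases hγ : γ ∈ insert 0 td.R
    · rw [Finset.sum_eq_single_of_mem γ hγ]
      · rw [td_proj_in td (Set.mem_singleton γ) hx]
      · intro δ _ hne
        rw [td_proj_out td (S := {δ}) (fun h => hne h.symm) hx]
    · rw [Finset.mem_insert, not_or] at hγ
      rw [td.rs_bot γ hγ.1 hγ.2, Submodule.mem_bot] at hx
      subst hx
      simp

theorem td_proj_D (φ : (SR → ℤ) →+ ℂ) (γ : SR → ℤ) (x : L) :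
    td.proj {γ} (td_D td φ x) = φ γ • td.proj {γ} x := by
  induction x using td_induction td with
  | h0 => simp
  | hadd x y hx hy => simp only [map_add, smul_add, hx, hy]
  | hm δ x hx =>
    rw [td_D_apply td φ hx, map_smul]
    by_cases h : δ = γ
    · subst h; rfl
    · rw [td_proj_out td (S := {γ}) h hx, smul_zero, smul_zero]

/-- the derivation -/
def td_der (φ : (SR → ℤ) →+ ℂ) : LieDerivation ℂ L L where
  toLinearMap := td_D td φ
  leibniz' := by
    intro a b
    induction a using td_induction td with
    | h0 => simp
    | hadd x y hx hy =>
      simp only [add_lie, map_add, lie_add, hx, hy]; abel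
    | hm γ x hx =>
      induction b using td_induction td with
      | h0 => simp
      | hadd y z hy hz => simp only [add_lie, map_add, lie_add, hy, hz]; abel
      | hm δ y hy =>
        rw [td_D_apply td φ hx, td_D_apply td φ hy, td_D_apply td φ (td.bracket_mem _ _ _ hx _ hy),
          map_add, lie_smul, lie_smul, ← lie_skew x y, add_smul, smul_neg, smul_neg]
        abel

variable [FiniteDimensional ℂ L] [IsKilling ℂ L]

theorem td_exists_h (φ : (SR → ℤ) →+ ℂ) : ∃ h : L, ∀ x, ⁅h, x⁆ = td_D td φ x := by
  obtain ⟨h, hh⟩ := LieDerivation.IsKilling.exists_eq_ad (td_der td φ)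
  refine ⟨h, fun x => ?_⟩
  have := congrArg (fun D : LieDerivation ℂ L L => D x) hh
  rw [LieDerivation.ad_apply_apply] at this
  exact this

/-- coordinate sum -/
def td_ht : (SR → ℤ) →+ ℤ := ∑ a : SR, Pi.evalAddMonoidHom (fun _ : SR => ℤ) a

theorem td_ht_apply (γ : SR → ℤ) : td_ht γ = ∑ a, γ a := by
  simp [td_ht]

theorem td_ht_ne {γ : SR → ℤ} (hγ : γ ∈ td.R) : td_ht γ ≠ 0 := by
  rw [td_ht_apply]
  intro h0
  apply td.root_ne_zero γ hγ
  rcases td.root_pos_or_neg γ hγ with h | h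
  · rw [Finset.sum_eq_zero_iff_of_nonneg (fun a _ => h a)] at h0
    ext a; exact h0 a (Finset.mem_univ a)
  · rw [Finset.sum_eq_zero_iff_of_nonpos (fun a _ => h a)] at h0
    ext a; exact h0 a (Finset.mem_univ a)

/-- the complexified height -/
def td_htC : (SR → ℤ) →+ ℂ := (Int.castAddHom ℂ).comp td_ht

/-- the complexified coordinate -/
def td_crC (a : SR) : (SR → ℤ) →+ ℂ :=
  (Int.castAddHom ℂ).comp (Pi.evalAddMonoidHom (fun _ : SR => ℤ) a)

/-- the grading element -/
def td_h : L := (td_exists_h td td_htC).choose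

theorem td_h_spec (x : L) : ⁅td_h td, x⁆ = td_D td td_htC x := (td_exists_h td td_htC).choose_spec x

/-- the fundamental coweights -/
def td_ha (a : SR) : L := (td_exists_h td (td_crC a)).choose

theorem td_ha_spec (a : SR) (x : L) : ⁅td_ha td a, x⁆ = td_D td (td_crC a) x :=
  (td_exists_h td (td_crC a)).choose_spec x

theorem td_mem_zero_of {x : L} (hx : td_D td td_htC x ∈ td.rs 0) : x ∈ td.rs 0 := by
  have h1 : ∀ γ ∈ td.R, td.proj {γ} x = 0 := by
    intro γ hγ
    have h2 := td_proj_D td td_htC γ x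
    have h3 : (0 : SR → ℤ) ∉ ({γ} : Set (SR → ℤ)) := fun h =>
      td.root_ne_zero γ hγ (Set.mem_singleton_iff.mp h).symm
    rw [td_proj_out td h3 hx] at h2
    rcases smul_eq_zero.mp h2.symm with h4 | h4
    · exact absurd (Int.cast_eq_zero.mp (show ((td_ht γ : ℤ) : ℂ) = 0 from h4)) (td_ht_ne td hγ)
    · exact h4
  have h2 := td_sum_proj td x
  have h0 : (0 : SR → ℤ) ∉ td.R := fun h => td.root_ne_zero 0 h rfl
  rw [Finset.sum_insert h0, Finset.sum_eq_zero h1, add_zero] at h2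
  rw [← h2]
  have := td.proj_mem {0} x
  simpa using this

theorem td_h_mem : td_h td ∈ td.rs 0 := by
  apply td_mem_zero_of
  rw [← td_h_spec, lie_self]; exact zero_mem _

theorem td_ha_mem (a : SR) : td_ha td a ∈ td.rs 0 := by
  apply td_mem_zero_of
  rw [← td_h_spec, ← lie_skew, td_ha_spec, td_D_apply td _ (td_h_mem td)]
  simp

/-- the annihilator of the root spaces in the Cartan subalgebra -/
def td_I : LieIdeal ℂ L where
  carrier := {z | z ∈ td.rs 0 ∧ ∀ γ ∈ td.R, ∀ x ∈ td.rs γ, ⁅z, x⁆ = 0}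
  zero_mem' := ⟨zero_mem _, fun _ _ _ _ => by simp⟩
  add_mem' := by
    rintro a b ⟨h1, h2⟩ ⟨h3, h4⟩
    exact ⟨add_mem h1 h3, fun γ hγ x hx => by rw [add_lie, h2 γ hγ x hx, h4 γ hγ x hx, add_zero]⟩
  smul_mem' := by
    rintro c a ⟨h1, h2⟩
    exact ⟨Submodule.smul_mem _ _ h1, fun γ hγ x hx => by rw [smul_lie, h2 γ hγ x hx, smul_zero]⟩
  lie_mem := by
    intro y z hz
    change z ∈ td.rs 0 ∧ ∀ γ ∈ td.R, ∀ x ∈ td.rs γ, ⁅z, x⁆ = 0 at hz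
    change ⁅y, z⁆ ∈ td.rs 0 ∧ ∀ γ ∈ td.R, ∀ x ∈ td.rs γ, ⁅⁅y, z⁆, x⁆ = 0
    obtain ⟨h1, h2⟩ := hz
    induction y using td_induction td with
    | h0 => simp
    | hadd a b ha hb =>
      refine ⟨by rw [add_lie]; exact add_mem ha.1 hb.1, fun γ hγ x hx => ?_⟩
      rw [add_lie, add_lie, ha.2 γ hγ x hx, hb.2 γ hγ x hx, add_zero]
    | hm δ y hy =>
      by_cases hδ : δ ∈ td.R
      · have : ⁅y, z⁆ = 0 := by rw [← lie_skew, h2 δ hδ y hy, neg_zero]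
        rw [this]
        exact ⟨zero_mem _, fun _ _ _ _ => by simp⟩
      · by_cases h0 : δ = 0
        · subst h0
          refine ⟨by simpa using td.bracket_mem 0 0 y hy z h1, fun γ hγ x hx => ?_⟩
          have h5 : ⁅y, x⁆ ∈ td.rs γ := by simpa using td.bracket_mem 0 γ y hy x hx
          rw [lie_lie, h2 γ hγ x hx, h2 γ hγ _ h5, lie_zero, sub_zero]
        · rw [td.rs_bot δ h0 hδ, Submodule.mem_bot] at hy
          subst hy
          simp

theorem td_exists_vec {γ : SR → ℤ} (hγ : γ ∈ td.R) : ∃ x ∈ td.rs γ, x ≠ 0 := by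
  have h1 := td.rs_dim γ hγ
  have h2 : td.rs γ ≠ ⊥ := by
    intro h; rw [h] at h1; simp at h1
  obtain ⟨x, hx, hx0⟩ := Submodule.exists_mem_ne_zero_of_ne_bot h2
  exact ⟨x, hx, hx0⟩

theorem td_I_bot [LieAlgebra.IsSimple ℂ L] : td_I td = ⊥ := by
  rcases LieAlgebra.IsSimple.eq_bot_or_eq_top (R := ℂ) (td_I td) with h | h
  · exact h
  · exfalso
    obtain ⟨x, hx, hx0⟩ := td_exists_vec td td.theta_mem
    have hx1 : x ∈ td_I td := by rw [h]; trivial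
    have hx2 : x ∈ td.rs 0 := hx1.1
    have h3 : td.proj {0} x = x := td_proj_in td (Set.mem_singleton _) hx2
    rw [td_proj_out td (S := {0}) (td.root_ne_zero _ td.theta_mem) hx] at h3
    exact hx0 h3.symm

theorem td_smul_of_zero {γ : SR → ℤ} (hγ : γ ∈ td.R) {y : L} (hy : y ∈ td.rs 0) :
    ∃ c : ℂ, ∀ x ∈ td.rs γ, ⁅y, x⁆ = c • x := by
  obtain ⟨x0, hx0, hne⟩ := td_exists_vec td hγ
  have hd := (finrank_eq_one_iff_of_nonzero' (⟨x0, hx0⟩ : td.rs γ) (by simpa using hne)).mp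
    (td.rs_dim γ hγ)
  have h1 : ⁅y, x0⁆ ∈ td.rs γ := by simpa using td.bracket_mem 0 γ y hy x0 hx0
  obtain ⟨c, hc⟩ := hd ⟨_, h1⟩
  have hc' : c • x0 = ⁅y, x0⁆ := congrArg Subtype.val hc
  refine ⟨c, fun x hx => ?_⟩
  obtain ⟨b, hb⟩ := hd ⟨x, hx⟩
  have hb' : b • x0 = x := congrArg Subtype.val hb
  rw [← hb', lie_smul, ← hc', smul_comm]

theorem td_zero_abelian [LieAlgebra.IsSimple ℂ L] {x y : L} (hx : x ∈ td.rs 0) (hy : y ∈ td.rs 0) :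
    ⁅x, y⁆ = 0 := by
  have h : ⁅x, y⁆ ∈ td_I td := by
    refine ⟨by simpa using td.bracket_mem 0 0 x hx y hy, fun γ hγ z hz => ?_⟩
    obtain ⟨a, ha⟩ := td_smul_of_zero td hγ hx
    obtain ⟨b, hb⟩ := td_smul_of_zero td hγ hy
    rw [lie_lie, hb z hz, ha z hz, lie_smul, lie_smul, ha z hz, hb z hz, smul_comm, sub_self]
  rw [td_I_bot] at h
  exact h

theorem td_mem_cartan {x : L} : x ∈ td.cartan ↔ x ∈ td.rs 0 := by
  rw [td.rs_zero]; rfl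

theorem td_isCartan [LieAlgebra.IsSimple ℂ L] : td.cartan.IsCartanSubalgebra := by
  have hab : IsLieAbelian td.cartan := ⟨fun x y => Subtype.ext
    (td_zero_abelian td ((td_mem_cartan td).mp x.2) ((td_mem_cartan td).mp y.2))⟩
  refine ⟨inferInstance, le_antisymm (fun x hx => ?_) (LieSubalgebra.le_normalizer _)⟩
  rw [LieSubalgebra.mem_normalizer_iff] at hx
  rw [td_mem_cartan]
  apply td_mem_zero_of
  rw [← td_h_spec, ← lie_skew, ← td_mem_cartan]
  exact neg_mem (hx _ ((td_mem_cartan td).mpr (td_h_mem td)))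

end TD
end CPF

namespace CPF

section TDW
open LieAlgebra.IsKilling LieModule
variable {L : Type*} [LieRing L] [LieAlgebra ℂ L]
  {SR : Type*} [Fintype SR] [DecidableEq SR] (td : TriangularData L SR)
  [FiniteDimensional ℂ L] [IsKilling ℂ L]

theorem td_proj_lie {y : L} (hy : y ∈ td.rs 0) (γ : SR → ℤ) (x : L) :
    td.proj {γ} ⁅y, x⁆ = ⁅y, td.proj {γ} x⁆ := by
  induction x using td_induction td with
  | h0 => simp
  | hadd a b ha hb => simp only [lie_add, map_add, ha, hb]
  | hm δ x hx =>
    have h1 : ⁅y, x⁆ ∈ td.rs δ := by simpa using td.bracket_mem 0 δ y hy x hx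
    by_cases h : δ = γ
    · subst h
      rw [td_proj_in td (Set.mem_singleton _) h1, td_proj_in td (Set.mem_singleton _) hx]
    · rw [td_proj_out td (S := {γ}) h h1, td_proj_out td (S := {γ}) h hx, lie_zero]

theorem td_htC_apply (γ : SR → ℤ) : td_htC γ = ((td_ht γ : ℤ) : ℂ) := rfl
theorem td_crC_apply (a : SR) (γ : SR → ℤ) : td_crC a γ = ((γ a : ℤ) : ℂ) := rfl

theorem td_exists_wt [td.cartan.IsCartanSubalgebra] {γ : SR → ℤ} (hγ : γ ∈ td.R) :
    ∃ α : Weight ℂ td.cartan L, α.IsNonZero ∧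
      (∀ y : td.cartan, ∀ x ∈ td.rs γ, ⁅(y : L), x⁆ = α y • x) ∧
      td.rs γ = (rootSpace td.cartan (α : td.cartan → ℂ)).toSubmodule := by
  have hex : ∀ y : td.cartan, ∃ c : ℂ, ∀ x ∈ td.rs γ, ⁅(y : L), x⁆ = c • x := fun y =>
    td_smul_of_zero td hγ ((td_mem_cartan td).mp y.2)
  choose f hf using hex
  have hle : td.rs γ ≤ (rootSpace td.cartan f).toSubmodule := by
    intro x hx
    apply weightSpace_le_genWeightSpace L f
    rw [mem_weightSpace]
    intro y
    exact hf y x hx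
  obtain ⟨x0, hx0, hne⟩ := td_exists_vec td hγ
  have hbot : rootSpace td.cartan f ≠ ⊥ := by
    intro h
    have := hle hx0
    rw [h] at this
    exact hne this
  let α : Weight ℂ td.cartan L := ⟨f, hbot⟩
  have hα : α.IsNonZero := by
    intro h0
    have h1 : α ⟨td_h td, (td_mem_cartan td).mpr (td_h_mem td)⟩ = 0 := by
      rw [h0]; rfl
    have h2 := hf ⟨td_h td, (td_mem_cartan td).mpr (td_h_mem td)⟩ x0 hx0
    change f _ = 0 at h1
    rw [h1] at h2
    change ⁅td_h td, x0⁆ = _ at h2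
    rw [td_h_spec, td_D_apply td _ hx0, zero_smul, td_htC_apply] at h2
    rcases smul_eq_zero.mp h2 with h3 | h3
    · exact td_ht_ne td hγ (Int.cast_eq_zero.mp h3)
    · exact hne h3
  refine ⟨α, hα, hf, ?_⟩
  apply Submodule.eq_of_le_of_finrank_eq hle
  rw [td.rs_dim γ hγ]
  exact (finrank_rootSpace_eq_one α hα).symm

/-- the weight attached to a root -/
def td_wt [td.cartan.IsCartanSubalgebra] {γ : SR → ℤ} (hγ : γ ∈ td.R) : Weight ℂ td.cartan L :=
  (td_exists_wt td hγ).choose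

theorem td_wt_spec [td.cartan.IsCartanSubalgebra] {γ : SR → ℤ} (hγ : γ ∈ td.R) :
    (td_wt td hγ).IsNonZero ∧
      (∀ y : td.cartan, ∀ x ∈ td.rs γ, ⁅(y : L), x⁆ = (td_wt td hγ) y • x) ∧
      td.rs γ = (rootSpace td.cartan ((td_wt td hγ) : td.cartan → ℂ)).toSubmodule :=
  (td_exists_wt td hγ).choose_spec

/-- the grading element in the Cartan subalgebra -/
def td_hH : td.cartan := ⟨td_h td, (td_mem_cartan td).mpr (td_h_mem td)⟩

/-- the fundamental coweights in the Cartan subalgebra -/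
def td_haH (a : SR) : td.cartan := ⟨td_ha td a, (td_mem_cartan td).mpr (td_ha_mem td a)⟩

theorem td_wt_h [td.cartan.IsCartanSubalgebra] {γ : SR → ℤ} (hγ : γ ∈ td.R) :
    td_wt td hγ (td_hH td) = ((td_ht γ : ℤ) : ℂ) := by
  obtain ⟨x0, hx0, hne⟩ := td_exists_vec td hγ
  have h2 := (td_wt_spec td hγ).2.1 (td_hH td) x0 hx0
  change ⁅td_h td, x0⁆ = _ at h2
  rw [td_h_spec, td_D_apply td _ hx0, td_htC_apply] at h2
  exact (smul_left_injective ℂ hne h2).symm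

theorem td_wt_ha [td.cartan.IsCartanSubalgebra] {γ : SR → ℤ} (hγ : γ ∈ td.R) (a : SR) :
    td_wt td hγ (td_haH td a) = ((γ a : ℤ) : ℂ) := by
  obtain ⟨x0, hx0, hne⟩ := td_exists_vec td hγ
  have h2 := (td_wt_spec td hγ).2.1 (td_haH td a) x0 hx0
  change ⁅td_ha td a, x0⁆ = _ at h2
  rw [td_ha_spec, td_D_apply td _ hx0, td_crC_apply] at h2
  exact (smul_left_injective ℂ hne h2).symm

theorem td_wt_surj [td.cartan.IsCartanSubalgebra] [LieAlgebra.IsSimple ℂ L]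
    (β : Weight ℂ td.cartan L) (hβ : β.IsNonZero) :
    ∃ γ, ∃ hγ : γ ∈ td.R, β = td_wt td hγ := by
  obtain ⟨x, hx, hx0⟩ := β.exists_ne_zero
  have hxy : ∀ y : td.cartan, ⁅(y : L), x⁆ = β y • x := fun y =>
    lie_eq_smul_of_mem_rootSpace hx y
  have h1 : ∃ γ ∈ insert 0 td.R, td.proj {γ} x ≠ 0 := by
    by_contra hc
    push Not at hc
    apply hx0
    rw [← td_sum_proj td x]
    exact Finset.sum_eq_zero hc
  obtain ⟨γ, hγ, hp⟩ := h1
  have hpm : td.proj {γ} x ∈ td.rs γ := by simpa using td.proj_mem {γ} x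
  have h2 : ∀ y : td.cartan, ⁅(y : L), td.proj {γ} x⁆ = β y • td.proj {γ} x := by
    intro y
    rw [← td_proj_lie td ((td_mem_cartan td).mp y.2), hxy, map_smul]
  rcases Finset.mem_insert.mp hγ with h0 | hγ
  · exfalso
    subst h0
    apply hβ
    ext y
    have h3 := h2 y
    rw [td_zero_abelian td ((td_mem_cartan td).mp y.2) hpm] at h3
    rcases smul_eq_zero.mp h3.symm with h | h
    · exact h
    · exact absurd h hp
  · refine ⟨γ, hγ, ?_⟩
    ext y
    have h3 := h2 y
    rw [(td_wt_spec td hγ).2.1 y _ hpm] at h3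
    exact (smul_left_injective ℂ hp h3).symm

theorem td_hh [td.cartan.IsCartanSubalgebra] [LieAlgebra.IsSimple ℂ L]
    (β : Weight ℂ td.cartan L) (hβ : β.IsNonZero) :
    ∃ n : ℤ, n ≠ 0 ∧ β (td_hH td) = n := by
  obtain ⟨γ, hγ, rfl⟩ := td_wt_surj td β hβ
  exact ⟨td_ht γ, td_ht_ne td hγ, td_wt_h td hγ⟩

/-- coordinates to lattice -/
def td_v [td.cartan.IsCartanSubalgebra] (γ : SR → ℤ) : Lat td.cartan (td_hH td) :=
  if hγ : γ ∈ td.R then ⟨(td_wt td hγ).toLinear, mem_Lat _ _ (td_wt_h td hγ)⟩ else 0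

theorem td_v_coe [td.cartan.IsCartanSubalgebra] {γ : SR → ℤ} (hγ : γ ∈ td.R) :
    (td_v td γ).1 = (td_wt td hγ).toLinear := by
  rw [td_v, dif_pos hγ]

theorem td_v_ha [td.cartan.IsCartanSubalgebra] {γ : SR → ℤ} (hγ : γ ∈ td.R) (a : SR) :
    (td_v td γ).1 (td_haH td a) = ((γ a : ℤ) : ℂ) := by
  rw [td_v_coe td hγ]; exact td_wt_ha td hγ a

theorem td_v_mem [td.cartan.IsCartanSubalgebra] [LieAlgebra.IsSimple ℂ L]
    (m : Lat td.cartan (td_hH td)) :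
    m ∈ LatR td.cartan (td_hH td) ↔ ∃ γ ∈ td.R, m = td_v td γ := by
  constructor
  · rintro ⟨α, hα, hm⟩
    obtain ⟨γ, hγ, rfl⟩ := td_wt_surj td α hα
    exact ⟨γ, hγ, Subtype.ext (hm.trans (td_v_coe td hγ).symm)⟩
  · rintro ⟨γ, hγ, rfl⟩
    exact ⟨td_wt td hγ, (td_wt_spec td hγ).1, td_v_coe td hγ⟩

theorem td_link.{u, w} {L : Type u} [LieRing L] [LieAlgebra ℂ L]
    {SR : Type w} [Fintype SR] [DecidableEq SR] (td : TriangularData L SR)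
    [FiniteDimensional ℂ L] [IsKilling ℂ L] [LieAlgebra.IsSimple ℂ L] :
    ∃ (M : Type u) (_ : AddCommGroup M) (R : RS M) (S : Setup L R) (v : (SR → ℤ) → M),
      (∀ m, m ∈ R.Φ ↔ ∃ γ ∈ td.R, m = v γ) ∧
      (∀ γ ∈ td.R, ∀ δ ∈ td.R, ∀ ε ∈ td.R, v ε = v γ + v δ → ε = γ + δ) ∧
      (∀ γ ∈ td.R, ∀ δ ∈ td.R, v γ = v δ → γ = δ) ∧
      (∀ γ ∈ td.R, v (-γ) = - v γ) ∧
      (∀ γ ∈ td.R, R.ht (v γ) = ∑ a, γ a) ∧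
      (∀ γ ∈ td.R, td.rs γ = Submodule.span ℂ {S.e (v γ)}) ∧
      (∀ γ ∈ td.R, ∀ x ∈ td.rs 0, killingForm ℂ L (S.e (v γ)) x = 0) := by
  have := td_isCartan td
  have hh := td_hh td
  obtain ⟨e, he⟩ := exists_rootVectors (td_hH td) hh
  have hinj : ∀ γ ∈ td.R, ∀ δ ∈ td.R, td_v td γ = td_v td δ → γ = δ := by
    intro γ hγ δ hδ h
    ext a
    have h1 := td_v_ha td hγ a
    rw [h, td_v_ha td hδ a] at h1
    exact (Int.cast_injective h1).symm
  refine ⟨Lat td.cartan (td_hH td), inferInstance, LatRS td.cartan (td_hH td) hh,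
    LatSetup (td_hH td) hh e he, td_v td, td_v_mem td, ?_, hinj, ?_, ?_, ?_, ?_⟩
  · intro γ hγ δ hδ ε hε h
    ext a
    have h1 := td_v_ha td hε a
    rw [h] at h1
    change (td_v td γ).1 (td_haH td a) + (td_v td δ).1 (td_haH td a) = _ at h1
    rw [td_v_ha td hγ a, td_v_ha td hδ a] at h1
    exact_mod_cast h1.symm
  · intro γ hγ
    have h1 : - td_v td γ ∈ LatR td.cartan (td_hH td) :=
      (LatRS td.cartan (td_hH td) hh).neg_mem _ ((td_v_mem td _).mpr ⟨γ, hγ, rfl⟩)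
    obtain ⟨δ, hδ, hd⟩ := (td_v_mem td _).mp h1
    have : δ = -γ := by
      ext a
      have h1 := td_v_ha td hδ a
      rw [← hd] at h1
      change -(td_v td γ).1 (td_haH td a) = _ at h1
      rw [td_v_ha td hγ a] at h1
      exact_mod_cast h1.symm
    rw [← this, hd]
  · intro γ hγ
    have h1 : ((Latht td.cartan (td_hH td) (td_v td γ) : ℤ) : ℂ) = _ := Latht_cast _ _ _
    rw [td_v_coe td hγ] at h1
    change _ = td_wt td hγ (td_hH td) at h1
    rw [td_wt_h, td_ht_apply] at h1
    exact Int.cast_injective h1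
  · intro γ hγ
    change _ = Submodule.span ℂ {e (td_v td γ)}
    have hm := (td_v_mem td _).mpr ⟨γ, hγ, rfl⟩
    have h1 := (he _ hm).1
    have h0 := rootVec_ne (td_hH td) he hm
    have h2 : e (td_v td γ) ∈ td.rs γ := by
      rw [(td_wt_spec td hγ).2.2]
      rw [coe_eq_of (td_hH td) (td_v_coe td hγ)] at h1
      exact h1
    symm
    apply Submodule.eq_of_le_of_finrank_eq
    · rw [Submodule.span_singleton_le_iff_mem]; exact h2
    · rw [finrank_span_singleton h0, td.rs_dim γ hγ]
  · intro γ hγ x hx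
    have hm := (td_v_mem td _).mpr ⟨γ, hγ, rfl⟩
    have h1 := (he _ hm).1
    have h2 : x ∈ rootSpace td.cartan (0 : td.cartan → ℂ) := by
      rw [rootSpace_zero_eq]
      exact (td_mem_cartan td).mpr hx
    refine killingForm_apply_eq_zero_of_mem_rootSpace_of_add_ne_zero ℂ L td.cartan h1 h2 ?_
    rw [add_zero, coe_eq_of (td_hH td) (td_v_coe td hγ)]
    exact (td_wt_spec td hγ).1

end TDW
end CPF

namespace CPF

/-- compatibility between a triangular decomposition and the abstract setup -/
structure Link {L : Type*} [LieRing L] [LieAlgebra ℂ L]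
    {SR : Type*} [Fintype SR] [DecidableEq SR] (td : TriangularData L SR)
    {M : Type*} [AddCommGroup M] {R : RS M} (S : Setup L R) (v : (SR → ℤ) → M) : Prop where
  mem : ∀ m, m ∈ R.Φ ↔ ∃ γ ∈ td.R, m = v γ
  add : ∀ γ ∈ td.R, ∀ δ ∈ td.R, ∀ ε ∈ td.R, v ε = v γ + v δ → ε = γ + δ
  inj : ∀ γ ∈ td.R, ∀ δ ∈ td.R, v γ = v δ → γ = δ
  neg : ∀ γ ∈ td.R, v (-γ) = - v γ
  ht : ∀ γ ∈ td.R, R.ht (v γ) = ∑ a, γ a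
  rs : ∀ γ ∈ td.R, td.rs γ = Submodule.span ℂ {S.e (v γ)}
  kz : ∀ γ ∈ td.R, ∀ x ∈ td.rs 0, killingForm ℂ L (S.e (v γ)) x = 0

namespace Link
open MvPolynomial
variable {L : Type*} [LieRing L] [LieAlgebra ℂ L]
    {SR : Type*} [Fintype SR] [DecidableEq SR] {td : TriangularData L SR}
    {M : Type*} [AddCommGroup M] {R : RS M} {S : Setup L R} {v : (SR → ℤ) → M}
    (T : Finset SR)

theorem td_sum_ne (td : TriangularData L SR) {γ : SR → ℤ} (hγ : γ ∈ td.R) : ∑ a, γ a ≠ 0 := by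
  intro h0
  apply td.root_ne_zero γ hγ
  rcases td.root_pos_or_neg γ hγ with h | h
  · rw [Finset.sum_eq_zero_iff_of_nonneg (fun a _ => h a)] at h0
    ext a; exact h0 a (Finset.mem_univ a)
  · rw [Finset.sum_eq_zero_iff_of_nonpos (fun a _ => h a)] at h0
    ext a; exact h0 a (Finset.mem_univ a)

theorem mem_pos {γ : SR → ℤ} : γ ∈ td.posR ↔ γ ∈ td.R ∧ ∀ a, 0 ≤ γ a := by
  simp [TriangularData.posR]

theorem mem_nil {γ : SR → ℤ} :
    γ ∈ td.nilRoots T ↔ γ ∈ td.R ∧ (∀ a, 0 ≤ γ a) ∧ ∃ a ∈ T, 0 < γ a := by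
  simp [TriangularData.nilRoots, TriangularData.posR, and_assoc]

theorem ht_pos_iff (K : Link td S v) {γ : SR → ℤ} (hγ : γ ∈ td.R) :
    0 < R.ht (v γ) ↔ ∀ a, 0 ≤ γ a := by
  rw [K.ht γ hγ]
  have hne : ∑ a, γ a ≠ 0 := td_sum_ne td hγ
  constructor
  · intro h
    rcases td.root_pos_or_neg γ hγ with h1 | h1
    · exact h1
    · have := Finset.sum_nonpos (s := Finset.univ) (fun a _ => h1 a)
      omega
  · intro h
    have := Finset.sum_nonneg (s := Finset.univ) (fun a _ => h a)
    omega

/-- the lattice roots of the nilradical -/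
def N (v : (SR → ℤ) → M) (td : TriangularData L SR) (T : Finset SR) : Finset M :=
  (td.nilRoots T).image v

theorem mem_N {m : M} : m ∈ N v td T ↔ ∃ γ ∈ td.nilRoots T, v γ = m := by
  simp [N]

theorem upper (K : Link td S v) : Upper R (N v td T : Set M) := by
  refine ⟨?_, ?_, ?_⟩
  · intro m hm
    obtain ⟨γ, hγ, rfl⟩ := (mem_N T).mp hm
    exact (K.mem _).mpr ⟨γ, ((mem_nil T).mp hγ).1, rfl⟩
  · intro m hm
    obtain ⟨γ, hγ, rfl⟩ := (mem_N T).mp hm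
    exact (K.ht_pos_iff ((mem_nil T).mp hγ).1).mpr ((mem_nil T).mp hγ).2.1
  · intro m hm α hα hp hs
    obtain ⟨γ, hγ, rfl⟩ := (mem_N T).mp hm
    obtain ⟨hγR, hγ0, a, haT, ha⟩ := (mem_nil T).mp hγ
    obtain ⟨δ, hδ, rfl⟩ := (K.mem _).mp hα
    have hδ0 := (K.ht_pos_iff hδ).mp hp
    obtain ⟨ε, hε, he⟩ := (K.mem _).mp hs
    have h1 := K.add γ hγR δ hδ ε hε he.symm
    refine (mem_N T).mpr ⟨ε, (mem_nil T).mpr ⟨hε, ?_, a, haT, ?_⟩, he.symm⟩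
    · intro b; rw [h1, Pi.add_apply]; exact add_nonneg (hγ0 b) (hδ0 b)
    · rw [h1, Pi.add_apply]; have := hδ0 a; omega

theorem e_mem_rs (K : Link td S v) {γ : SR → ℤ} (hγ : γ ∈ td.R) : S.e (v γ) ∈ td.rs γ := by
  rw [K.rs γ hγ]; exact Submodule.mem_span_singleton_self _

theorem nilrad_eq (K : Link td S v) : (td.nilrad T).toSubmodule = S.n (N v td T) := by
  have hU := K.upper T
  apply le_antisymm
  · let A : LieSubalgebra ℂ L := { S.n (N v td T) with
      lie_mem' := fun {x y} hx hy => S.n_lie hU hx hy }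
    have hA : td.nilrad T ≤ A := by
      rw [TriangularData.nilrad, LieSubalgebra.lieSpan_le]
      intro x hx
      simp only [Set.mem_iUnion] at hx
      obtain ⟨γ, hγ, hx⟩ := hx
      have hγ' : γ ∈ td.nilRoots T := hγ
      have hR := ((mem_nil T).mp hγ').1
      change x ∈ td.rs γ at hx
      rw [K.rs γ hR] at hx
      change x ∈ S.n (N v td T)
      refine (Submodule.span_singleton_le_iff_mem _ _).mpr ?_ hx
      exact S.e_mem_n _ ((mem_N T).mpr ⟨γ, hγ', rfl⟩)
    exact hA
  · rw [Setup.n, Submodule.span_le]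
    rintro _ ⟨m, hm, rfl⟩
    obtain ⟨γ, hγ, rfl⟩ := (mem_N T).mp hm
    apply LieSubalgebra.subset_lieSpan
    simp only [Set.mem_iUnion]
    exact ⟨γ, hγ, K.e_mem_rs ((mem_nil T).mp hγ).1⟩

theorem mem_nilrad (K : Link td S v) {x : L} : x ∈ td.nilrad T ↔ x ∈ S.n (N v td T) := by
  rw [← K.nilrad_eq T]; rfl

theorem n_univ (K : Link td S v) : S.n (N v td Finset.univ) = S.u := by
  rw [Setup.n, Setup.u]
  congr 2
  ext m
  constructor
  · intro hm
    exact ⟨(K.upper Finset.univ).sub hm, (K.upper Finset.univ).pos m hm⟩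
  · rintro ⟨hm, hp⟩
    obtain ⟨γ, hγ, rfl⟩ := (K.mem _).mp hm
    have h0 := (K.ht_pos_iff hγ).mp hp
    refine (mem_N _).mpr ⟨γ, (mem_nil _).mpr ⟨hγ, h0, ?_⟩, rfl⟩
    by_contra hc
    push Not at hc
    apply td.root_ne_zero γ hγ
    ext a
    exact le_antisymm (hc a (Finset.mem_univ a)) (h0 a)

theorem negNil_eq (K : Link td S v) : td.negNilSub T = LinearMap.range (S.pt (N v td T)) := by
  apply le_antisymm
  · refine iSup₂_le fun δ hδ => ?_
    obtain ⟨γ, hγ, rfl⟩ := hδ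
    have hγ' : γ ∈ td.nilRoots T := hγ
    have hR := ((mem_nil T).mp hγ').1
    change td.rs (-γ) ≤ _
    rw [K.rs _ (td.root_neg γ hR), Submodule.span_singleton_le_iff_mem, K.neg γ hR]
    have hN : v γ ∈ N v td T := (mem_N T).mpr ⟨γ, hγ', rfl⟩
    refine ⟨Pi.single ⟨v γ, hN⟩ 1, ?_⟩
    rw [Setup.pt_apply, Finset.sum_eq_single ⟨v γ, hN⟩]
    · simp
    · intro b _ hb; rw [Pi.single_eq_of_ne hb, zero_smul]
    · simp
  · rintro _ ⟨c, rfl⟩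
    rw [Setup.pt_apply]
    refine Submodule.sum_mem _ fun η _ => Submodule.smul_mem _ _ ?_
    obtain ⟨γ, hγ, he⟩ := (mem_N T).mp η.2
    have hR := ((mem_nil T).mp hγ).1
    rw [← he, ← K.neg γ hR]
    exact td_mem_bi td (S := td.negSet T) ⟨γ, hγ, rfl⟩ (K.e_mem_rs (td.root_neg γ hR))

theorem pt_mem (K : Link td S v) (c : ↥(N v td T) → ℂ) : S.pt (N v td T) c ∈ td.negNilSub T := by
  rw [K.negNil_eq T]; exact ⟨c, rfl⟩

theorem exists_ptE (K : Link td S v) : ∃ E : (↥(N v td T) → ℂ) ≃ₗ[ℂ] ↥(td.negNilSub T),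
    ∀ c, (E c : L) = S.pt (N v td T) c := by
  refine ⟨LinearEquiv.ofBijective ((S.pt (N v td T)).codRestrict _ (K.pt_mem T)) ⟨?_, ?_⟩,
    fun c => rfl⟩
  · intro c d h
    have h1 : S.pt (N v td T) c = S.pt (N v td T) d := congrArg Subtype.val h
    ext γ
    rw [← S.kill_pt (K.upper T) γ c, h1, S.kill_pt (K.upper T)]
  · rintro ⟨w, hw⟩
    rw [K.negNil_eq T] at hw
    obtain ⟨c, hc⟩ := hw
    exact ⟨c, Subtype.ext hc⟩

theorem finrank_killStab (K : Link td S v) (c : ↥(N v td T) → ℂ) :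
    finrank ℂ (killStab (S.pt (N v td T) c) (td.nilrad T) (td.nilrad T)) =
      finrank ℂ (S.stab c) := by
  have h : killStab (S.pt (N v td T) c) (td.nilrad T) (td.nilrad T) =
      (S.stab c).map (S.n (N v td T)).subtype := by
    ext x
    constructor
    · rintro ⟨h1, h2⟩
      refine ⟨⟨x, (K.mem_nilrad T).mp h1⟩, ?_, rfl⟩
      refine S.mem_stab.mpr fun y => h2 _ ((K.mem_nilrad T).mpr y.2)
    · rintro ⟨x, hx, rfl⟩
      exact ⟨(K.mem_nilrad T).mpr x.2, fun y hy => S.mem_stab.mp hx ⟨y, (K.mem_nilrad T).mp hy⟩⟩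
  rw [h]
  exact Submodule.finrank_map_subtype_eq _ _

theorem nilIndex_spec (K : Link td S v) : ∃ c0 : ↥(N v td T) → ℂ, td.nilIndex T = finrank ℂ (S.stab c0) ∧
    ∀ c : ↥(N v td T) → ℂ, finrank ℂ (S.stab c0) ≤ finrank ℂ (S.stab c) := by
  obtain ⟨E, hE⟩ := K.exists_ptE T
  obtain ⟨w, hw⟩ : ∃ w : ↥(td.negNilSub T),
      finrank ℂ (killStab (w : L) (td.nilrad T) (td.nilrad T)) = td.nilIndex T := by
    have := Nat.sInf_mem (Set.range_nonempty fun w : ↥(td.negNilSub T) =>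
      finrank ℂ (killStab (w : L) (td.nilrad T) (td.nilrad T)))
    exact this
  have hle : ∀ w : ↥(td.negNilSub T), td.nilIndex T ≤
      finrank ℂ (killStab (w : L) (td.nilrad T) (td.nilrad T)) := fun w =>
    ciInf_le (OrderBot.bddBelow _) w
  refine ⟨E.symm w, ?_, fun c => ?_⟩
  · rw [← K.finrank_killStab T, ← hE, E.apply_symm_apply, hw]
  · have h1 := hle (E c)
    rw [hE, K.finrank_killStab T, ← hw] at h1
    rw [← K.finrank_killStab T (E.symm w), ← hE, E.apply_symm_apply]
    exact h1

theorem free_of_CP (K : Link td S v) [FiniteDimensional ℂ L] (hCP : ∃ a : LieSubalgebra ℂ L, a ≤ td.nilrad T ∧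
      (∀ x ∈ a, ∀ y ∈ a, ⁅x, y⁆ = 0) ∧
      2 * Module.finrank ℂ a.toSubmodule =
        Module.finrank ℂ (td.nilrad T).toSubmodule + td.nilIndex T) :
    Module.Free (S.A' (N v td T)) (MvPolynomial ↥(N v td T) ℂ) := by
  obtain ⟨a, han, hab, hd⟩ := hCP
  have hU := K.upper T
  obtain ⟨G⟩ := exists_greedy R (N v td T) hU.sub
  obtain ⟨c0, h0, hmin⟩ := K.nilIndex_spec T
  refine S.free_A' G hU (S.hab_of_CP G hU (a.toSubmodule.comap (S.n (N v td T)).subtype) ?_ c0 hmin ?_)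
  · intro x hx y hy
    exact hab _ hx _ hy
  · rw [K.nilrad_eq T, h0] at hd
    have h1 : a.toSubmodule ≤ S.n (N v td T) := fun x hx => (K.mem_nilrad T).mp (han hx)
    rw [(Submodule.comapSubtypeEquivOfLe h1).finrank_eq]
    exact hd

theorem kill_proj (K : Link td S v) (γ : ↥(N v td T)) (y : L) :
    killingForm ℂ L (S.e γ) (td.proj (td.negSet T) y) = killingForm ℂ L (S.e γ) y := by
  have h1 : ⨆ δ ∈ (td.negSet T)ᶜ, td.rs δ ≤ LinearMap.ker (killingForm ℂ L (S.e γ)) := by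
    obtain ⟨γ0, hγ0, he⟩ := (mem_N T).mp γ.2
    have hR := ((mem_nil T).mp hγ0).1
    refine iSup₂_le fun δ hδ => ?_
    by_cases hδR : δ ∈ td.R
    · rw [K.rs δ hδR, Submodule.span_singleton_le_iff_mem, LinearMap.mem_ker, ← he,
        S.kill _ ((K.mem _).mpr ⟨_, hR, rfl⟩) _ ((K.mem _).mpr ⟨_, hδR, rfl⟩), if_neg]
      intro h
      apply hδ
      have h2 : v δ = v (-γ0) := by rw [K.neg γ0 hR]; exact (neg_eq_of_add_eq_zero_right h).symm
      exact ⟨γ0, hγ0, (K.inj _ hδR _ (td.root_neg γ0 hR) h2).symm⟩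
    · by_cases h0 : δ = 0
      · subst h0
        intro x hx
        rw [LinearMap.mem_ker, ← he]
        exact K.kz _ hR x hx
      · rw [td.rs_bot δ h0 hδR]; exact bot_le
  have h2 := h1 (td.proj_compl (td.negSet T) y)
  rw [LinearMap.mem_ker, map_sub, sub_eq_zero] at h2
  exact h2.symm

theorem coact_eq (K : Link td S v) (E : (↥(N v td T) → ℂ) ≃ₗ[ℂ] ↥(td.negNilSub T))
    (hE : ∀ c, (E c : L) = S.pt (N v td T) c) (x : L) (c : ↥(N v td T) → ℂ) :
    td.coactOn T x (E c) = E (S.act (N v td T) x c) := by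
  obtain ⟨d, hd⟩ := E.surjective (td.coactOn T x (E c))
  rw [← hd]
  congr 1
  ext γ
  rw [← S.kill_pt (K.upper T) γ d, ← hE, hd]
  change killingForm ℂ L (S.e γ) (td.proj _ (nilExp _ (E c : L))) = _
  rw [K.kill_proj T, hE]
  rfl

theorem exists_polyE (K : Link td S v) (E : (↥(N v td T) → ℂ) ≃ₗ[ℂ] ↥(td.negNilSub T)) :
    ∃ F : MvPolynomial ↥(N v td T) ℂ ≃ₐ[ℂ] ↥(td.polyAlg T),
      ∀ f c, (F f : ↥(td.negNilSub T) → ℂ) (E c) = eval c f := by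
  let P : MvPolynomial ↥(N v td T) ℂ →ₐ[ℂ] (↥(td.negNilSub T) → ℂ) :=
    aeval fun γ => fun w => E.symm w γ
  have hP : ∀ f w, P f w = eval (E.symm w) f := by
    intro f w
    induction f using MvPolynomial.induction_on with
    | C a => simp [P]
    | add p q hp hq => simp only [map_add, Pi.add_apply, hp, hq]
    | mul_X p γ hp => simp only [map_mul, Pi.mul_apply, hp, eval_X]; simp [P]
  have hinj : Function.Injective P := by
    intro f g h
    apply MvPolynomial.funext
    intro c
    have := congrFun h (E c)
    rwa [hP, hP, E.symm_apply_apply] at this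
  have hr : P.range = td.polyAlg T := by
    rw [← Algebra.adjoin_range_eq_range_aeval, TriangularData.polyAlg]
    apply le_antisymm
    · apply Algebra.adjoin_mono
      rintro _ ⟨γ, rfl⟩
      exact ⟨(LinearMap.proj γ).comp E.symm.toLinearMap, rfl⟩
    · apply Algebra.adjoin_le
      rintro _ ⟨l, rfl⟩
      have h1 : (l : ↥(td.negNilSub T) → ℂ) =
          ∑ γ : ↥(N v td T), l (E (Pi.single γ 1)) • fun w => E.symm w γ := by
        funext w
        rw [Finset.sum_apply]
        conv_lhs => rw [← E.apply_symm_apply w, pi_eq_sum_univ' (E.symm w)]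
        simp only [map_sum, map_smul, smul_eq_mul, Pi.smul_apply]
        refine Finset.sum_congr rfl fun γ _ => ?_
        rw [mul_comm]
      change (l : ↥(td.negNilSub T) → ℂ) ∈ _
      rw [h1]
      exact Subalgebra.sum_mem _ fun γ _ =>
        Subalgebra.smul_mem _ (Algebra.subset_adjoin (Set.mem_range_self γ)) _
  refine ⟨(AlgEquiv.ofInjective P hinj).trans (Subalgebra.equivOfEq _ _ hr), fun f c => ?_⟩
  change P f (E c) = _
  rw [hP, E.symm_apply_apply]

theorem final (K : Link td S v) [FiniteDimensional ℂ L] (hCP : ∃ a : LieSubalgebra ℂ L, a ≤ td.nilrad T ∧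
      (∀ x ∈ a, ∀ y ∈ a, ⁅x, y⁆ = 0) ∧
      2 * Module.finrank ℂ a.toSubmodule =
        Module.finrank ℂ (td.nilrad T).toSubmodule + td.nilIndex T) :
    Module.Free ↥(td.invAlg T (td.nilrad Finset.univ)) ↥(td.polyAlg T) := by
  have hfree := K.free_of_CP T hCP
  have hU := K.upper T
  obtain ⟨E, hE⟩ := K.exists_ptE T
  obtain ⟨F, hF⟩ := K.exists_polyE T E
  have hu : ∀ x, x ∈ td.nilrad Finset.univ ↔ x ∈ S.u := fun x => by
    rw [K.mem_nilrad, K.n_univ]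
  have hmem : ∀ f, F f ∈ td.invAlg T (td.nilrad Finset.univ) ↔ f ∈ S.A' (N v td T) := by
    intro f
    constructor
    · intro h
      refine S.A'_of_inv hU fun α ha hp s c => ?_
      have h1 := h (s • S.e α) ((hu _).mpr (Submodule.smul_mem _ _ (S.e_mem_u ha hp))) (E c)
      rw [K.coact_eq T E hE, hF, hF] at h1
      exact h1
    · intro h x hx w
      obtain ⟨c, rfl⟩ := E.surjective w
      rw [K.coact_eq T E hE, hF, hF]
      exact S.A'_inv hU h ((hu x).mp hx) c
  have hmap : (S.A' (N v td T)).map F.toAlgHom = td.invAlg T (td.nilrad Finset.univ) := by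
    ext g
    constructor
    · rintro ⟨f, hf, rfl⟩
      exact (hmem f).mpr hf
    · intro hg
      refine ⟨F.symm g, (hmem _).mp ?_, F.apply_symm_apply g⟩
      rw [F.apply_symm_apply]; exact hg
  let e1 : S.A' (N v td T) ≃+* td.invAlg T (td.nilrad Finset.univ) :=
    (((S.A' (N v td T)).equivMapOfInjective F.toAlgHom F.injective).trans
      (Subalgebra.equivOfEq _ _ hmap)).toRingEquiv
  have he1 : ∀ r, ((e1 r : ↥(td.polyAlg T))) = F r := fun r => rfl
  have i1 := RingHomInvPair.of_ringEquiv e1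
  have i2 := RingHomInvPair.of_ringEquiv e1.symm
  let e2 : MvPolynomial ↥(N v td T) ℂ ≃ₛₗ[(e1 : S.A' (N v td T) →+* td.invAlg T (td.nilrad Finset.univ))] ↥(td.polyAlg T) :=
    { F.toRingEquiv.toAddEquiv with
      map_smul' := fun r f => by
        change F (r.1 * f) = (e1 r : ↥(td.polyAlg T)) * F f
        rw [map_mul, he1] }
  exact Module.Free.of_equiv e2

end Link

theorem main.{u, w} {L : Type u} [LieRing L] [LieAlgebra ℂ L] [FiniteDimensional ℂ L]
    [LieAlgebra.IsSimple ℂ L]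
    {SR : Type w} [Fintype SR] [DecidableEq SR]
    (td : TriangularData L SR) (T : Finset SR)
    (hCP : ∃ a : LieSubalgebra ℂ L, a ≤ td.nilrad T ∧
      (∀ x ∈ a, ∀ y ∈ a, ⁅x, y⁆ = 0) ∧
      2 * Module.finrank ℂ a.toSubmodule =
        Module.finrank ℂ (td.nilrad T).toSubmodule + td.nilIndex T) :
    Module.Free ↥(td.invAlg T (td.nilrad Finset.univ)) ↥(td.polyAlg T) := by
  obtain ⟨M, i, R, S, v, h1, h2, h3, h4, h5, h6, h7⟩ := td_link td
  have K : Link td S v := ⟨h1, h2, h3, h4, h5, h6, h7⟩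
  exact K.final T hCP

end CPF

/-- Let `n = n_T` be a nilradical in a complex simple Lie algebra `g`
that admits a commutative polarisation (an abelian subalgebra `a ⊆ n` with
`dim a = b(n)`).  Then `S(n)` is a free module over `S(n)^U`, where `U = exp(u)`. -/
theorem free_over_U_invariants_of_CP
    {L : Type*} [LieRing L] [LieAlgebra ℂ L] [FiniteDimensional ℂ L]
    [LieAlgebra.IsSimple ℂ L]
    {SR : Type*} [Fintype SR] [DecidableEq SR]
    (td : TriangularData L SR)
    (K : Finset (SR → ℤ)) (hK : td.IsCascade K)
    (T : Finset SR)
    (hCP : ∃ a : LieSubalgebra ℂ L, a ≤ td.nilrad T ∧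
      (∀ x ∈ a, ∀ y ∈ a, ⁅x, y⁆ = 0) ∧
      2 * Module.finrank ℂ a.toSubmodule =
        Module.finrank ℂ (td.nilrad T).toSubmodule + td.nilIndex T) :
    Module.Free ↥(td.invAlg T (td.nilrad Finset.univ)) ↥(td.polyAlg T) := by
  exact CPF.main td T hCP

end
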